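/- Let 2 ≤ p < ∞. There exists a constant C_p > 0 depending only on p (in particular independent of the dimension d) such that for every d ≥ 1 and every f ∈ ℓ_p(ℤ^d; ℂ), the dyadic maximal function satisfies ‖ sup_{N ∈ 𝔻} |M_N^B f| ‖_{ℓ_p(ℤ^d)} ≤ C_p ‖f‖_{ℓ_p(ℤ^d)}. (This is the scalar-valued case of the paper's main Theorem 1.1.) -/

import Mathlib

open MeasureTheory ENNReal

/-- The set of lattice points in the closed Euclidean ball of radius `N`
centered at the origin of `ℝ^d`. -/
def latticeBallSet (d : ℕ) (N : ℝ) : Set (Fin d → ℤ) :=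
  {y | ∑ j, ((y j : ℝ)) ^ 2 ≤ N ^ 2}

/-- The discrete Hardy–Littlewood averaging operator over the Euclidean ball
of radius `N`: `M_N^B f (x) = (1/#(B_N ∩ ℤ^d)) ∑_{y ∈ B_N ∩ ℤ^d} f (x - y)`. -/
noncomputable def ballAvg (d : ℕ) (N : ℝ) (f : (Fin d → ℤ) → ℂ) (x : Fin d → ℤ) : ℂ :=
  (∑ᶠ y ∈ latticeBallSet d N, f (x - y)) / ((latticeBallSet d N).ncard : ℂ)

/-- The `ℓ_p` norm on `ℤ^d` of an `ℝ≥0∞`-valued function. -/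
noncomputable def lpNorm (d : ℕ) (p : ℝ) (g : (Fin d → ℤ) → ℝ≥0∞) : ℝ≥0∞ :=
  (∑' x : Fin d → ℤ, (g x) ^ p) ^ (1 / p)

/-- The lattice points `x ∈ ℤ^d` with `|x|² ≤ R`. -/
noncomputable def latticeBall (d R : ℕ) : Finset (Fin d → ℤ) :=
  (Fintype.piFinset fun _ => Finset.Icc (-(R : ℤ)) R).filter fun x => ∑ j, x j ^ 2 ≤ (R : ℤ)

theorem mem_latticeBall {d R : ℕ} {x : Fin d → ℤ} :
    x ∈ latticeBall d R ↔ ∑ j, x j ^ 2 ≤ (R : ℤ) := by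
  simp only [latticeBall, Finset.mem_filter, Fintype.mem_piFinset, Finset.mem_Icc,
    and_iff_right_iff_imp]
  intro h j
  have h1 : x j ^ 2 ≤ ∑ j, x j ^ 2 :=
    Finset.single_le_sum (f := fun j => x j ^ 2) (fun i _ => sq_nonneg _) (Finset.mem_univ j)
  constructor <;> nlinarith [sq_nonneg (x j), Int.le_self_sq (x j), Int.le_self_sq (- x j)]

theorem latticeBall_nonempty (d R : ℕ) : (latticeBall d R).Nonempty :=
  ⟨0, by simp [mem_latticeBall]⟩

theorem latticeBall_card_pos (d R : ℕ) : (0 : ℝ) < (latticeBall d R).card := by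
  exact_mod_cast (latticeBall_nonempty d R).card_pos

/-- Half the length of the segment obtained by slicing a ball along a coordinate line
over the point `y`. -/
noncomputable def halfWidth {n : ℕ} (R : ℕ) (y : Fin n → ℤ) : ℕ :=
  Nat.sqrt ((R : ℤ) - ∑ j, y j ^ 2).toNat

theorem mem_Icc_sqrt_iff (T : ℕ) (a : ℤ) :
    a ∈ Finset.Icc (-(Nat.sqrt T : ℤ)) (Nat.sqrt T) ↔ a ^ 2 ≤ (T : ℤ) := by
  rw [Finset.mem_Icc, ← abs_le]
  have h : a ^ 2 = ((a.natAbs ^ 2 : ℕ) : ℤ) := by push_cast; rw [sq_abs]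
  rw [h, Int.ofNat_le, ← Nat.le_sqrt', Int.abs_eq_natAbs, Int.ofNat_le]

theorem sum_sq_insertNth {n : ℕ} (j : Fin (n + 1)) (a : ℤ) (y : Fin n → ℤ) :
    ∑ i, (j.insertNth a y : Fin (n + 1) → ℤ) i ^ 2 = a ^ 2 + ∑ i, y i ^ 2 := by
  rw [Fin.sum_univ_succAbove _ j]
  simp

theorem insertNth_mem_latticeBall {n R : ℕ} (j : Fin (n + 1)) (a : ℤ) (y : Fin n → ℤ) :
    (j.insertNth a y : Fin (n + 1) → ℤ) ∈ latticeBall (n + 1) R ↔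
      y ∈ latticeBall n R ∧ a ∈ Finset.Icc (-(halfWidth R y : ℤ)) (halfWidth R y) := by
  rw [mem_latticeBall, sum_sq_insertNth, mem_latticeBall, halfWidth, mem_Icc_sqrt_iff]
  constructor
  · intro h
    have : ∑ j, y j ^ 2 ≤ (R : ℤ) := by nlinarith [sq_nonneg a]
    refine ⟨this, ?_⟩
    rw [Int.toNat_of_nonneg (by linarith)]; linarith
  · rintro ⟨h1, h2⟩
    rw [Int.toNat_of_nonneg (by linarith)] at h2; linarith

theorem sum_latticeBall_succ {M : Type*} [AddCommMonoid M] {n R : ℕ} (j : Fin (n + 1))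
    (F : (Fin (n + 1) → ℤ) → M) :
    ∑ x ∈ latticeBall (n + 1) R, F x =
      ∑ y ∈ latticeBall n R, ∑ a ∈ Finset.Icc (-(halfWidth R y : ℤ)) (halfWidth R y),
        F (j.insertNth a y) := by
  rw [Finset.sum_sigma']
  refine Finset.sum_bij' (fun x _ => (⟨j.removeNth x, x j⟩ : Σ _ : Fin n → ℤ, ℤ))
    (fun s _ => j.insertNth s.2 s.1) ?_ ?_ ?_ ?_ ?_
  · intro x hx
    rw [Finset.mem_sigma]
    rw [← insertNth_mem_latticeBall j]
    simpa using hx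
  · intro s hs
    rw [Finset.mem_sigma] at hs
    exact (insertNth_mem_latticeBall j _ _).2 hs
  · intro x _; simp
  · intro s _; simp
  · intro x _; simp

theorem sum_Icc_neg_succ {M : Type*} [AddCommMonoid M] (k : ℕ) (f : ℤ → M) :
    ∑ a ∈ Finset.Icc (-((k + 1 : ℕ) : ℤ)) ((k + 1 : ℕ) : ℤ), f a =
      f (-((k : ℤ) + 1)) + (f ((k : ℤ) + 1) + ∑ a ∈ Finset.Icc (-(k : ℤ)) k, f a) := by
  have : Finset.Icc (-((k + 1 : ℕ) : ℤ)) ((k + 1 : ℕ) : ℤ) =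
      insert (-((k : ℤ) + 1)) (insert ((k : ℤ) + 1) (Finset.Icc (-(k : ℤ)) k)) := by
    ext a; simp only [Finset.mem_Icc, Finset.mem_insert]; push_cast; omega
  rw [this, Finset.sum_insert, Finset.sum_insert]
  · simp
  · simp only [Finset.mem_insert, Finset.mem_Icc]; omega

theorem sum_Icc_neg_sq (k : ℕ) :
    ∑ a ∈ Finset.Icc (-(k : ℤ)) k, (a : ℝ) ^ 2 = k * (k + 1) * (2 * k + 1) / 3 := by
  induction k with
  | zero => simp
  | succ k ih => rw [sum_Icc_neg_succ, ih]; push_cast; ring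

theorem sum_Icc_neg_pow_four (k : ℕ) :
    ∑ a ∈ Finset.Icc (-(k : ℤ)) k, (a : ℝ) ^ 4 =
      k * (k + 1) * (2 * k + 1) * (3 * k ^ 2 + 3 * k - 1) / 15 := by
  induction k with
  | zero => simp
  | succ k ih => rw [sum_Icc_neg_succ, ih]; push_cast; ring

theorem card_Icc_neg (k : ℕ) : ((Finset.Icc (-(k : ℤ)) k).card : ℝ) = 2 * k + 1 := by
  rw [Int.card_Icc]
  have : ((k : ℤ) + 1 - -(k : ℤ)).toNat = 2 * k + 1 := by omega
  rw [this]; push_cast; ring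

theorem half_sum_sq_le_sum_gap (T : ℕ) :
    (1 / 2 : ℝ) * ∑ a ∈ Finset.Icc (-(Nat.sqrt T : ℤ)) (Nat.sqrt T), (a : ℝ) ^ 2 ≤
      ∑ a ∈ Finset.Icc (-(Nat.sqrt T : ℤ)) (Nat.sqrt T), ((T : ℝ) - (a : ℝ) ^ 2) := by
  rw [Finset.sum_sub_distrib, Finset.sum_const, nsmul_eq_mul, card_Icc_neg, sum_Icc_neg_sq]
  have h1 : ((Nat.sqrt T : ℝ)) ^ 2 ≤ T := by exact_mod_cast Nat.sqrt_le' T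
  have h2 : ((Nat.sqrt T : ℝ)) ≤ (Nat.sqrt T : ℝ) ^ 2 := by
    exact_mod_cast Nat.le_self_pow two_ne_zero _
  set k : ℝ := (Nat.sqrt T : ℝ)
  have h0 : 0 ≤ k := Nat.cast_nonneg _
  nlinarith [mul_nonneg h0 (sub_nonneg.2 h2), mul_nonneg h0 (sub_nonneg.2 h1)]

theorem sum_gap_sq_le (T : ℕ) :
    ∑ a ∈ Finset.Icc (-(Nat.sqrt T : ℤ)) (Nat.sqrt T), ((T : ℝ) - (a : ℝ) ^ 2) ^ 2 ≤
      10 * ∑ a ∈ Finset.Icc (-(Nat.sqrt T : ℤ)) (Nat.sqrt T),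
          ((T : ℝ) - (a : ℝ) ^ 2) * (a : ℝ) ^ 2 +
        ∑ _ ∈ Finset.Icc (-(Nat.sqrt T : ℤ)) (Nat.sqrt T), (1 : ℝ) := by
  have e1 : ∀ a : ℤ, ((T : ℝ) - (a : ℝ) ^ 2) ^ 2 =
      (T : ℝ) ^ 2 - 2 * T * (a : ℝ) ^ 2 + (a : ℝ) ^ 4 := fun a => by ring
  have e2 : ∀ a : ℤ, ((T : ℝ) - (a : ℝ) ^ 2) * (a : ℝ) ^ 2 =
      T * (a : ℝ) ^ 2 - (a : ℝ) ^ 4 := fun a => by ring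
  simp only [e1, e2]
  rw [Finset.sum_sub_distrib, Finset.sum_add_distrib, Finset.sum_sub_distrib, ← Finset.mul_sum,
    ← Finset.mul_sum, Finset.sum_const, Finset.sum_const, nsmul_eq_mul, nsmul_eq_mul,
    card_Icc_neg, sum_Icc_neg_sq, sum_Icc_neg_pow_four]
  obtain ⟨e, he⟩ : ∃ e : ℕ, T = Nat.sqrt T ^ 2 + e := ⟨T - Nat.sqrt T ^ 2, by
    have := Nat.sqrt_le' T; omega⟩
  have he2 : e ≤ 2 * Nat.sqrt T := by
    have := Nat.lt_succ_sqrt' T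
    simp only [Nat.succ_eq_add_one] at this
    nlinarith
  have hT : (T : ℝ) = (Nat.sqrt T : ℝ) ^ 2 + e := by exact_mod_cast he
  rw [hT]
  have he2' : (e : ℝ) ≤ 2 * (Nat.sqrt T : ℝ) := by exact_mod_cast he2
  have he0 : (0 : ℝ) ≤ e := Nat.cast_nonneg _
  rcases Nat.eq_zero_or_pos (Nat.sqrt T) with h | h
  · rw [h] at he2' ⊢
    have : (e : ℝ) = 0 := by simp at he2'; simp [he2']
    rw [this]; simp
  obtain ⟨l, hl⟩ : ∃ l : ℕ, Nat.sqrt T = l + 1 := ⟨Nat.sqrt T - 1, by omega⟩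
  rw [hl] at he2' ⊢
  have hl0 : (0 : ℝ) ≤ l := Nat.cast_nonneg _
  push_cast at he2' ⊢
  set x : ℝ := (l : ℝ)
  set z : ℝ := (e : ℝ)
  suffices h : 0 ≤ 12 * ((x + 1) ^ 2 + z) * ((x + 1) * (x + 2) / 3)
      - 11 * ((x + 1) * (x + 2) * (3 * (x + 1) ^ 2 + 3 * (x + 1) - 1) / 15) + 1
      - ((x + 1) ^ 2 + z) ^ 2 by
    have := mul_nonneg (by positivity : 0 ≤ 2 * (x + 1) + 1) h
    nlinarith [this]
  have hz : 0 ≤ z * (2 * (x + 1) - z) := mul_nonneg he0 (by linarith)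
  nlinarith [hz, mul_nonneg he0 hl0, mul_nonneg (mul_nonneg he0 hl0) hl0, pow_nonneg hl0 2,
    pow_nonneg hl0 3, pow_nonneg hl0 4]

theorem toNat_cast_of_mem {n R : ℕ} {y : Fin n → ℤ} (hy : y ∈ latticeBall n R) :
    ((((R : ℤ) - ∑ j, y j ^ 2).toNat : ℕ) : ℝ) = (R : ℝ) - ∑ j, (y j : ℝ) ^ 2 := by
  rw [mem_latticeBall] at hy
  have h : (((R : ℤ) - ∑ j, y j ^ 2).toNat : ℤ) = (R : ℤ) - ∑ j, y j ^ 2 :=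
    Int.toNat_of_nonneg (by linarith)
  have := congrArg (Int.cast (R := ℝ)) h
  push_cast at this ⊢
  linarith

theorem sum_sq_le_of_mem {n R : ℕ} {y : Fin n → ℤ} (hy : y ∈ latticeBall n R) :
    ∑ j, (y j : ℝ) ^ 2 ≤ R := by
  rw [mem_latticeBall] at hy
  exact_mod_cast hy

theorem sum_sq_insertNth_real {n : ℕ} (j : Fin (n + 1)) (a : ℤ) (y : Fin n → ℤ) :
    ∑ i, ((j.insertNth a y : Fin (n + 1) → ℤ) i : ℝ) ^ 2 = (a : ℝ) ^ 2 + ∑ i, (y i : ℝ) ^ 2 := by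
  exact_mod_cast sum_sq_insertNth j a y

theorem half_sum_coord_sq_le {n R : ℕ} (j : Fin (n + 1)) :
    (1 / 2 : ℝ) * ∑ x ∈ latticeBall (n + 1) R, (x j : ℝ) ^ 2 ≤
      ∑ x ∈ latticeBall (n + 1) R, ((R : ℝ) - ∑ i, (x i : ℝ) ^ 2) := by
  rw [sum_latticeBall_succ j, sum_latticeBall_succ j, Finset.mul_sum]
  refine Finset.sum_le_sum fun y hy => ?_
  simp only [Fin.insertNth_apply_same, sum_sq_insertNth_real]
  refine (half_sum_sq_le_sum_gap _).trans (le_of_eq (Finset.sum_congr rfl fun a _ => ?_))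
  rw [toNat_cast_of_mem hy]; ring

theorem sum_gap_sq_le_coord {n R : ℕ} (j : Fin (n + 1)) :
    ∑ x ∈ latticeBall (n + 1) R, ((R : ℝ) - ∑ i, (x i : ℝ) ^ 2) ^ 2 ≤
      10 * ∑ x ∈ latticeBall (n + 1) R, ((R : ℝ) - ∑ i, (x i : ℝ) ^ 2) * (x j : ℝ) ^ 2 +
        (latticeBall (n + 1) R).card := by
  have hc : ((latticeBall (n + 1) R).card : ℝ) = ∑ x ∈ latticeBall (n + 1) R, (1 : ℝ) := by simp
  rw [hc, sum_latticeBall_succ j, sum_latticeBall_succ j, sum_latticeBall_succ j, Finset.mul_sum,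
    ← Finset.sum_add_distrib]
  refine Finset.sum_le_sum fun y hy => ?_
  simp only [Fin.insertNth_apply_same, sum_sq_insertNth_real]
  have := sum_gap_sq_le ((R : ℤ) - ∑ j, y j ^ 2).toNat
  rw [toNat_cast_of_mem hy] at this
  simp only [sub_add_eq_sub_sub_swap] at this ⊢
  exact this

/-- Lower bound for the mean of `R - |x|²` on a lattice ball. -/
theorem mul_card_le_sum_gap (n R : ℕ) :
    (R : ℝ) * (latticeBall (n + 1) R).card ≤
      (2 * (n + 1) + 1) * ∑ x ∈ latticeBall (n + 1) R, ((R : ℝ) - ∑ i, (x i : ℝ) ^ 2) := by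
  have h : ∑ j : Fin (n + 1), (1 / 2 : ℝ) * ∑ x ∈ latticeBall (n + 1) R, (x j : ℝ) ^ 2 ≤
      ∑ _j : Fin (n + 1), ∑ x ∈ latticeBall (n + 1) R, ((R : ℝ) - ∑ i, (x i : ℝ) ^ 2) :=
    Finset.sum_le_sum fun j _ => half_sum_coord_sq_le j
  rw [← Finset.mul_sum, Finset.sum_comm, Finset.sum_const, Finset.card_univ, Fintype.card_fin,
    nsmul_eq_mul] at h
  have h2 : ∑ x ∈ latticeBall (n + 1) R, ∑ j, (x j : ℝ) ^ 2 =
      R * (latticeBall (n + 1) R).card -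
        ∑ x ∈ latticeBall (n + 1) R, ((R : ℝ) - ∑ i, (x i : ℝ) ^ 2) := by
    rw [Finset.sum_sub_distrib]; simp; ring
  push_cast at h
  rw [h2] at h
  linarith

/-- Upper bound for the second moment of `R - |x|²` on a lattice ball. -/
theorem sum_gap_sq_le_mul (n R : ℕ) :
    (n + 1) * ∑ x ∈ latticeBall (n + 1) R, ((R : ℝ) - ∑ i, (x i : ℝ) ^ 2) ^ 2 ≤
      10 * R * ∑ x ∈ latticeBall (n + 1) R, ((R : ℝ) - ∑ i, (x i : ℝ) ^ 2) +
        (n + 1) * (latticeBall (n + 1) R).card := by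
  have h := Finset.sum_le_sum fun j (_ : j ∈ (Finset.univ : Finset (Fin (n + 1)))) =>
    sum_gap_sq_le_coord (R := R) j
  rw [Finset.sum_const, Finset.sum_add_distrib, ← Finset.mul_sum, Finset.sum_comm, Finset.sum_const,
    Finset.card_univ, Fintype.card_fin, nsmul_eq_mul, nsmul_eq_mul] at h
  push_cast at h
  refine h.trans ?_
  have h2 : ∑ x ∈ latticeBall (n + 1) R, ∑ j, ((R : ℝ) - ∑ i, (x i : ℝ) ^ 2) * (x j : ℝ) ^ 2 ≤
      R * ∑ x ∈ latticeBall (n + 1) R, ((R : ℝ) - ∑ i, (x i : ℝ) ^ 2) := by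
    rw [Finset.mul_sum]
    refine Finset.sum_le_sum fun x hx => ?_
    rw [← Finset.mul_sum]
    have h3 := sum_sq_le_of_mem hx
    have h4 : 0 ≤ ∑ j, (x j : ℝ) ^ 2 := Finset.sum_nonneg fun _ _ => sq_nonneg _
    nlinarith
  linarith

theorem card_latticeBall_succ {n R : ℕ} :
    ((latticeBall (n + 1) R).card : ℝ) = ∑ y ∈ latticeBall n R, (2 * (halfWidth R y : ℝ) + 1) := by
  have hc : ((latticeBall (n + 1) R).card : ℝ) = ∑ x ∈ latticeBall (n + 1) R, (1 : ℝ) := by simp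
  rw [hc, sum_latticeBall_succ 0]
  refine Finset.sum_congr rfl fun y _ => ?_
  rw [Finset.sum_const, nsmul_eq_mul, mul_one, card_Icc_neg]

theorem sqrt_gap_le {n R : ℕ} {y : Fin n → ℤ} (hy : y ∈ latticeBall n R) :
    √((R : ℝ) - ∑ j, (y j : ℝ) ^ 2) ≤ 2 * (halfWidth R y : ℝ) + 1 := by
  rw [← toNat_cast_of_mem hy]
  refine (Real.sqrt_le_left (by positivity)).2 ?_
  have h := Nat.lt_succ_sqrt' ((R : ℤ) - ∑ j, y j ^ 2).toNat
  have h2 : ((((R : ℤ) - ∑ j, y j ^ 2).toNat : ℕ) : ℝ) < ((halfWidth R y : ℝ) + 1) ^ 2 := by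
    unfold halfWidth
    exact_mod_cast h
  have h0 : (0 : ℝ) ≤ halfWidth R y := Nat.cast_nonneg _
  nlinarith

theorem sqrt_ge_quadratic {w s : ℝ} (hw : 0 ≤ w) (hs : 0 < s) :
    w / s * (3 / 2 - w / (2 * s ^ 2)) ≤ √w := by
  obtain ⟨r, hr, rfl⟩ : ∃ r, 0 ≤ r ∧ w = r ^ 2 := ⟨√w, Real.sqrt_nonneg _, (Real.sq_sqrt hw).symm⟩
  rw [Real.sqrt_sq hr]
  have : r - r ^ 2 / s * (3 / 2 - r ^ 2 / (2 * s ^ 2)) = r * (r - s) ^ 2 * (r + 2 * s) / (2 * s ^ 3) := by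
    field_simp; ring
  have h2 : 0 ≤ r * (r - s) ^ 2 * (r + 2 * s) / (2 * s ^ 3) := by positivity
  linarith

/-- Passing from dimension `n` to `n + 1`, the number of points of a lattice ball of
squared radius `R ≥ (n + 1) / 2` grows at least by a factor comparable to `√(R / (n + 1))`. -/
theorem sqrt_mul_card_le {n R : ℕ} (hR : n + 1 ≤ 2 * R) :
    √((R : ℝ) / (n + 1)) * (latticeBall n R).card ≤ 20 * (latticeBall (n + 1) R).card := by
  have hle : ∑ y ∈ latticeBall n R, √((R : ℝ) - ∑ j, (y j : ℝ) ^ 2) ≤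
      (latticeBall (n + 1) R).card := by
    rw [card_latticeBall_succ]
    exact Finset.sum_le_sum fun y hy => sqrt_gap_le hy
  rcases n with _ | n
  · simp only [Finset.univ_eq_empty, Finset.sum_empty, sub_zero, Finset.sum_const,
      nsmul_eq_mul] at hle
    simp only [Nat.cast_zero, zero_add, div_one]
    have h0 : 0 ≤ √(R : ℝ) := Real.sqrt_nonneg _
    have h1 := latticeBall_card_pos 1 R
    nlinarith
  have hR' : ((n : ℝ) + 2) ≤ 2 * R := by
    have : ((n + 1 + 1 : ℕ) : ℝ) ≤ ((2 * R : ℕ) : ℝ) := by exact_mod_cast hR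
    push_cast at this; linarith
  have hn : (0 : ℝ) ≤ n := Nat.cast_nonneg _
  have hV := latticeBall_card_pos (n + 1) R
  have m1 := mul_card_le_sum_gap n R
  have m2 := sum_gap_sq_le_mul n R
  push_cast
  set V : ℝ := ((latticeBall (n + 1) R).card : ℝ)
  set E1 := ∑ x ∈ latticeBall (n + 1) R, ((R : ℝ) - ∑ i, (x i : ℝ) ^ 2)
  set E2 := ∑ x ∈ latticeBall (n + 1) R, ((R : ℝ) - ∑ i, (x i : ℝ) ^ 2) ^ 2
  set K : ℝ := (R : ℝ) / (n + 1 + 1) with hK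
  have hK0 : 1 / 2 ≤ K := by rw [hK, le_div_iff₀ (by positivity)]; linarith
  have hRK : (R : ℝ) = K * (n + 2) := by rw [hK]; field_simp; ring
  -- first moment
  have m1' : K * V ≤ 2 * E1 := by
    rw [hRK] at m1
    have : (2 * ((n : ℝ) + 1) + 1) * (K * V) ≤ (2 * ((n : ℝ) + 1) + 1) * (2 * E1) := by
      nlinarith [mul_pos (by linarith : (0 : ℝ) < K) hV,
        mul_nonneg hn (mul_pos (by linarith : (0 : ℝ) < K) hV).le]
    exact le_of_mul_le_mul_left this (by positivity)
  have hE1 : 0 < E1 := by nlinarith [mul_pos (by linarith : (0 : ℝ) < K) hV]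
  have m2' : E2 ≤ 30 * K * E1 := by
    rw [hRK] at m2
    have hV2 : V ≤ 4 * K * (2 * E1) := by nlinarith [mul_pos (by linarith : (0 : ℝ) < K) hV]
    have : ((n : ℝ) + 1) * E2 ≤ (n + 1) * (30 * K * E1) := by
      have h5 : 0 ≤ K * E1 := by positivity
      nlinarith [mul_nonneg hn h5, mul_le_mul_of_nonneg_left hV2 (by positivity : (0 : ℝ) ≤ n + 1)]
    exact le_of_mul_le_mul_left this (by positivity)
  have hs : 0 < √K := Real.sqrt_pos.2 (by linarith)
  have hsq : √K ^ 2 = K := Real.sq_sqrt (by linarith)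
  have key : E1 / (6 * √K) * (3 / 2) - E2 / (2 * (6 * √K) ^ 3) ≤ (latticeBall (n + 2) R).card := by
    refine le_trans (le_of_eq ?_) ((Finset.sum_le_sum fun y hy =>
      sqrt_ge_quadratic (s := 6 * √K) (sub_nonneg.2 (sum_sq_le_of_mem hy)) (by positivity)).trans hle)
    simp only [E1, E2, Finset.sum_div, Finset.sum_mul]
    rw [← Finset.sum_sub_distrib]
    refine Finset.sum_congr rfl fun y _ => ?_
    field_simp
  have k2 : E2 / (2 * (6 * √K) ^ 3) ≤ E1 / (6 * √K) * (1 / 2) := by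
    rw [div_le_iff₀ (by positivity)]
    calc E2 ≤ 30 * √K ^ 2 * E1 := by rw [hsq]; exact m2'
      _ ≤ 36 * √K ^ 2 * E1 := by gcongr; norm_num
      _ = _ := by field_simp; norm_num
  have k3 : E1 / (6 * √K) ≤ (latticeBall (n + 2) R).card := by linarith
  rw [div_le_iff₀ (by positivity)] at k3
  have : √K * (√K * V) ≤ √K * (20 * (latticeBall (n + 1 + 1) R).card) := by
    have : √K * (√K * V) = K * V := by rw [← mul_assoc, ← sq, hsq]
    rw [this]
    have hc : (0 : ℝ) ≤ √K * (latticeBall (n + 1 + 1) R).card := mul_nonneg (Real.sqrt_nonneg _) (Nat.cast_nonneg _)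
    nlinarith
  exact le_of_mul_le_mul_left this hs

/-- Symmetrization of a sum of products along a family of commuting involutions. -/
theorem sum_mul_prod_symm {ι α : Type*} {𝕜 : Type*} [Field 𝕜] [CharZero 𝕜] [DecidableEq ι]
    (B : Finset α) (τ : ι → α → α) (hτ : ∀ i x, τ i (τ i x) = x) (hB : ∀ i, ∀ x ∈ B, τ i x ∈ B)
    (f : ι → α → 𝕜) (hf : ∀ i j, i ≠ j → ∀ x, f j (τ i x) = f j x)
    (hf' : ∀ i j, i ≠ j → ∀ x, f j (τ j (τ i x)) = f j (τ j x))
    (S : Finset ι) (g : α → 𝕜) (hg : ∀ i ∈ S, ∀ x, g (τ i x) = g x) :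
    ∑ x ∈ B, g x * ∏ i ∈ S, f i x = ∑ x ∈ B, g x * ∏ i ∈ S, ((f i x + f i (τ i x)) / 2) := by
  induction S using Finset.induction_on generalizing g with
  | empty => simp
  | insert i S hi ih =>
    simp only [Finset.prod_insert hi]
    have hG : ∀ x, g (τ i x) * ∏ j ∈ S, f j (τ i x) = g x * ∏ j ∈ S, f j x := fun x => by
      rw [hg i (Finset.mem_insert_self _ _)]
      congr 1
      exact Finset.prod_congr rfl fun j hj => hf i j (fun h => hi (h ▸ hj)) x
    have h1 : ∑ x ∈ B, g x * (f i x * ∏ j ∈ S, f j x) =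
        ∑ x ∈ B, g x * (f i (τ i x) * ∏ j ∈ S, f j x) := by
      refine Finset.sum_bij' (fun x _ => τ i x) (fun x _ => τ i x) (fun x hx => hB i x hx)
        (fun x hx => hB i x hx) (fun x _ => hτ i x) (fun x _ => hτ i x) fun x _ => ?_
      rw [hτ]
      linear_combination - f i x * hG x
    have h2 : ∑ x ∈ B, g x * (f i x * ∏ j ∈ S, f j x) =
        ∑ x ∈ B, (g x * ((f i x + f i (τ i x)) / 2)) * ∏ j ∈ S, f j x := by
      have : ∑ x ∈ B, (g x * ((f i x + f i (τ i x)) / 2)) * ∏ j ∈ S, f j x =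
          (∑ x ∈ B, g x * (f i x * ∏ j ∈ S, f j x) +
            ∑ x ∈ B, g x * (f i (τ i x) * ∏ j ∈ S, f j x)) / 2 := by
        rw [← Finset.sum_add_distrib, Finset.sum_div]
        exact Finset.sum_congr rfl fun x _ => by ring
      rw [this, ← h1]; ring
    rw [h2, ih]
    · exact Finset.sum_congr rfl fun x _ => by ring
    · intro j hj x
      have hne : j ≠ i := fun h => hi (h ▸ hj)
      rw [hg j (Finset.mem_insert_of_mem hj), hf j i hne, hf' j i hne]

/-- The unnormalized Fourier multiplier of the lattice ball, in cosine form. -/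
noncomputable def cosSum (d R : ℕ) (ξ : Fin d → ℝ) : ℝ :=
  ∑ x ∈ latticeBall d R, ∏ j, Real.cos (2 * Real.pi * (x j * ξ j))

/-- The mean of `sin² (π ξ_j)`. -/
noncomputable def sinMean (d : ℕ) (ξ : Fin d → ℝ) : ℝ :=
  (∑ j, Real.sin (Real.pi * ξ j) ^ 2) / d

theorem comp_perm_mem_latticeBall {d R : ℕ} (σ : Equiv.Perm (Fin d)) {x : Fin d → ℤ} :
    x ∘ σ ∈ latticeBall d R ↔ x ∈ latticeBall d R := by
  rw [mem_latticeBall, mem_latticeBall]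
  have : ∑ j, (x ∘ σ) j ^ 2 = ∑ j, x j ^ 2 := Equiv.sum_comp σ fun j => x j ^ 2
  rw [this]

theorem sum_latticeBall_comp_perm {M : Type*} [AddCommMonoid M] {d R : ℕ}
    (σ : Equiv.Perm (Fin d)) (F : (Fin d → ℤ) → M) :
    ∑ x ∈ latticeBall d R, F (x ∘ σ) = ∑ x ∈ latticeBall d R, F x :=
  Finset.sum_bij' (fun x _ => x ∘ σ) (fun x _ => x ∘ σ.symm)
    (fun x hx => (comp_perm_mem_latticeBall σ).2 hx)
    (fun x hx => (comp_perm_mem_latticeBall σ.symm).2 hx)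
    (fun x _ => by ext; simp) (fun x _ => by ext; simp) fun x _ => rfl

theorem sum_prod_exp_eq_cosSum (d R : ℕ) (ξ : Fin d → ℝ) :
    ∑ x ∈ latticeBall d R, ∏ j, Complex.exp (2 * Real.pi * Complex.I * (x j * ξ j)) =
      (cosSum d R ξ : ℂ) := by
  have h := sum_mul_prod_symm (𝕜 := ℂ) (latticeBall d R)
    (fun (j : Fin d) (x : Fin d → ℤ) => Function.update x j (-x j))
    (fun j x => by ext i; by_cases h : i = j <;> simp [h, Function.update])
    (fun j x hx => by
      rw [mem_latticeBall] at hx ⊢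
      refine le_trans (le_of_eq (Finset.sum_congr rfl fun i _ => ?_)) hx
      by_cases h : i = j
      · subst h; simp
      · simp [h])
    (fun j x => Complex.exp (2 * Real.pi * Complex.I * (x j * ξ j)))
    (fun i j hij x => by simp [hij.symm])
    (fun i j hij x => by simp [hij.symm]) Finset.univ (fun _ => 1) (fun _ _ _ => rfl)
  simp only [one_mul, Function.update_self] at h
  rw [h, cosSum]
  push_cast
  refine Finset.sum_congr rfl fun x _ => Finset.prod_congr rfl fun j _ => ?_
  rw [Complex.cos]
  congr 3 <;> ring_nf

theorem abs_prod_sub_prod_le {ι : Type*} (S : Finset ι) (a b : ι → ℝ) (ha : ∀ i, |a i| ≤ 1)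
    (hb : ∀ i, |b i| ≤ 1) : |∏ i ∈ S, a i - ∏ i ∈ S, b i| ≤ ∑ i ∈ S, |a i - b i| := by
  classical
  induction S using Finset.induction_on with
  | empty => simp
  | insert i S hi ih =>
    rw [Finset.prod_insert hi, Finset.prod_insert hi, Finset.sum_insert hi]
    have hP : |∏ j ∈ S, a j| ≤ 1 := by
      rw [Finset.abs_prod]
      exact Finset.prod_le_one (fun _ _ => abs_nonneg _) fun j _ => ha j
    have : a i * ∏ j ∈ S, a j - b i * ∏ j ∈ S, b j =
        (a i - b i) * ∏ j ∈ S, a j + b i * (∏ j ∈ S, a j - ∏ j ∈ S, b j) := by ring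
    rw [this]
    refine (abs_add_le _ _).trans (add_le_add ?_ ?_)
    · rw [abs_mul]; exact mul_le_of_le_one_right (abs_nonneg _) hP
    · rw [abs_mul]; exact (mul_le_of_le_one_left (abs_nonneg _) (hb i)).trans ih

theorem abs_sin_natCast_mul_le (k : ℕ) (t : ℝ) : |Real.sin (k * t)| ≤ k * |Real.sin t| := by
  induction k with
  | zero => simp
  | succ k ih =>
    push_cast
    rw [add_mul, one_mul, Real.sin_add]
    refine (abs_add_le _ _).trans ?_
    rw [abs_mul, abs_mul]
    nlinarith [Real.abs_cos_le_one (k * t), Real.abs_cos_le_one t, abs_nonneg (Real.sin t),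
      abs_nonneg (Real.sin (k * t))]

theorem sin_sq_intCast_mul_le (k : ℤ) (t : ℝ) :
    Real.sin (k * t) ^ 2 ≤ (k : ℝ) ^ 2 * Real.sin t ^ 2 := by
  rw [← mul_pow]
  apply sq_le_sq.2
  rw [abs_mul]
  have h := abs_sin_natCast_mul_le k.natAbs t
  have hk : ((k.natAbs : ℕ) : ℝ) = |(k : ℝ)| := by
    rw [← Int.cast_natCast, Int.natCast_natAbs, Int.cast_abs]
  rw [hk] at h
  refine le_trans (le_of_eq ?_) h
  rcases abs_choice (k : ℝ) with h' | h' <;> simp [h']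

theorem abs_cos_sub_one_le (k : ℤ) (t : ℝ) :
    |Real.cos (2 * Real.pi * (k * t)) - 1| ≤ 2 * ((k : ℝ) ^ 2 * Real.sin (Real.pi * t) ^ 2) := by
  have h : Real.cos (2 * Real.pi * (k * t)) = 1 - 2 * Real.sin (k * (Real.pi * t)) ^ 2 := by
    rw [show 2 * Real.pi * (k * t) = 2 * (k * (Real.pi * t)) by ring, Real.cos_two_mul,
      Real.cos_sq']
    ring
  rw [h, show 1 - 2 * Real.sin (k * (Real.pi * t)) ^ 2 - 1 =
    -(2 * Real.sin (k * (Real.pi * t)) ^ 2) by ring, abs_neg, abs_of_nonneg (by positivity)]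
  linarith [sin_sq_intCast_mul_le k (Real.pi * t)]

theorem abs_cos_sub_cos_half_le (k : ℤ) (t : ℝ) :
    |Real.cos (2 * Real.pi * (k * t)) - Real.cos (2 * Real.pi * (k * (1 / 2)))| ≤
      2 * ((k : ℝ) ^ 2 * Real.cos (Real.pi * t) ^ 2) := by
  have h0 : Real.sin (2 * Real.pi * (k * (1 / 2))) = 0 := by
    rw [show 2 * Real.pi * (k * (1 / 2)) = k * Real.pi by ring]; exact Real.sin_int_mul_pi k
  have h1 : Real.cos (2 * Real.pi * (k * t)) =
      Real.cos (2 * Real.pi * (k * (t - 1 / 2))) * Real.cos (2 * Real.pi * (k * (1 / 2))) := by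
    rw [show 2 * Real.pi * (k * t) =
      2 * Real.pi * (k * (t - 1 / 2)) + 2 * Real.pi * (k * (1 / 2)) by ring, Real.cos_add, h0]
    ring
  have h2 : Real.sin (Real.pi * (t - 1 / 2)) ^ 2 = Real.cos (Real.pi * t) ^ 2 := by
    rw [show Real.pi * (t - 1 / 2) = Real.pi * t - Real.pi / 2 by ring, Real.sin_sub_pi_div_two]
    ring
  rw [h1, ← sub_one_mul, abs_mul, ← h2]
  exact (mul_le_of_le_one_right (abs_nonneg _) (Real.abs_cos_le_one _)).trans
    (abs_cos_sub_one_le k _)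

theorem mul_sum_coord_sq_le {d R : ℕ} (j : Fin d) :
    (d : ℝ) * ∑ x ∈ latticeBall d R, (x j : ℝ) ^ 2 ≤ R * (latticeBall d R).card := by
  have h : ∀ i, ∑ x ∈ latticeBall d R, (x i : ℝ) ^ 2 = ∑ x ∈ latticeBall d R, (x j : ℝ) ^ 2 := by
    intro i
    rw [← sum_latticeBall_comp_perm (Equiv.swap i j)]
    simp
  have h2 : ∑ i : Fin d, ∑ x ∈ latticeBall d R, (x i : ℝ) ^ 2 ≤ R * (latticeBall d R).card := by
    rw [Finset.sum_comm, mul_comm, ← nsmul_eq_mul]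
    exact Finset.sum_le_card_nsmul _ _ _ fun x hx => sum_sq_le_of_mem hx
  simpa [h] using h2

theorem abs_cosSum_sub_le {d R : ℕ} (hd : 1 ≤ d) (ξ : Fin d → ℝ) (b : ℝ) (s : Fin d → ℝ)
    (hs0 : ∀ j, 0 ≤ s j)
    (hs : ∀ (k : ℤ) j, |Real.cos (2 * Real.pi * (k * ξ j)) - Real.cos (2 * Real.pi * (k * b))| ≤
      2 * ((k : ℝ) ^ 2 * s j)) :
    |cosSum d R ξ - cosSum d R fun _ => b| ≤
      2 * R * ((∑ j, s j) / d) * (latticeBall d R).card := by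
  have hd' : (0 : ℝ) < d := by exact_mod_cast hd
  rw [cosSum, cosSum, ← Finset.sum_sub_distrib]
  calc _ ≤ ∑ x ∈ latticeBall d R, ∑ j, 2 * ((x j : ℝ) ^ 2 * s j) := by
        refine (Finset.abs_sum_le_sum_abs _ _).trans (Finset.sum_le_sum fun x _ => ?_)
        refine (abs_prod_sub_prod_le _ _ _ (fun _ => Real.abs_cos_le_one _)
          fun _ => Real.abs_cos_le_one _).trans (Finset.sum_le_sum fun j _ => hs _ _)
    _ = ∑ j, 2 * (s j / d * (d * ∑ x ∈ latticeBall d R, (x j : ℝ) ^ 2)) := by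
        rw [Finset.sum_comm]
        refine Finset.sum_congr rfl fun j _ => ?_
        rw [← Finset.mul_sum, ← Finset.sum_mul]
        field_simp
    _ ≤ ∑ j, 2 * (s j / d * (R * (latticeBall d R).card)) := by
        refine Finset.sum_le_sum fun j _ => ?_
        have := mul_le_mul_of_nonneg_left (mul_sum_coord_sq_le (R := R) j)
          (div_nonneg (hs0 j) hd'.le)
        linarith
    _ = _ := by
        rw [← Finset.mul_sum, ← Finset.sum_mul, ← Finset.sum_div]; ring

theorem cosSum_zero (d R : ℕ) : (cosSum d R fun _ => 0) = (latticeBall d R).card := by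
  simp [cosSum]

theorem abs_cosSum_sub_card_le {d R : ℕ} (hd : 1 ≤ d) (ξ : Fin d → ℝ) :
    |cosSum d R ξ - (latticeBall d R).card| ≤ 2 * R * sinMean d ξ * (latticeBall d R).card := by
  have h := abs_cosSum_sub_le (R := R) hd ξ 0 (fun j => Real.sin (Real.pi * ξ j) ^ 2)
    (fun _ => sq_nonneg _) fun k j => by simpa using abs_cos_sub_one_le k (ξ j)
  rw [cosSum_zero] at h
  exact h

theorem one_sub_sinMean {d : ℕ} (hd : 1 ≤ d) (ξ : Fin d → ℝ) :
    1 - sinMean d ξ = (∑ j, Real.cos (Real.pi * ξ j) ^ 2) / d := by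
  have hd' : (d : ℝ) ≠ 0 := by positivity
  simp only [sinMean, Real.sin_sq, Finset.sum_sub_distrib]
  field_simp
  simp

theorem sinMean_nonneg (d : ℕ) (ξ : Fin d → ℝ) : 0 ≤ sinMean d ξ := by
  unfold sinMean; positivity

theorem sinMean_le_one {d : ℕ} (hd : 1 ≤ d) (ξ : Fin d → ℝ) : sinMean d ξ ≤ 1 := by
  rw [← sub_nonneg, one_sub_sinMean hd]; positivity

theorem abs_cosSum_sub_half_le {d R : ℕ} (hd : 1 ≤ d) (ξ : Fin d → ℝ) :
    |cosSum d R ξ - cosSum d R fun _ => 1 / 2| ≤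
      2 * R * (1 - sinMean d ξ) * (latticeBall d R).card := by
  rw [one_sub_sinMean hd]
  exact abs_cosSum_sub_le hd ξ (1 / 2) (fun j => Real.cos (Real.pi * ξ j) ^ 2)
    (fun _ => sq_nonneg _) fun k j => abs_cos_sub_cos_half_le k (ξ j)

theorem abs_cosSum_le (d R : ℕ) (ξ : Fin d → ℝ) : |cosSum d R ξ| ≤ (latticeBall d R).card := by
  refine (Finset.abs_sum_le_sum_abs _ _).trans ?_
  rw [← mul_one (((latticeBall d R).card : ℕ) : ℝ), ← nsmul_eq_mul]
  refine Finset.sum_le_card_nsmul _ _ _ fun x _ => ?_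
  rw [Finset.abs_prod]
  exact Finset.prod_le_one (fun _ _ => abs_nonneg _) fun j _ => Real.abs_cos_le_one _

theorem sin_mul_sum_cos (k : ℕ) (t : ℝ) :
    Real.sin t * ∑ a ∈ Finset.Icc (-(k : ℤ)) k, Real.cos (2 * (a * t)) =
      Real.sin ((2 * k + 1) * t) := by
  induction k with
  | zero => simp
  | succ k ih =>
    rw [sum_Icc_neg_succ, mul_add, mul_add, ih]
    push_cast
    have h1 : Real.cos (2 * ((-1 + -(k : ℝ)) * t)) = Real.cos (2 * ((k + 1) * t)) := by
      rw [← Real.cos_neg]; ring_nf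
    have h2 : Real.sin ((2 * (k + 1) + 1) * t) - Real.sin ((2 * k + 1) * t) =
        2 * Real.sin t * Real.cos (2 * ((k + 1) * t)) := by
      rw [Real.sin_sub_sin]; ring_nf
    rw [neg_add_rev, h1]
    linarith

theorem abs_sin_mul_abs_cosSum_le {n R : ℕ} (j : Fin (n + 1)) (ξ : Fin (n + 1) → ℝ) :
    |Real.sin (Real.pi * ξ j)| * |cosSum (n + 1) R ξ| ≤ (latticeBall n R).card := by
  rw [← abs_mul, cosSum, sum_latticeBall_succ j, Finset.mul_sum]
  refine (Finset.abs_sum_le_sum_abs _ _).trans ?_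
  rw [← mul_one (((latticeBall n R).card : ℕ) : ℝ), ← nsmul_eq_mul]
  refine Finset.sum_le_card_nsmul _ _ _ fun y _ => ?_
  have : ∀ a : ℤ, ∏ i, Real.cos (2 * Real.pi * ((j.insertNth a y : Fin (n + 1) → ℤ) i * ξ i)) =
      Real.cos (2 * (a * (Real.pi * ξ j))) *
        ∏ i, Real.cos (2 * Real.pi * (y i * ξ (j.succAbove i))) := fun a => by
    rw [Fin.prod_univ_succAbove _ j]
    simp only [Fin.insertNth_apply_same, Fin.insertNth_apply_succAbove]
    ring_nf
  simp only [this]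
  rw [← Finset.sum_mul, ← mul_assoc, sin_mul_sum_cos, abs_mul, Finset.abs_prod]
  exact mul_le_one₀ (Real.abs_sin_le_one _) (Finset.prod_nonneg fun _ _ => abs_nonneg _)
    (Finset.prod_le_one (fun _ _ => abs_nonneg _) fun j _ => Real.abs_cos_le_one _)

theorem card_le_of_gap (k p l : ℕ) (hl : 0 < l) (A : Finset ℤ) (hA : A ⊆ Finset.Icc (-(k : ℤ)) k)
    (hgap : ∀ a ∈ A, ∀ b ∈ A, a < b → b - a ≤ p ∨ (l : ℤ) ≤ b - a) :
    A.card ≤ (p + 1) * (2 * k / l + 1) := by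
  have hl' : (0 : ℤ) < l := by exact_mod_cast hl
  have himg : (A.image fun a => (a + k) / (l : ℤ)).card ≤ 2 * k / l + 1 := by
    have : (A.image fun a => (a + k) / (l : ℤ)) ⊆ Finset.Icc (0 : ℤ) ((2 * k / l : ℕ) : ℤ) := by
      intro b hb
      obtain ⟨a, ha, rfl⟩ := Finset.mem_image.1 hb
      have ha' := Finset.mem_Icc.1 (hA ha)
      rw [Finset.mem_Icc]
      constructor
      · exact Int.ediv_nonneg (by linarith) hl'.le
      · push_cast
        exact Int.ediv_le_ediv hl' (by linarith)
    refine (Finset.card_le_card this).trans ?_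
    have hm : ∀ m : ℕ, ((m : ℤ) + 1 - 0).toNat = m + 1 := fun m => by omega
    rw [Int.card_Icc, hm]
  refine (Finset.card_le_mul_card_image A (p + 1) ?_).trans (Nat.mul_le_mul_left _ himg)
  intro b _
  rcases (Finset.filter (fun a => (a + k) / (l : ℤ) = b) A).eq_empty_or_nonempty with h | h
  · rw [h]; simp
  set F := Finset.filter (fun a => (a + k) / (l : ℤ) = b) A with hF
  have hmin := F.min'_mem h
  have hsub : F ⊆ Finset.Icc (F.min' h) (F.min' h + p) := by
    intro x hx
    rw [Finset.mem_Icc]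
    have hle := F.min'_le x hx
    refine ⟨hle, ?_⟩
    rcases hle.lt_or_eq with hlt | heq
    · have h1 := Finset.mem_filter.1 hx
      have h2 := Finset.mem_filter.1 hmin
      rcases hgap _ h2.1 _ h1.1 hlt with h3 | h3
      · linarith
      · exfalso
        have e1 := Int.emod_add_mul_ediv (x + k) l
        have e2 := Int.emod_add_mul_ediv (F.min' h + k) l
        have e3 := Int.emod_lt_of_pos (x + k) hl'
        have e4 := Int.emod_nonneg (F.min' h + k) hl'.ne'
        rw [h1.2] at e1
        rw [h2.2] at e2
        linarith
    · rw [← heq]; linarith [Int.natCast_nonneg p]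
  refine (Finset.card_le_card hsub).trans ?_
  rw [Int.card_Icc]; omega

theorem card_filter_abs_sin_le (k : ℕ) {t η : ℝ} (ht : 0 < |t|) (hη : 0 ≤ η) :
    (((Finset.Icc (-(k : ℤ)) k).filter fun a : ℤ =>
      |Real.sin (2 * Real.pi * (a * t))| ≤ η).card : ℝ) ≤
      ((2 * k + 1) * (4 * |t|) + 1) * (η / (2 * |t|) + 1) := by
  set A := (Finset.Icc (-(k : ℤ)) k).filter fun a : ℤ => |Real.sin (2 * Real.pi * (a * t))| ≤ η
  set p := ⌊η / (2 * |t|)⌋₊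
  set l := ⌊1 / (4 * |t|)⌋₊ + 1
  have hl1 : 1 / (4 * |t|) < (l : ℝ) := by
    simp only [l]; push_cast; exact Nat.lt_floor_add_one _
  have hl0 : (0 : ℝ) < l := lt_trans (by positivity) hl1
  have hgap : ∀ a ∈ A, ∀ b ∈ A, a < b → b - a ≤ p ∨ (l : ℤ) ≤ b - a := by
    intro a ha b hb hab
    have ha := (Finset.mem_filter.1 ha).2
    have hb := (Finset.mem_filter.1 hb).2
    obtain ⟨m, hm⟩ : ∃ m : ℕ, b - a = m := ⟨(b - a).toNat, by omega⟩
    have hm' : (b : ℝ) - a = m := by exact_mod_cast hm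
    rw [hm]
    have hsin : |Real.sin (2 * Real.pi * (m * t))| ≤ 2 * η := by
      rw [← hm', show 2 * Real.pi * (((b : ℝ) - a) * t) =
        2 * Real.pi * (b * t) - 2 * Real.pi * (a * t) by ring, Real.sin_sub]
      refine (abs_sub _ _).trans ?_
      rw [abs_mul, abs_mul]
      nlinarith [Real.abs_cos_le_one (2 * Real.pi * (b * t)), abs_nonneg (Real.sin (2 * Real.pi * (a * t))),
        Real.abs_cos_le_one (2 * Real.pi * (a * t)), abs_nonneg (Real.sin (2 * Real.pi * (b * t)))]
    by_cases hc : (m : ℝ) ≤ 1 / (4 * |t|)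
    · left
      have hsin' : |Real.sin (2 * Real.pi * (m * t))| = Real.sin (2 * Real.pi * (m * |t|)) := by
        have hnn : 0 ≤ Real.sin (2 * Real.pi * (m * |t|)) := by
          apply Real.sin_nonneg_of_nonneg_of_le_pi (by positivity)
          rw [le_div_iff₀ (by positivity)] at hc
          nlinarith [Real.pi_pos]
        rcases abs_choice t with h | h
        · rw [h] at hnn ⊢; exact abs_of_nonneg hnn
        · rw [h] at hnn ⊢
          rw [show 2 * Real.pi * (m * t) = -(2 * Real.pi * (m * -t)) by ring, Real.sin_neg, abs_neg]
          exact abs_of_nonneg hnn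
      have hlow : 2 / Real.pi * (2 * Real.pi * (m * |t|)) ≤ Real.sin (2 * Real.pi * (m * |t|)) := by
        apply Real.mul_le_sin (by positivity)
        rw [le_div_iff₀ (by positivity)] at hc
        nlinarith [Real.pi_pos]
      have e : 2 / Real.pi * (2 * Real.pi * (m * |t|)) = 4 * m * |t| := by
        field_simp; ring
      have : (m : ℝ) ≤ η / (2 * |t|) := by
        rw [le_div_iff₀ (by positivity)]
        linarith
      exact_mod_cast Nat.le_floor this
    · right
      have : l ≤ m := by
        by_contra hcon
        push Not at hcon hc
        have : m ≤ ⌊1 / (4 * |t|)⌋₊ := by omega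
        have h2 := Nat.floor_le (by positivity : 0 ≤ 1 / (4 * |t|))
        have h3 : (m : ℝ) ≤ (⌊1 / (4 * |t|)⌋₊ : ℝ) := by exact_mod_cast this
        linarith
      exact_mod_cast this
  have h := card_le_of_gap k p l (Nat.succ_pos _) A (Finset.filter_subset _ _) hgap
  have h' : (A.card : ℝ) ≤ (p + 1) * ((2 * k / l : ℕ) + 1) := by exact_mod_cast h
  refine h'.trans ?_
  rw [mul_comm]
  have hp : (p : ℝ) ≤ η / (2 * |t|) := Nat.floor_le (by positivity)
  have hq : ((2 * k / l : ℕ) : ℝ) ≤ (2 * k + 1) * (4 * |t|) := by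
    have h1 : ((2 * k / l : ℕ) : ℝ) ≤ ((2 * k : ℕ) : ℝ) / l := Nat.cast_div_le
    have h2 : (1 : ℝ) / l ≤ 4 * |t| := by
      rw [div_lt_iff₀ (by positivity)] at hl1
      rw [div_le_iff₀ hl0]; linarith
    calc _ ≤ ((2 * k : ℕ) : ℝ) / l := h1
      _ = (2 * k) * (1 / l) := by push_cast; ring
      _ ≤ (2 * k + 1) * (4 * |t|) := by gcongr; linarith
  gcongr

theorem card_bad_le {n R : ℕ} {κ c t : ℝ} (hκ : 0 < κ)
    (hκV : κ * (latticeBall n R).card ≤ 20 * (latticeBall (n + 1) R).card)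
    (hc : 0 ≤ c) (ht : 0 < |t|) (j : Fin (n + 1)) :
    (((latticeBall (n + 1) R).filter fun x =>
      |Real.sin (2 * Real.pi * (x j * t))| ≤ c * min 1 (κ * |t|)).card : ℝ) ≤
      (12 * c + 4 * |t| + 20 / κ) * (latticeBall (n + 1) R).card := by
  set η := c * min 1 (κ * |t|)
  have hη : 0 ≤ η := by positivity
  have h1 : (((latticeBall (n + 1) R).filter fun x =>
      |Real.sin (2 * Real.pi * (x j * t))| ≤ η).card : ℝ) =
      ∑ y ∈ latticeBall n R, (((Finset.Icc (-(halfWidth R y : ℤ)) (halfWidth R y)).filter fun a : ℤ =>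
      |Real.sin (2 * Real.pi * (a * t))| ≤ η).card : ℝ) := by
    rw [Finset.card_filter, sum_latticeBall_succ j]
    push_cast
    refine Finset.sum_congr rfl fun y _ => ?_
    rw [Finset.card_filter]
    push_cast
    simp
  rw [h1]
  set V := ((latticeBall (n + 1) R).card : ℝ) with hV
  have hVp : 0 < V := latticeBall_card_pos _ _
  have hV' : ((latticeBall n R).card : ℝ) ≤ 20 / κ * V := by
    rw [div_mul_eq_mul_div, le_div_iff₀ hκ]; linarith
  have e1 : η / (2 * |t|) * (4 * |t|) ≤ 2 * c := by
    have : η / (2 * |t|) * (4 * |t|) = 2 * η := by field_simp; ring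
    rw [this]
    have : η ≤ c * 1 := mul_le_mul_of_nonneg_left (min_le_left _ _) hc
    linarith
  have e2 : η / (2 * |t|) * (20 / κ) ≤ 10 * c := by
    have : η ≤ c * (κ * |t|) := mul_le_mul_of_nonneg_left (min_le_right _ _) hc
    rw [div_mul_div_comm, div_le_iff₀ (by positivity)]
    nlinarith
  calc _ ≤ ∑ y ∈ latticeBall n R,
        ((2 * (halfWidth R y : ℝ) + 1) * (4 * |t|) + 1) * (η / (2 * |t|) + 1) :=
        Finset.sum_le_sum fun y _ => card_filter_abs_sin_le _ ht hη
    _ = (V * (4 * |t|) + (latticeBall n R).card) * (η / (2 * |t|) + 1) := by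
        rw [← Finset.sum_mul, Finset.sum_add_distrib, ← Finset.sum_mul, ← card_latticeBall_succ]
        simp [V]
    _ ≤ (V * (4 * |t|) + 20 / κ * V) * (η / (2 * |t|) + 1) := by gcongr
    _ = (η / (2 * |t|) * (4 * |t|) + η / (2 * |t|) * (20 / κ) + 4 * |t| + 20 / κ) * V := by ring
    _ ≤ (2 * c + 10 * c + 4 * |t| + 20 / κ) * V := by gcongr
    _ = _ := by ring

theorem abs_cos_le_exp (t : ℝ) : |Real.cos t| ≤ Real.exp (-(Real.sin t ^ 2 / 2)) := by
  apply abs_le_of_sq_le_sq _ (Real.exp_nonneg _)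
  rw [← Real.exp_nat_mul, Real.cos_sq']
  have := Real.add_one_le_exp (-(Real.sin t ^ 2))
  push_cast
  rw [show (2 : ℝ) * -(Real.sin t ^ 2 / 2) = -(Real.sin t ^ 2) by ring]
  linarith

theorem abs_prod_cos_le_exp {ι : Type*} (S : Finset ι) (t : ι → ℝ) :
    |∏ i ∈ S, Real.cos (t i)| ≤ Real.exp (-(∑ i ∈ S, Real.sin (t i) ^ 2) / 2) := by
  rw [Finset.abs_prod, neg_div, Finset.sum_div, ← Finset.sum_neg_distrib, Real.exp_sum]
  exact Finset.prod_le_prod (fun _ _ => abs_nonneg _) fun i _ => abs_cos_le_exp _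

theorem abs_prod_cos_le_of_weights {ι : Type*} [Fintype ι] (θ r : ι → ℝ) (c : ℝ)
    (hc : 0 ≤ c) (hr : ∀ i, 0 ≤ r i) (hW : 0 < ∑ i, r i ^ 2) :
    |∏ i, Real.cos (θ i)| ≤ Real.exp (-(c ^ 2 * (∑ i, r i ^ 2) / 4)) +
      2 / (∑ i, r i ^ 2) * ∑ i, r i ^ 2 * (if |Real.sin (θ i)| ≤ c * r i then 1 else 0) := by
  set W := ∑ i, r i ^ 2
  set X := ∑ i, r i ^ 2 * (if |Real.sin (θ i)| ≤ c * r i then (1 : ℝ) else 0) with hX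
  have hX0 : 0 ≤ X := Finset.sum_nonneg fun i _ => by positivity
  by_cases h : X ≤ W / 2
  · refine le_trans ?_ (le_add_of_nonneg_right (by positivity))
    refine (abs_prod_cos_le_exp _ _).trans (Real.exp_le_exp.2 ?_)
    have : c ^ 2 * (W - X) ≤ ∑ i, Real.sin (θ i) ^ 2 := by
      rw [hX, ← Finset.sum_sub_distrib, Finset.mul_sum]
      refine Finset.sum_le_sum fun i _ => ?_
      split_ifs with hi
      · simp; positivity
      · push Not at hi
        rw [mul_zero, sub_zero, ← mul_pow, ← sq_abs (Real.sin _)]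
        exact pow_le_pow_left₀ (mul_nonneg hc (hr i)) hi.le 2
    nlinarith [sq_nonneg c]
  · push Not at h
    have h1 : |∏ i, Real.cos (θ i)| ≤ 1 := by
      rw [Finset.abs_prod]
      exact Finset.prod_le_one (fun _ _ => abs_nonneg _) fun j _ => Real.abs_cos_le_one _
    have h2 : 1 ≤ 2 / W * X := by
      rw [div_mul_eq_mul_div, le_div_iff₀ hW]; linarith
    linarith [Real.exp_nonneg (-(c ^ 2 * W / 4))]

theorem abs_cosSum_le_of_small {n R : ℕ} {κ c A : ℝ} (hκ : 0 < κ)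
    (hκV : κ * (latticeBall n R).card ≤ 20 * (latticeBall (n + 1) R).card)
    (hc : 0 ≤ c) (hA : 1 ≤ A) (ξ : Fin (n + 1) → ℝ) (hξ : ∀ j, κ * |ξ j| ≤ A)
    (hW : 0 < ∑ j, (min 1 (κ * |ξ j|)) ^ 2) :
    |cosSum (n + 1) R ξ| ≤
      (Real.exp (-(c ^ 2 * (∑ j, (min 1 (κ * |ξ j|)) ^ 2) / 4)) + 24 * c + 48 * (A / κ)) *
        (latticeBall (n + 1) R).card := by
  set W := ∑ j, (min 1 (κ * |ξ j|)) ^ 2 with hWdef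
  set V := ((latticeBall (n + 1) R).card : ℝ)
  have hVp : 0 < V := latticeBall_card_pos _ _
  have hbad : ∀ j, (min 1 (κ * |ξ j|)) ^ 2 * ∑ x ∈ latticeBall (n + 1) R,
      (if |Real.sin (2 * Real.pi * (x j * ξ j))| ≤ c * min 1 (κ * |ξ j|) then (1 : ℝ) else 0) ≤
      (min 1 (κ * |ξ j|)) ^ 2 * ((12 * c + 24 * (A / κ)) * V) := by
    intro j
    rcases eq_or_lt_of_le (abs_nonneg (ξ j)) with h | h
    · rw [← h]; simp
    · refine mul_le_mul_of_nonneg_left ?_ (sq_nonneg _)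
      have h1 := card_bad_le hκ hκV hc h j
      rw [Finset.card_filter] at h1
      push_cast at h1
      refine h1.trans (mul_le_mul_of_nonneg_right ?_ hVp.le)
      have h2 : |ξ j| ≤ A / κ := by rw [le_div_iff₀ hκ]; linarith [hξ j]
      have h3 : 1 / κ ≤ A / κ := by gcongr
      have h4 : 20 / κ = 20 * (1 / κ) := by ring
      linarith
  calc |cosSum (n + 1) R ξ| ≤ ∑ x ∈ latticeBall (n + 1) R, (Real.exp (-(c ^ 2 * W / 4)) +
        2 / W * ∑ j, (min 1 (κ * |ξ j|)) ^ 2 *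
          (if |Real.sin (2 * Real.pi * (x j * ξ j))| ≤ c * min 1 (κ * |ξ j|) then (1 : ℝ) else 0)) :=
        (Finset.abs_sum_le_sum_abs _ _).trans (Finset.sum_le_sum fun x _ =>
          abs_prod_cos_le_of_weights _ _ c hc (fun j => by positivity) hW)
    _ = V * Real.exp (-(c ^ 2 * W / 4)) + 2 / W * ∑ j, (min 1 (κ * |ξ j|)) ^ 2 *
        ∑ x ∈ latticeBall (n + 1) R,
      (if |Real.sin (2 * Real.pi * (x j * ξ j))| ≤ c * min 1 (κ * |ξ j|) then (1 : ℝ) else 0) := by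
        rw [Finset.sum_add_distrib, ← Finset.mul_sum, Finset.sum_comm, Finset.sum_const,
          nsmul_eq_mul]
        simp only [Finset.mul_sum]
        rfl
    _ ≤ V * Real.exp (-(c ^ 2 * W / 4)) + 2 / W * ∑ j, (min 1 (κ * |ξ j|)) ^ 2 *
        ((12 * c + 24 * (A / κ)) * V) := by
        exact add_le_add le_rfl (mul_le_mul_of_nonneg_left
          (Finset.sum_le_sum fun j _ => hbad j) (by positivity))
    _ = _ := by
        rw [← Finset.sum_mul, ← hWdef]
        field_simp
        ring

theorem abs_cosSum_le_large {n R : ℕ} (hR : n + 1 ≤ 2 * R) (ξ : Fin (n + 1) → ℝ)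
    (hξ : ∀ j, |ξ j| ≤ 1 / 2) {t s : ℝ} (ht : 0 < t) (hs : 0 < s)
    (htR : t ^ 8 = R * sinMean (n + 1) ξ) (hsR : s ^ 4 * (n + 1) = R) :
    |cosSum (n + 1) R ξ| ≤ 250 * (1 / t + 1 / s) * (latticeBall (n + 1) R).card := by
  set V := ((latticeBall (n + 1) R).card : ℝ)
  have hVp : 0 < V := latticeBall_card_pos _ _
  have htriv : |cosSum (n + 1) R ξ| ≤ V := abs_cosSum_le _ _ _
  by_cases ht1 : t < 1
  · have : 1 < 1 / t := by rwa [lt_div_iff₀ ht, one_mul]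
    have : 0 < 1 / s := by positivity
    nlinarith
  by_cases hs1 : s < 1
  · have : 1 < 1 / s := by rwa [lt_div_iff₀ hs, one_mul]
    have : 0 < 1 / t := by positivity
    nlinarith
  push Not at ht1 hs1
  have hκV : s ^ 2 * (latticeBall n R).card ≤ 20 * (latticeBall (n + 1) R).card := by
    have h := sqrt_mul_card_le hR
    have h2 : √((R : ℝ) / (n + 1)) = s ^ 2 := by
      rw [← hsR, mul_div_cancel_right₀ _ (by positivity : (n : ℝ) + 1 ≠ 0),
        show s ^ 4 = (s ^ 2) ^ 2 by ring, Real.sqrt_sq (by positivity)]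
    rwa [h2] at h
  set A := min (t ^ 2) s
  have hA1 : 1 ≤ A := le_min (by nlinarith) hs1
  have hA0 : 0 < A := by linarith
  have hAinv : 1 / A ≤ 1 / t + 1 / s := by
    rcases min_choice (t ^ 2) s with h | h
    · have : A = t ^ 2 := h
      rw [this]
      have : 1 / t ^ 2 ≤ 1 / t := by gcongr; nlinarith
      have : 0 < 1 / s := by positivity
      linarith
    · have : A = s := h
      rw [this]
      have : 0 < 1 / t := by positivity
      linarith
  by_cases hbig : ∃ j, A < s ^ 2 * |ξ j|
  · obtain ⟨j, hj⟩ := hbig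
    have h3 := abs_sin_mul_abs_cosSum_le (R := R) j ξ
    have hsin : 2 * |ξ j| ≤ |Real.sin (Real.pi * ξ j)| := by
      have h := Real.mul_abs_le_abs_sin (x := Real.pi * ξ j) (by
        rw [abs_mul, abs_of_pos Real.pi_pos]; nlinarith [Real.pi_pos, hξ j])
      rw [abs_mul, abs_of_pos Real.pi_pos] at h
      have e : 2 / Real.pi * (Real.pi * |ξ j|) = 2 * |ξ j| := by field_simp
      linarith
    have h4 : A * |cosSum (n + 1) R ξ| ≤ 10 * V := by
      have h5 : s ^ 2 * (2 * |ξ j| * |cosSum (n + 1) R ξ|) ≤ 20 * V := by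
        refine le_trans (mul_le_mul_of_nonneg_left ?_ (by positivity)) hκV
        exact (mul_le_mul_of_nonneg_right hsin (abs_nonneg _)).trans h3
      nlinarith [mul_le_mul_of_nonneg_right hj.le (abs_nonneg (cosSum (n + 1) R ξ))]
    have h6 : |cosSum (n + 1) R ξ| ≤ 10 * (1 / A) * V := by
      rw [show 10 * (1 / A) * V = 10 * V / A by ring, le_div_iff₀ hA0]; linarith
    have : 1 / A * V ≤ (1 / t + 1 / s) * V := by gcongr
    have : 0 < (1 / t + 1 / s) * V := by positivity
    linarith
  push Not at hbig
  have hWlow : t ^ 8 / (10 * A ^ 2) ≤ ∑ j, (min 1 (s ^ 2 * |ξ j|)) ^ 2 := by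
    have hj : ∀ j, s ^ 4 * Real.sin (Real.pi * ξ j) ^ 2 / (10 * A ^ 2) ≤
        (min 1 (s ^ 2 * |ξ j|)) ^ 2 := by
      intro j
      have h1 : s ^ 2 * |ξ j| / A ≤ min 1 (s ^ 2 * |ξ j|) := by
        apply le_min
        · rw [div_le_one hA0]; exact hbig j
        · exact div_le_self (by positivity) hA1
      have h2 : Real.sin (Real.pi * ξ j) ^ 2 ≤ 10 * |ξ j| ^ 2 := by
        have h := Real.abs_sin_le_abs (x := Real.pi * ξ j)
        rw [← sq_abs]
        have h' := pow_le_pow_left₀ (abs_nonneg _) h 2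
        rw [abs_mul, abs_of_pos Real.pi_pos, mul_pow] at h'
        have hpi : Real.pi ^ 2 ≤ 10 := by nlinarith [Real.pi_lt_d2, Real.pi_pos]
        exact h'.trans (mul_le_mul_of_nonneg_right hpi (sq_nonneg _))
      calc _ ≤ s ^ 4 * (10 * |ξ j| ^ 2) / (10 * A ^ 2) := by gcongr
        _ = (s ^ 2 * |ξ j| / A) ^ 2 := by field_simp
        _ ≤ _ := by gcongr
    refine le_trans (le_of_eq ?_) (Finset.sum_le_sum fun j _ => hj j)
    rw [← Finset.sum_div, ← Finset.mul_sum, htR, ← hsR, sinMean]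
    push_cast
    field_simp
  have hW0 : 0 < ∑ j, (min 1 (s ^ 2 * |ξ j|)) ^ 2 := lt_of_lt_of_le (by positivity) hWlow
  have hmain := abs_cosSum_le_of_small (c := 1 / t) (by positivity) hκV (by positivity) hA1 ξ hbig hW0
  refine hmain.trans (mul_le_mul_of_nonneg_right ?_ hVp.le)
  have hexp : Real.exp (-((1 / t) ^ 2 * (∑ j, (min 1 (s ^ 2 * |ξ j|)) ^ 2) / 4)) ≤ 40 * (1 / t) := by
    set W := ∑ j, (min 1 (s ^ 2 * |ξ j|)) ^ 2
    have hAt : A ^ 2 ≤ t ^ 4 := by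
      have : A ≤ t ^ 2 := min_le_left _ _
      calc A ^ 2 ≤ (t ^ 2) ^ 2 := by gcongr
        _ = t ^ 4 := by ring
    have h1 : t ^ 4 / 10 ≤ W := by
      refine le_trans ?_ hWlow
      rw [div_le_div_iff₀ (by norm_num) (by positivity)]
      nlinarith [mul_le_mul_of_nonneg_left hAt (by positivity : 0 ≤ t ^ 4)]
    have h2 : t / 40 ≤ (1 / t) ^ 2 * W / 4 := by
      have : (1 / t) ^ 2 * (t ^ 4 / 10) / 4 ≤ (1 / t) ^ 2 * W / 4 := by gcongr
      have e : (1 / t) ^ 2 * (t ^ 4 / 10) / 4 = t ^ 2 / 40 := by field_simp; norm_num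
      nlinarith
    have h3 : t / 40 ≤ Real.exp ((1 / t) ^ 2 * W / 4) := by
      linarith [Real.add_one_le_exp ((1 / t) ^ 2 * W / 4)]
    rw [Real.exp_neg]
    calc _ ≤ (t / 40)⁻¹ := by gcongr
      _ = _ := by field_simp
  have hAs : A / s ^ 2 ≤ 1 / s := by
    rw [div_le_div_iff₀ (by positivity) hs]
    nlinarith [min_le_right (t ^ 2) s]
  have : 0 < 1 / t := by positivity
  have : 0 < 1 / s := by positivity
  linarith

/-- The set of coordinates where `x` equals `±1`. -/
def unitCoords {d : ℕ} (x : Fin d → ℤ) : Finset (Fin d) :=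
  Finset.univ.filter fun i => |x i| = 1

/-- The set of coordinates where `x` vanishes. -/
def zeroCoords {d : ℕ} (x : Fin d → ℤ) : Finset (Fin d) :=
  Finset.univ.filter fun i => x i = 0

theorem sum_sq_update {d : ℕ} (x : Fin d → ℤ) (i : Fin d) (b : ℤ) :
    ∑ l, (Function.update x i b) l ^ 2 = ∑ l, x l ^ 2 + (b ^ 2 - x i ^ 2) := by
  rw [← Finset.add_sum_erase _ _ (Finset.mem_univ i), ← Finset.add_sum_erase _ _ (Finset.mem_univ i)]
  have : ∑ l ∈ Finset.univ.erase i, (Function.update x i b) l ^ 2 =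
      ∑ l ∈ Finset.univ.erase i, x l ^ 2 :=
    Finset.sum_congr rfl fun l hl => by rw [Function.update_of_ne (Finset.ne_of_mem_erase hl)]
  rw [this]; simp; ring

theorem card_unitCoords_update_le {d : ℕ} (x : Fin d → ℤ) (i : Fin d) (b : ℤ) :
    (unitCoords (Function.update x i b)).card ≤ (unitCoords x).card + 1 := by
  have : unitCoords (Function.update x i b) ⊆ insert i (unitCoords x) := by
    intro l hl
    by_cases h : l = i
    · simp [h]
    · simp only [unitCoords, Finset.mem_insert, Finset.mem_filter, Finset.mem_univ, true_and] at hl ⊢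
      rw [Function.update_of_ne h] at hl
      exact Or.inr hl
  exact (Finset.card_le_card this).trans (Finset.card_insert_le _ _)

theorem sub_le_card_zeroCoords {d R : ℕ} {x : Fin d → ℤ} (hx : x ∈ latticeBall d R) :
    (d : ℝ) - R ≤ (zeroCoords x).card := by
  have h1 := Finset.card_filter_add_card_filter_not (s := (Finset.univ : Finset (Fin d)))
    (fun i => x i = 0)
  rw [Finset.card_univ, Fintype.card_fin] at h1
  have h2 : ((Finset.univ.filter fun i => ¬ x i = 0).card : ℤ) ≤ R := by
    refine le_trans ?_ (mem_latticeBall.1 hx)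
    rw [Finset.card_filter]
    push_cast
    refine Finset.sum_le_sum fun i _ => ?_
    split_ifs with h
    · exact sq_nonneg _
    · have := sq_pos_of_ne_zero h; linarith
  have h3 : ((zeroCoords x).card : ℤ) + (Finset.univ.filter fun i => ¬ x i = 0).card = d := by
    unfold zeroCoords; exact_mod_cast h1
  have h4 : (d : ℤ) - R ≤ (zeroCoords x).card := by linarith
  exact_mod_cast h4

theorem gap_add_sum_large {d R : ℕ} (x : Fin d → ℤ) :
    ((R : ℝ) - ∑ i, (x i : ℝ) ^ 2) + ∑ i, (if 2 ≤ |x i| then (x i : ℝ) ^ 2 else 0) =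
      R - (unitCoords x).card := by
  have : ∀ i, (x i : ℝ) ^ 2 = (if 2 ≤ |x i| then (x i : ℝ) ^ 2 else 0) +
      (if |x i| = 1 then (1 : ℝ) else 0) := by
    intro i
    by_cases h2 : 2 ≤ |x i|
    · have : ¬ |x i| = 1 := by omega
      simp [h2, this]
    · by_cases h1 : |x i| = 1
      · simp only [h1]
        have : (x i : ℝ) ^ 2 = 1 := by
          rw [← sq_abs, ← Int.cast_abs, h1]; simp
        simp [this]
      · have h0 : x i = 0 := by
          have := abs_nonneg (x i)
          exact abs_eq_zero.1 (by omega)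
        simp [h0]
  have h := Finset.sum_congr rfl fun i (_ : i ∈ (Finset.univ : Finset (Fin d))) => this i
  rw [Finset.sum_add_distrib] at h
  have hK : ((unitCoords x).card : ℝ) = ∑ i, (if |x i| = 1 then (1 : ℝ) else 0) := by
    rw [unitCoords, Finset.card_filter]; push_cast; rfl
  rw [hK]; linarith

theorem sum_le_sum_of_inj {α β : Type*} [DecidableEq β] (s : Finset α) (t : Finset β) (φ : α → β)
    (f : α → ℝ) (g : β → ℝ) (hφ : ∀ x ∈ s, φ x ∈ t) (hinj : Set.InjOn φ s)
    (hfg : ∀ x ∈ s, f x ≤ g (φ x)) (hg : ∀ y ∈ t, 0 ≤ g y) : ∑ x ∈ s, f x ≤ ∑ y ∈ t, g y :=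
  calc ∑ x ∈ s, f x ≤ ∑ x ∈ s, g (φ x) := Finset.sum_le_sum hfg
    _ = ∑ y ∈ s.image φ, g y := (Finset.sum_image hinj).symm
    _ ≤ ∑ y ∈ t, g y := Finset.sum_le_sum_of_subset_of_nonneg
        (Finset.image_subset_iff.2 hφ) fun y hy _ => hg y hy

theorem sum_sq_coord_le_of_move {d R m : ℕ} (i j : Fin d) :
    ∑ x ∈ (latticeBall d R).filter (fun x => (unitCoords x).card < m ∧ x j = 0),
        (if 2 ≤ |x i| then (x i : ℝ) ^ 2 else 0) ≤
      ∑ x ∈ (latticeBall d R).filter (fun x => (unitCoords x).card < m + 2 ∧ x j = 1),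
        4 * (x i : ℝ) ^ 2 := by
  rw [← Finset.sum_filter, Finset.filter_filter]
  refine sum_le_sum_of_inj _ _
    (fun x => Function.update (Function.update x j 1) i (x i - (x i).sign)) _ _ ?_ ?_ ?_
    fun y _ => by positivity
  · intro x hx
    simp only [Finset.mem_filter] at hx ⊢
    obtain ⟨hx, ⟨hK, hj⟩, hi⟩ := hx
    have hij : j ≠ i := by rintro rfl; simp [hj] at hi
    refine ⟨?_, ?_, ?_⟩
    · rw [mem_latticeBall] at hx ⊢
      rw [sum_sq_update, sum_sq_update, hj, Function.update_of_ne hij.symm]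
      rcases le_or_gt 0 (x i) with h | h
      · rw [abs_of_nonneg h] at hi
        rw [Int.sign_eq_one_of_pos (by omega)]
        nlinarith
      · rw [abs_of_neg h] at hi
        rw [Int.sign_eq_neg_one_of_neg h]
        nlinarith
    · have h1 := card_unitCoords_update_le (Function.update x j 1) i (x i - (x i).sign)
      have h2 := card_unitCoords_update_le x j 1
      omega
    · rw [Function.update_of_ne hij, Function.update_self]
  · intro x hx y hy hxy
    simp only [Finset.coe_filter, Set.mem_ofPred_eq] at hx hy
    obtain ⟨_, ⟨_, hj⟩, hi⟩ := hx
    obtain ⟨_, ⟨_, hj'⟩, hi'⟩ := hy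
    ext l
    have h := congrFun hxy l
    by_cases hl : l = i
    · subst hl
      simp only [Function.update_self] at h
      rcases le_or_gt 0 (x l) with h1 | h1 <;> rcases le_or_gt 0 (y l) with h2 | h2
      · rw [abs_of_nonneg h1] at hi
        rw [abs_of_nonneg h2] at hi'
        rw [Int.sign_eq_one_of_pos (by omega), Int.sign_eq_one_of_pos (by omega)] at h
        omega
      · rw [abs_of_nonneg h1] at hi
        rw [abs_of_neg h2] at hi'
        rw [Int.sign_eq_one_of_pos (by omega), Int.sign_eq_neg_one_of_neg h2] at h
        omega
      · rw [abs_of_neg h1] at hi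
        rw [abs_of_nonneg h2] at hi'
        rw [Int.sign_eq_neg_one_of_neg h1, Int.sign_eq_one_of_pos (by omega)] at h
        omega
      · rw [Int.sign_eq_neg_one_of_neg h1, Int.sign_eq_neg_one_of_neg h2] at h
        omega
    · simp only [Function.update_of_ne hl] at h
      by_cases hl' : l = j
      · rw [hl', hj, hj']
      · simpa [Function.update_of_ne hl'] using h
  · intro x hx
    simp only [Finset.mem_filter] at hx
    obtain ⟨_, _, hi⟩ := hx
    simp only [Function.update_self]
    have : x i ^ 2 ≤ 4 * (x i - (x i).sign) ^ 2 := by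
      rcases le_or_gt 0 (x i) with h1 | h1
      · rw [abs_of_nonneg h1] at hi
        rw [Int.sign_eq_one_of_pos (by omega)]
        nlinarith
      · rw [abs_of_neg h1] at hi
        rw [Int.sign_eq_neg_one_of_neg h1]
        nlinarith
    exact_mod_cast this

theorem sum_gap_le_of_move {d R m : ℕ} (j : Fin d) :
    ∑ x ∈ (latticeBall d R).filter (fun x => (unitCoords x).card < m ∧ x j = 0),
        ((R : ℝ) - ∑ i, (x i : ℝ) ^ 2) ≤
      ∑ _ ∈ (latticeBall d R).filter (fun x => (unitCoords x).card < m + 2 ∧ x j = 1), (R : ℝ) := by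
  have h0 : ∑ x ∈ (latticeBall d R).filter (fun x => (unitCoords x).card < m ∧ x j = 0),
        ((R : ℝ) - ∑ i, (x i : ℝ) ^ 2) =
      ∑ x ∈ (latticeBall d R).filter (fun x => ((unitCoords x).card < m ∧ x j = 0) ∧
        ∑ i, x i ^ 2 < (R : ℤ)), ((R : ℝ) - ∑ i, (x i : ℝ) ^ 2) := by
    rw [← Finset.filter_filter (fun x : Fin d → ℤ => (unitCoords x).card < m ∧ x j = 0)
      (fun x => ∑ i, x i ^ 2 < (R : ℤ)),
      Finset.sum_filter (fun x : Fin d → ℤ => ∑ i, x i ^ 2 < (R : ℤ))]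
    refine Finset.sum_congr rfl fun x hx => ?_
    split_ifs with h
    · rfl
    · have h1 := mem_latticeBall.1 (Finset.mem_filter.1 hx).1
      have h2 : ∑ i, x i ^ 2 = (R : ℤ) := le_antisymm h1 (not_lt.1 h)
      have h3 : ∑ i, (x i : ℝ) ^ 2 = (R : ℝ) := by exact_mod_cast h2
      rw [h3, sub_self]
  rw [h0]
  refine sum_le_sum_of_inj _ _ (fun x => Function.update x j 1) _ _ ?_ ?_ ?_
    fun y _ => by positivity
  · intro x hx
    simp only [Finset.mem_filter] at hx ⊢
    obtain ⟨hx, ⟨hK, hj⟩, hi⟩ := hx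
    refine ⟨?_, ?_, ?_⟩
    · rw [mem_latticeBall, sum_sq_update, hj]
      linarith
    · have h2 := card_unitCoords_update_le x j 1
      omega
    · rw [Function.update_self]
  · intro x hx y hy hxy
    simp only [Finset.coe_filter, Set.mem_ofPred_eq] at hx hy
    ext l
    have h := congrFun hxy l
    by_cases hl : l = j
    · rw [hl, hx.2.1.2, hy.2.1.2]
    · simpa [Function.update_of_ne hl] using h
  · intro x _
    have : (0 : ℝ) ≤ ∑ i, (x i : ℝ) ^ 2 := Finset.sum_nonneg fun i _ => sq_nonneg _
    linarith

theorem card_few_units_le {d R m : ℕ} (hR : 0 < R) (hd : 2 * R ≤ d) (hm : 2 * m ≤ R) :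
    (d : ℝ) * ((latticeBall d R).filter fun x => (unitCoords x).card < m).card ≤
      20 * (m + 2) * (latticeBall d R).card := by
  set Bad := (latticeBall d R).filter fun x => (unitCoords x).card < m with hBad
  have hR' : (0 : ℝ) < R := by exact_mod_cast hR
  have hd' : 2 * (R : ℝ) ≤ d := by exact_mod_cast hd
  have hm' : 2 * (m : ℝ) ≤ R := by exact_mod_cast hm
  have lower : (Bad.card : ℝ) * (d / 2 * (R / 2)) ≤
      ∑ x ∈ Bad, ((zeroCoords x).card : ℝ) * (R - (unitCoords x).card) := by
    rw [← nsmul_eq_mul]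
    refine Finset.card_nsmul_le_sum _ _ _ fun x hx => ?_
    obtain ⟨hx, hK⟩ := Finset.mem_filter.1 hx
    have hK' : ((unitCoords x).card : ℝ) ≤ m := by exact_mod_cast hK.le
    have hz := sub_le_card_zeroCoords hx
    refine mul_le_mul (by linarith) (by linarith) (by positivity) (Nat.cast_nonneg _)
  have upper : ∑ x ∈ Bad, ((zeroCoords x).card : ℝ) * (R - (unitCoords x).card) ≤
      ((latticeBall d R).card : ℝ) * ((m + 2) * (5 * R)) := by
    calc _ = ∑ x ∈ Bad, ∑ j, (if x j = 0 then
          ((R : ℝ) - ∑ i, (x i : ℝ) ^ 2) + ∑ i, (if 2 ≤ |x i| then (x i : ℝ) ^ 2 else 0) else 0) := by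
          refine Finset.sum_congr rfl fun x _ => ?_
          rw [gap_add_sum_large, ← Finset.sum_filter, Finset.sum_const, nsmul_eq_mul]
          rfl
      _ = ∑ j, ∑ x ∈ (latticeBall d R).filter (fun x => (unitCoords x).card < m ∧ x j = 0),
          (((R : ℝ) - ∑ i, (x i : ℝ) ^ 2) + ∑ i, (if 2 ≤ |x i| then (x i : ℝ) ^ 2 else 0)) := by
          rw [Finset.sum_comm]
          refine Finset.sum_congr rfl fun j _ => ?_
          rw [← Finset.sum_filter, hBad, Finset.filter_filter]
      _ ≤ ∑ j, ∑ x ∈ (latticeBall d R).filter (fun x => (unitCoords x).card < m + 2 ∧ x j = 1),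
          ((R : ℝ) + ∑ i, 4 * (x i : ℝ) ^ 2) := by
          refine Finset.sum_le_sum fun j _ => ?_
          rw [Finset.sum_add_distrib, Finset.sum_add_distrib, Finset.sum_comm]
          refine add_le_add (sum_gap_le_of_move j) ?_
          rw [Finset.sum_comm (s := Finset.filter _ _)]
          exact Finset.sum_le_sum fun i _ => sum_sq_coord_le_of_move i j
      _ ≤ ∑ j, ∑ x ∈ (latticeBall d R).filter (fun x => (unitCoords x).card < m + 2 ∧ x j = 1),
          (5 * R : ℝ) := by
          refine Finset.sum_le_sum fun j _ => Finset.sum_le_sum fun x hx => ?_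
          have := sum_sq_le_of_mem (Finset.mem_filter.1 hx).1
          rw [← Finset.mul_sum]; linarith
      _ = ∑ x ∈ (latticeBall d R).filter (fun x => (unitCoords x).card < m + 2),
          ∑ j, (if x j = 1 then (5 * R : ℝ) else 0) := by
          rw [Finset.sum_comm]
          refine Finset.sum_congr rfl fun j _ => ?_
          rw [← Finset.sum_filter, Finset.filter_filter]
      _ ≤ ∑ x ∈ (latticeBall d R).filter (fun x => (unitCoords x).card < m + 2),
          ((m + 2) * (5 * R) : ℝ) := by
          refine Finset.sum_le_sum fun x hx => ?_
          rw [← Finset.sum_filter, Finset.sum_const, nsmul_eq_mul]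
          refine mul_le_mul_of_nonneg_right ?_ (by positivity)
          have h1 := (Finset.mem_filter.1 hx).2
          have h2 : (Finset.univ.filter fun j => x j = 1).card ≤ (unitCoords x).card :=
            Finset.card_le_card fun l hl => by
              simp only [unitCoords, Finset.mem_filter, Finset.mem_univ, true_and] at hl ⊢
              rw [hl]; simp
          exact_mod_cast (h2.trans h1.le)
      _ ≤ _ := by
          rw [Finset.sum_const, nsmul_eq_mul]
          refine mul_le_mul_of_nonneg_right ?_ (by positivity)
          exact_mod_cast Finset.card_filter_le _ _
  have h := lower.trans upper
  have h2 : ((d : ℝ) * Bad.card) * R ≤ (20 * (m + 2) * (latticeBall d R).card) * R := by linarith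
  exact le_of_mul_le_mul_right h2 hR'

theorem card_embedding_mul_sum_perm {ι : Type*} [Fintype ι] [DecidableEq ι] {d : ℕ}
    (u : ι ↪ Fin d) (F : (ι → Fin d) → ℝ) :
    (Fintype.card (ι ↪ Fin d) : ℝ) * ∑ τ : Equiv.Perm (Fin d), F (τ ∘ u) =
      (d.factorial : ℝ) * ∑ v : ι ↪ Fin d, F v := by
  have h1 : ∀ v : ι ↪ Fin d, ∑ τ : Equiv.Perm (Fin d), F (τ ∘ v) =
      ∑ τ : Equiv.Perm (Fin d), F (τ ∘ u) := by
    intro v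
    obtain ⟨π, hπ⟩ := Equiv.Perm.exists_extending_pair u v u.injective v.injective
    rw [← Equiv.sum_comp (Equiv.mulRight π⁻¹)]
    refine Finset.sum_congr rfl fun τ _ => ?_
    congr 1
    ext i
    simp [← hπ]
  have h2 : ∀ τ : Equiv.Perm (Fin d), ∑ v : ι ↪ Fin d, F (τ ∘ v) = ∑ v : ι ↪ Fin d, F v := by
    intro τ
    exact Equiv.sum_comp (Equiv.embeddingCongr (Equiv.refl ι) τ) (fun v : ι ↪ Fin d => F v)
  have h3 : ∑ v : ι ↪ Fin d, ∑ τ : Equiv.Perm (Fin d), F (τ ∘ v) =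
      ∑ τ : Equiv.Perm (Fin d), ∑ v : ι ↪ Fin d, F (τ ∘ v) := Finset.sum_comm
  simp only [h1, h2, Finset.sum_const, Finset.card_univ, nsmul_eq_mul] at h3
  rw [h3, Fintype.card_perm, Fintype.card_fin]

theorem sum_perm_pair {d : ℕ} {a b : Fin d} (hab : a ≠ b) (G : Fin d → Fin d → ℝ) :
    (d : ℝ) * (d - 1) * ∑ τ : Equiv.Perm (Fin d), G (τ a) (τ b) =
      (d.factorial : ℝ) * ∑ p ∈ (Finset.univ : Finset (Fin d)).offDiag, G p.1 p.2 := by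
  have h := card_embedding_mul_sum_perm (ι := Fin 2)
    ⟨![a, b], by
      intro i j hij
      fin_cases i <;> fin_cases j <;> simp_all⟩ (fun v => G (v 0) (v 1))
  have hc : (Fintype.card (Fin 2 ↪ Fin d) : ℝ) = d * (d - 1) := by
    rw [Fintype.card_embedding_eq, Fintype.card_fin, Fintype.card_fin]
    rw [Nat.descFactorial_succ, Nat.descFactorial_one]
    have : 1 ≤ d := by have := a.2; omega
    push_cast [this]; ring
  rw [hc] at h
  refine Eq.trans h ?_
  congr 1
  refine Finset.sum_bij (fun v _ => (v 0, v 1)) ?_ ?_ ?_ ?_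
  · intro v _
    simp [Finset.mem_offDiag]
  · intro v _ v' _ hv
    simp only [Prod.mk.injEq] at hv
    ext i
    fin_cases i
    · simp [hv.1]
    · simp [hv.2]
  · intro p hp
    have hp' : p.1 ≠ p.2 := (Finset.mem_offDiag.1 hp).2.2
    refine ⟨⟨![p.1, p.2], ?_⟩, Finset.mem_univ _, rfl⟩
    intro i j hij
    fin_cases i <;> fin_cases j <;> simp_all
  · intro v _; rfl

theorem sum_perm_two_pairs_le {d : ℕ} (hd : 4 ≤ d) {a b a' b' : Fin d}
    (hinj : Function.Injective ![a, b, a', b']) (G : Fin d → Fin d → ℝ) (hG : ∀ i j, 0 ≤ G i j) :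
    (d : ℝ) * (d - 1) * ((d - 2) * (d - 3)) *
        ∑ τ : Equiv.Perm (Fin d), G (τ a) (τ b) * G (τ a') (τ b') ≤
      (d.factorial : ℝ) * (∑ p ∈ (Finset.univ : Finset (Fin d)).offDiag, G p.1 p.2) ^ 2 := by
  have h := card_embedding_mul_sum_perm (ι := Fin 4) ⟨![a, b, a', b'], hinj⟩
    (fun v => G (v 0) (v 1) * G (v 2) (v 3))
  have hc : (Fintype.card (Fin 4 ↪ Fin d) : ℝ) = d * (d - 1) * ((d - 2) * (d - 3)) := by
    rw [Fintype.card_embedding_eq, Fintype.card_fin, Fintype.card_fin]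
    simp only [Nat.descFactorial_succ, Nat.descFactorial_zero, Nat.sub_zero]
    push_cast [(by omega : 1 ≤ d), (by omega : 2 ≤ d), (by omega : 3 ≤ d)]
    ring
  rw [hc] at h
  refine le_trans (le_of_eq h) ?_
  refine mul_le_mul_of_nonneg_left ?_ (Nat.cast_nonneg _)
  rw [sq, Finset.sum_mul_sum, ← Finset.sum_product']
  refine sum_le_sum_of_inj _ _ (fun v : Fin 4 ↪ Fin d => ((v 0, v 1), (v 2, v 3))) _
    (fun p => G p.1.1 p.1.2 * G p.2.1 p.2.2) ?_ ?_ (fun _ _ => le_rfl)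
    (fun _ _ => mul_nonneg (hG _ _) (hG _ _))
  · intro v _
    simp [Finset.mem_offDiag]
  · intro v _ v' _ hv
    simp only [Prod.mk.injEq] at hv
    ext i
    fin_cases i
    · simp [hv.1.1]
    · simp [hv.1.2]
    · simp [hv.2.1]
    · simp [hv.2.2]

theorem exp_neg_le_chebyshev {X m : ℝ} (hX : 0 ≤ X) (hm : 0 < m) :
    Real.exp (-X) ≤ 2 / m + 4 * (X - m) ^ 2 / m ^ 2 := by
  by_cases h : m / 2 ≤ X
  · have h1 : Real.exp (-X) ≤ 2 / m := by
      rw [Real.exp_neg]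
      calc _ ≤ (m / 2)⁻¹ := by
            gcongr
            linarith [Real.add_one_le_exp X]
        _ = _ := by field_simp
    have : 0 ≤ 4 * (X - m) ^ 2 / m ^ 2 := by positivity
    linarith
  · push Not at h
    have h1 : Real.exp (-X) ≤ 1 := Real.exp_le_one_iff.2 (by linarith)
    have h2 : 1 ≤ 4 * (X - m) ^ 2 / m ^ 2 := by
      rw [le_div_iff₀ (by positivity)]; nlinarith
    have : 0 < 2 / m := by positivity
    linarith

theorem sum_perm_exp_le {d M : ℕ} (hd : 8 ≤ d) (a b : Fin M → Fin d)
    (hab : Function.Injective (Sum.elim a b)) (w : Fin M → ℝ) (hw0 : ∀ t, 0 ≤ w t)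
    (hw1 : ∀ t, w t ≤ 1) (hΩ : 0 < ∑ t, w t) (G : Fin d → Fin d → ℝ) (hG : ∀ i j, 0 ≤ G i j)
    (hG2 : ∀ i j, G i j * G i j = G i j) {μ : ℝ} (hμ : 0 < μ)
    (hμG : μ * (d * (d - 1)) = ∑ p ∈ (Finset.univ : Finset (Fin d)).offDiag, G p.1 p.2) :
    ∑ τ : Equiv.Perm (Fin d), Real.exp (-∑ t, w t * G (τ (a t)) (τ (b t))) ≤
      (d.factorial : ℝ) * (6 / (μ * ∑ t, w t) + 28 / d) := by
  set Ω := ∑ t, w t with hΩdef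
  set D := (d.factorial : ℝ) with hDdef
  have hD : 0 < D := by simp only [D]; positivity
  have hd' : (8 : ℝ) ≤ d := by exact_mod_cast hd
  have hne : ∀ t t', a t ≠ b t' := fun t t' h => by
    have := @hab (Sum.inl t) (Sum.inr t') h
    simp at this
  have hpair : ∀ t, ∑ τ : Equiv.Perm (Fin d), G (τ (a t)) (τ (b t)) = D * μ := by
    intro t
    have h := sum_perm_pair (hne t t) G
    rw [← hμG] at h
    have hp : (0 : ℝ) < d * (d - 1) := by nlinarith
    have : (d : ℝ) * (d - 1) * ∑ τ : Equiv.Perm (Fin d), G (τ (a t)) (τ (b t)) =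
        d * (d - 1) * (D * μ) := by rw [h]; ring
    exact mul_left_cancel₀ hp.ne' this
  have hquad : ∀ t t', ∑ τ : Equiv.Perm (Fin d),
      G (τ (a t)) (τ (b t)) * G (τ (a t')) (τ (b t')) ≤
      D * ((if t = t' then μ else 0) + (1 + 7 / d) * μ ^ 2) := by
    intro t t'
    by_cases htt : t = t'
    · subst htt
      simp only [hG2, hpair, if_true]
      have : 0 ≤ (1 + 7 / (d : ℝ)) * μ ^ 2 := by positivity
      nlinarith
    · rw [if_neg htt, zero_add]
      have hinj : Function.Injective ![a t, b t, a t', b t'] := by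
        have h1 : a t ≠ a t' := fun h => htt (by
          have := @hab (Sum.inl t) (Sum.inl t') h
          simpa using this)
        have h2 : b t ≠ b t' := fun h => htt (by
          have := @hab (Sum.inr t) (Sum.inr t') h
          simpa using this)
        have h3 := hne t t
        have h4 := hne t t'
        have h5 := hne t' t
        have h6 := hne t' t'
        intro i j hij
        have h7 := h1.symm
        have h8 := h2.symm
        have h9 := h3.symm
        have h10 := h4.symm
        have h11 := h5.symm
        have h12 := h6.symm
        fin_cases i <;> fin_cases j <;> first | rfl | (exfalso; revert hij; assumption)
      have h := sum_perm_two_pairs_le (by omega) hinj G hG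
      rw [← hμG] at h
      have hp : (0 : ℝ) < d * (d - 1) := by nlinarith
      have hq : (0 : ℝ) < (d - 2) * (d - 3) := by nlinarith
      have hr : (d : ℝ) * (d - 1) ≤ (1 + 7 / d) * ((d - 2) * (d - 3)) := by
        have : (1 + 7 / (d : ℝ)) * ((d - 2) * (d - 3)) = (d + 7) * ((d - 2) * (d - 3)) / d := by
          field_simp
        rw [this, le_div_iff₀ (by linarith)]
        nlinarith [sq_nonneg ((d : ℝ) - 8)]
      refine le_of_mul_le_mul_left (h.trans ?_) (mul_pos hp hq)
      have := mul_le_mul_of_nonneg_left hr (by positivity : 0 ≤ D * μ ^ 2 * ((d : ℝ) * (d - 1)))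
      linarith
  have hX0 : ∀ τ : Equiv.Perm (Fin d), 0 ≤ ∑ t, w t * G (τ (a t)) (τ (b t)) := fun τ =>
    Finset.sum_nonneg fun t _ => mul_nonneg (hw0 t) (hG _ _)
  have hm1 : ∑ τ : Equiv.Perm (Fin d), ∑ t, w t * G (τ (a t)) (τ (b t)) = D * (μ * Ω) := by
    rw [Finset.sum_comm]
    simp only [← Finset.mul_sum, hpair]
    rw [← Finset.sum_mul]; ring
  have hm2 : ∑ τ : Equiv.Perm (Fin d), (∑ t, w t * G (τ (a t)) (τ (b t))) ^ 2 ≤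
      D * (μ * Ω + (1 + 7 / d) * (μ * Ω) ^ 2) := by
    have e : ∀ τ : Equiv.Perm (Fin d), (∑ t, w t * G (τ (a t)) (τ (b t))) ^ 2 =
        ∑ t, ∑ t', w t * w t' * (G (τ (a t)) (τ (b t)) * G (τ (a t')) (τ (b t'))) := by
      intro τ
      rw [sq, Finset.sum_mul_sum]
      exact Finset.sum_congr rfl fun t _ => Finset.sum_congr rfl fun t' _ => by ring
    simp only [e]
    rw [Finset.sum_comm]
    calc _ = ∑ t, ∑ t', w t * w t' * ∑ τ : Equiv.Perm (Fin d),
          G (τ (a t)) (τ (b t)) * G (τ (a t')) (τ (b t')) := by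
          refine Finset.sum_congr rfl fun t _ => ?_
          rw [Finset.sum_comm]
          simp only [Finset.mul_sum]
      _ ≤ ∑ t, ∑ t', w t * w t' * (D * ((if t = t' then μ else 0) + (1 + 7 / d) * μ ^ 2)) :=
          Finset.sum_le_sum fun t _ => Finset.sum_le_sum fun t' _ =>
            mul_le_mul_of_nonneg_left (hquad t t') (mul_nonneg (hw0 _) (hw0 _))
      _ = ∑ t, (w t * w t * (D * μ) + w t * (Ω * (D * ((1 + 7 / d) * μ ^ 2)))) := by
          refine Finset.sum_congr rfl fun t _ => ?_
          simp only [mul_add, Finset.sum_add_distrib, mul_ite, mul_zero, Finset.sum_ite_eq,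
            Finset.mem_univ, if_true]
          rw [hΩdef, Finset.sum_mul, Finset.mul_sum]
          congr 1
          exact Finset.sum_congr rfl fun t' _ => by ring
      _ ≤ ∑ t, (w t * (D * μ) + w t * (Ω * (D * ((1 + 7 / d) * μ ^ 2)))) := by
          refine Finset.sum_le_sum fun t _ => ?_
          have : w t * w t ≤ w t := by nlinarith [hw0 t, hw1 t]
          have := mul_le_mul_of_nonneg_right this (by positivity : 0 ≤ D * μ)
          linarith
      _ = _ := by
          rw [Finset.sum_add_distrib, ← Finset.sum_mul, ← Finset.sum_mul]; ring
  set m := μ * Ω with hm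
  have hm0 : 0 < m := mul_pos hμ hΩ
  have hcard : ∑ _τ : Equiv.Perm (Fin d), (1 : ℝ) = D := by
    simp [D, Finset.card_univ, Fintype.card_perm]
  calc _ ≤ ∑ τ : Equiv.Perm (Fin d),
        (2 / m + 4 * ((∑ t, w t * G (τ (a t)) (τ (b t))) - m) ^ 2 / m ^ 2) :=
        Finset.sum_le_sum fun τ _ => exp_neg_le_chebyshev (hX0 τ) hm0
    _ = (2 / m + 4) * ∑ _τ : Equiv.Perm (Fin d), (1 : ℝ) +
        4 / m ^ 2 * ∑ τ : Equiv.Perm (Fin d), (∑ t, w t * G (τ (a t)) (τ (b t))) ^ 2 -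
        8 / m * ∑ τ : Equiv.Perm (Fin d), ∑ t, w t * G (τ (a t)) (τ (b t)) := by
        rw [Finset.mul_sum (s := Finset.univ) (a := 2 / m + 4),
          Finset.mul_sum (s := Finset.univ) (a := 4 / m ^ 2),
          Finset.mul_sum (s := Finset.univ) (a := 8 / m), ← Finset.sum_add_distrib,
          ← Finset.sum_sub_distrib]
        refine Finset.sum_congr rfl fun τ _ => ?_
        field_simp
        ring
    _ ≤ (2 / m + 4) * D + 4 / m ^ 2 * (D * (m + (1 + 7 / d) * m ^ 2)) - 8 / m * (D * m) := by
        rw [hcard, hm1]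
        gcongr
    _ = _ := by field_simp; ring

theorem prod_eq_prod_compl_mul_pairs {d M : ℕ} (a b : Fin M → Fin d)
    (hab : Function.Injective (Sum.elim a b)) (F : Fin d → ℝ) :
    ∏ j, F j = (∏ j ∈ (Finset.univ.map ⟨Sum.elim a b, hab⟩)ᶜ, F j) *
      ∏ t, (F (a t) * F (b t)) := by
  rw [← Finset.prod_compl_mul_prod (Finset.univ.map ⟨Sum.elim a b, hab⟩), Finset.prod_map,
    Fintype.prod_sum_type, Finset.prod_mul_distrib]
  rfl

/-- Indicator that `x` has absolute values `{0, 1}` at the coordinates `i, j`. -/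
noncomputable def zeroUnitPair {d : ℕ} (x : Fin d → ℤ) (i j : Fin d) : ℝ :=
  if (|x i| = 1 ∧ x j = 0) ∨ (x i = 0 ∧ |x j| = 1) then 1 else 0

/-- The gain of a pair of frequencies in the swap symmetrization. -/
noncomputable def pairWeight (s t : ℝ) : ℝ := (1 - (1 - (s + t)) ^ 2) / 2

theorem cos_two_pi_mul_of_abs_one {k : ℤ} (hk : |k| = 1) (ξ : ℝ) :
    Real.cos (2 * Real.pi * (k * ξ)) = 1 - 2 * Real.sin (Real.pi * ξ) ^ 2 := by
  have : Real.cos (2 * (Real.pi * ξ)) = 1 - 2 * Real.sin (Real.pi * ξ) ^ 2 := by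
    rw [Real.cos_two_mul, Real.sin_sq]; ring
  rcases abs_eq (by norm_num : (0:ℤ) ≤ 1) |>.1 hk with h | h
  · rw [h, ← this]; push_cast; congr 1; ring
  · rw [h, ← this, ← Real.cos_neg]; push_cast; congr 1; ring

theorem abs_pair_average_le {d : ℕ} (x : Fin d → ℤ) (ξ : Fin d → ℝ) (i j : Fin d) :
    |(Real.cos (2 * Real.pi * (x i * ξ i)) * Real.cos (2 * Real.pi * (x j * ξ j)) +
      Real.cos (2 * Real.pi * (x j * ξ i)) * Real.cos (2 * Real.pi * (x i * ξ j))) / 2| ≤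
    Real.exp (-(pairWeight (Real.sin (Real.pi * ξ i) ^ 2) (Real.sin (Real.pi * ξ j) ^ 2) *
      zeroUnitPair x i j)) := by
  unfold zeroUnitPair
  have key : ∀ c : ℝ, |c| ≤ Real.exp (-((1 - c ^ 2) / 2)) := by
    intro c
    refine abs_le_of_sq_le_sq ?_ (Real.exp_nonneg _)
    rw [← Real.exp_nat_mul]
    have := Real.add_one_le_exp (c ^ 2 - 1)
    refine le_trans (by linarith) (this.trans (Real.exp_le_exp.2 (le_of_eq ?_)))
    push_cast; ring
  split_ifs with h
  · have e : (Real.cos (2 * Real.pi * (x i * ξ i)) * Real.cos (2 * Real.pi * (x j * ξ j)) +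
      Real.cos (2 * Real.pi * (x j * ξ i)) * Real.cos (2 * Real.pi * (x i * ξ j))) / 2 =
      1 - (Real.sin (Real.pi * ξ i) ^ 2 + Real.sin (Real.pi * ξ j) ^ 2) := by
      rcases h with ⟨h1, h2⟩ | ⟨h1, h2⟩
      · simp only [cos_two_pi_mul_of_abs_one h1, h2]; simp; ring
      · simp only [cos_two_pi_mul_of_abs_one h2, h1]; simp; ring
    rw [e, mul_one]
    exact key _
  · simp only [mul_zero, neg_zero, Real.exp_zero]
    have h : ∀ u v : ℝ, |Real.cos u * Real.cos v| ≤ 1 := fun u v => by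
      rw [abs_mul]
      exact mul_le_one₀ (Real.abs_cos_le_one _) (abs_nonneg _) (Real.abs_cos_le_one _)
    rw [abs_div, abs_two, div_le_one (by norm_num)]
    refine (abs_add_le _ _).trans ?_
    linarith [h (2 * Real.pi * (x i * ξ i)) (2 * Real.pi * (x j * ξ j)),
      h (2 * Real.pi * (x j * ξ i)) (2 * Real.pi * (x i * ξ j))]

theorem abs_cosSum_le_sum_exp {d R M : ℕ} (a b : Fin M → Fin d)
    (hab : Function.Injective (Sum.elim a b)) (ξ : Fin d → ℝ) :
    |cosSum d R ξ| ≤ ∑ x ∈ latticeBall d R, Real.exp (-∑ t,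
      pairWeight (Real.sin (Real.pi * ξ (a t)) ^ 2) (Real.sin (Real.pi * ξ (b t)) ^ 2) *
        zeroUnitPair x (a t) (b t)) := by
  have hb : ∀ t u, t ≠ u → a t ≠ a u ∧ b t ≠ b u := fun t u h =>
    ⟨fun e => h (Sum.inl_injective (hab (a₁ := Sum.inl t) (a₂ := Sum.inl u) (by simpa using e))),
      fun e => h (Sum.inr_injective (hab (a₁ := Sum.inr t) (a₂ := Sum.inr u) (by simpa using e)))⟩
  have hne : ∀ t u, a t ≠ b u := fun t u e => by
    have := hab (a₁ := Sum.inl t) (a₂ := Sum.inr u) (by simpa using e)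
    simp at this
  have h := sum_mul_prod_symm (𝕜 := ℝ) (latticeBall d R)
    (fun (t : Fin M) (x : Fin d → ℤ) => x ∘ Equiv.swap (a t) (b t))
    (fun t x => by ext i; simp)
    (fun t x hx => (comp_perm_mem_latticeBall _).2 hx)
    (fun t x => Real.cos (2 * Real.pi * (x (a t) * ξ (a t))) *
      Real.cos (2 * Real.pi * (x (b t) * ξ (b t))))
    (fun t u htu x => by
      simp only [Function.comp_apply]
      rw [Equiv.swap_apply_of_ne_of_ne (hb t u htu).1.symm (hne u t),
        Equiv.swap_apply_of_ne_of_ne (hne t u).symm (hb t u htu).2.symm])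
    (fun t u htu x => by
      simp only [Function.comp_apply, Equiv.swap_apply_left, Equiv.swap_apply_right]
      rw [Equiv.swap_apply_of_ne_of_ne (hb t u htu).1.symm (hne u t),
        Equiv.swap_apply_of_ne_of_ne (hne t u).symm (hb t u htu).2.symm])
    Finset.univ
    (fun x => ∏ j ∈ (Finset.univ.map ⟨Sum.elim a b, hab⟩)ᶜ, Real.cos (2 * Real.pi * (x j * ξ j)))
    (fun t _ x => by
      refine Finset.prod_congr rfl fun j hj => ?_
      simp only [Finset.mem_compl, Finset.mem_map, Finset.mem_univ, true_and,
        Function.Embedding.coeFn_mk, Sum.exists, Sum.elim_inl, Sum.elim_inr, not_or,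
        not_exists] at hj
      simp only [Function.comp_apply]
      rw [Equiv.swap_apply_of_ne_of_ne (fun e => hj.1 t e.symm) (fun e => hj.2 t e.symm)])
  have h0 : cosSum d R ξ = ∑ x ∈ latticeBall d R,
      (∏ j ∈ (Finset.univ.map ⟨Sum.elim a b, hab⟩)ᶜ, Real.cos (2 * Real.pi * (x j * ξ j))) *
      ∏ t, (Real.cos (2 * Real.pi * (x (a t) * ξ (a t))) *
      Real.cos (2 * Real.pi * (x (b t) * ξ (b t)))) :=
    Finset.sum_congr rfl fun x _ => prod_eq_prod_compl_mul_pairs a b hab _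
  rw [h0, h]
  refine (Finset.abs_sum_le_sum_abs _ _).trans (Finset.sum_le_sum fun x _ => ?_)
  rw [abs_mul, ← Finset.sum_neg_distrib, Real.exp_sum, Finset.abs_prod, Finset.abs_prod]
  refine (mul_le_of_le_one_left (Finset.prod_nonneg fun _ _ => abs_nonneg _)
    (Finset.prod_le_one (fun _ _ => abs_nonneg _) fun _ _ => Real.abs_cos_le_one _)).trans ?_
  refine Finset.prod_le_prod (fun _ _ => abs_nonneg _) fun t _ => ?_
  have := abs_pair_average_le x ξ (a t) (b t)
  simpa only [Function.comp_apply, Equiv.swap_apply_left, Equiv.swap_apply_right] using this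

theorem cosSum_comp_perm {d R : ℕ} (σ : Equiv.Perm (Fin d)) (ξ : Fin d → ℝ) :
    cosSum d R (ξ ∘ σ) = cosSum d R ξ := by
  unfold cosSum
  rw [← sum_latticeBall_comp_perm σ]
  refine Finset.sum_congr rfl fun x _ => ?_
  exact Equiv.prod_comp σ fun j => Real.cos (2 * Real.pi * (x j * ξ j))

theorem sum_offDiag_mul_one_sub {d : ℕ} (s : Fin d → ℝ) :
    ∑ p ∈ (Finset.univ : Finset (Fin d)).offDiag, s p.1 * (1 - s p.2) =
      (∑ i, s i) * (d - ∑ i, s i) - ∑ i, s i * (1 - s i) := by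
  have h := Finset.sum_product (Finset.univ : Finset (Fin d)) (Finset.univ : Finset (Fin d))
    (fun p => s p.1 * (1 - s p.2))
  rw [← Finset.diag_union_offDiag, Finset.sum_union (Finset.disjoint_diag_offDiag _),
    Finset.sum_diag] at h
  have h2 : ∑ i : Fin d, ∑ j : Fin d, s i * (1 - s j) = (∑ i, s i) * (d - ∑ i, s i) := by
    simp_rw [← Finset.mul_sum]
    rw [← Finset.sum_mul]; simp
  simp only [] at h
  linarith

theorem sum_offDiag_swap {d : ℕ} (F : Fin d → Fin d → ℝ) :
    ∑ p ∈ (Finset.univ : Finset (Fin d)).offDiag, F p.2 p.1 =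
      ∑ p ∈ (Finset.univ : Finset (Fin d)).offDiag, F p.1 p.2 :=
  Finset.sum_bij' (fun p _ => p.swap) (fun p _ => p.swap)
    (by simp [eq_comm]) (by simp [eq_comm]) (by simp) (by simp) (by simp)

theorem le_pairWeight {s t : ℝ} (hs0 : 0 ≤ s) (hs1 : s ≤ 1) (ht0 : 0 ≤ t) (ht1 : t ≤ 1) :
    (s * (1 - t) + t * (1 - s)) / 2 ≤ pairWeight s t := by
  unfold pairWeight
  nlinarith [mul_nonneg hs0 (sub_nonneg.2 hs1), mul_nonneg ht0 (sub_nonneg.2 ht1),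
    mul_nonneg hs0 (sub_nonneg.2 ht1), mul_nonneg ht0 (sub_nonneg.2 hs1)]

theorem pairWeight_nonneg {s t : ℝ} (hs0 : 0 ≤ s) (hs1 : s ≤ 1) (ht0 : 0 ≤ t) (ht1 : t ≤ 1) :
    0 ≤ pairWeight s t := by
  refine le_trans ?_ (le_pairWeight hs0 hs1 ht0 ht1)
  have := mul_nonneg hs0 (sub_nonneg.2 ht1)
  have := mul_nonneg ht0 (sub_nonneg.2 hs1)
  positivity

theorem pairWeight_le_one (s t : ℝ) : pairWeight s t ≤ 1 := by
  unfold pairWeight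
  nlinarith [sq_nonneg (1 - (s + t))]

theorem le_sum_offDiag_pairWeight {d : ℕ} (hd : 8 ≤ d) (s : Fin d → ℝ) (hs0 : ∀ i, 0 ≤ s i)
    (hs1 : ∀ i, s i ≤ 1) {v : ℝ} (hv0 : 0 ≤ v) (hv1 : v * d ≤ ∑ i, s i)
    (hv2 : v * d ≤ d - ∑ i, s i) :
    (d : ℝ) * (d - 1) * (v / 4) ≤
      ∑ p ∈ (Finset.univ : Finset (Fin d)).offDiag, pairWeight (s p.1) (s p.2) := by
  have hd' : (8:ℝ) ≤ d := by exact_mod_cast hd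
  have h1 : ∑ p ∈ (Finset.univ : Finset (Fin d)).offDiag, s p.1 * (1 - s p.2) ≤
      ∑ p ∈ (Finset.univ : Finset (Fin d)).offDiag, pairWeight (s p.1) (s p.2) := by
    have h := sum_offDiag_swap fun i j => s i * (1 - s j)
    have : ∑ p ∈ (Finset.univ : Finset (Fin d)).offDiag, s p.1 * (1 - s p.2) =
        ∑ p ∈ (Finset.univ : Finset (Fin d)).offDiag,
          (s p.1 * (1 - s p.2) + s p.2 * (1 - s p.1)) / 2 := by
      rw [← Finset.sum_div, Finset.sum_add_distrib, h]; ring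
    rw [this]
    exact Finset.sum_le_sum fun p _ => le_pairWeight (hs0 _) (hs1 _) (hs0 _) (hs1 _)
  refine le_trans ?_ h1
  rw [sum_offDiag_mul_one_sub]
  set S := ∑ i, s i with hS
  have h2 : ∑ i, s i * (1 - s i) ≤ S :=
    Finset.sum_le_sum fun i _ => by nlinarith [hs0 i, sq_nonneg (s i)]
  have h3 : ∑ i, s i * (1 - s i) ≤ d - S := by
    have : ∑ i, (1 - s i) = d - S := by simp [hS]
    rw [← this]
    exact Finset.sum_le_sum fun i _ => by nlinarith [hs1 i, sq_nonneg (1 - s i)]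
  rcases le_total S (d - S) with h | h
  · have : d / 2 ≤ d - S := by linarith
    nlinarith [mul_le_mul_of_nonneg_left (show (d:ℝ) / 2 - 1 ≤ d - S - 1 by linarith)
      (show 0 ≤ S by nlinarith), mul_nonneg hv0 (by linarith : (0:ℝ) ≤ d),
      mul_le_mul_of_nonneg_right hv1 (show (0:ℝ) ≤ d / 2 - 1 by linarith),
      mul_nonneg (mul_nonneg hv0 (by linarith : (0:ℝ) ≤ d)) (by linarith : (0:ℝ) ≤ d - 8)]
  · have : d / 2 ≤ S := by linarith
    nlinarith [mul_le_mul_of_nonneg_left (show (d:ℝ) / 2 - 1 ≤ S - 1 by linarith)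
      (show 0 ≤ d - S by nlinarith), mul_nonneg hv0 (by linarith : (0:ℝ) ≤ d),
      mul_le_mul_of_nonneg_right hv2 (show (0:ℝ) ≤ d / 2 - 1 by linarith),
      mul_nonneg (mul_nonneg hv0 (by linarith : (0:ℝ) ≤ d)) (by linarith : (0:ℝ) ≤ d - 8)]

theorem exists_perm_le_sum_pairWeight {d M : ℕ} (hd : 8 ≤ d) (a b : Fin M → Fin d)
    (hab : ∀ t, a t ≠ b t) (s : Fin d → ℝ) (hs0 : ∀ i, 0 ≤ s i)
    (hs1 : ∀ i, s i ≤ 1) {v : ℝ} (hv0 : 0 ≤ v) (hv1 : v * d ≤ ∑ i, s i)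
    (hv2 : v * d ≤ d - ∑ i, s i) :
    ∃ σ : Equiv.Perm (Fin d), M * v / 4 ≤ ∑ t, pairWeight (s (σ (a t))) (s (σ (b t))) := by
  have hd' : (8:ℝ) ≤ d := by exact_mod_cast hd
  have hdd : 0 < (d:ℝ) * (d - 1) := mul_pos (by linarith) (by linarith)
  by_contra! hcon
  have h1 := Finset.sum_lt_sum_of_nonempty (Finset.univ_nonempty (α := Equiv.Perm (Fin d)))
    fun σ _ => hcon σ
  rw [Finset.sum_const, Finset.card_univ, Fintype.card_perm, Fintype.card_fin, nsmul_eq_mul,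
    Finset.sum_comm] at h1
  have h2 : ∀ t : Fin M, (d.factorial : ℝ) * (v / 4) ≤
      ∑ σ : Equiv.Perm (Fin d), pairWeight (s (σ (a t))) (s (σ (b t))) := by
    intro t
    have := sum_perm_pair (hab t) fun i j => pairWeight (s i) (s j)
    have h3 := le_sum_offDiag_pairWeight hd s hs0 hs1 hv0 hv1 hv2
    have h4 := mul_le_mul_of_nonneg_left h3 (Nat.cast_nonneg (α := ℝ) d.factorial)
    rw [← this] at h4
    refine le_of_mul_le_mul_left ?_ hdd
    linarith
  have h3 := Finset.sum_le_sum fun t (_ : t ∈ (Finset.univ : Finset (Fin M))) => h2 t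
  rw [Finset.sum_const, Finset.card_univ, Fintype.card_fin, nsmul_eq_mul] at h3
  linarith

theorem zeroUnitPair_nonneg {d : ℕ} (x : Fin d → ℤ) (i j : Fin d) : 0 ≤ zeroUnitPair x i j := by
  unfold zeroUnitPair; split_ifs <;> norm_num

theorem zeroUnitPair_mul_self {d : ℕ} (x : Fin d → ℤ) (i j : Fin d) :
    zeroUnitPair x i j * zeroUnitPair x i j = zeroUnitPair x i j := by
  unfold zeroUnitPair; split_ifs <;> norm_num

theorem card_mul_card_le_sum_zeroUnitPair {d : ℕ} (x : Fin d → ℤ) :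
    ((unitCoords x).card : ℝ) * (zeroCoords x).card ≤
      ∑ p ∈ (Finset.univ : Finset (Fin d)).offDiag, zeroUnitPair x p.1 p.2 := by
  have hsub : unitCoords x ×ˢ zeroCoords x ⊆ (Finset.univ : Finset (Fin d)).offDiag := by
    intro p hp
    simp only [unitCoords, zeroCoords, Finset.mem_product, Finset.mem_filter, Finset.mem_univ,
      true_and] at hp
    simp only [Finset.mem_offDiag, Finset.mem_univ, true_and]
    intro h
    rw [h, hp.2] at hp
    simp at hp
  refine le_trans ?_ (Finset.sum_le_sum_of_subset_of_nonneg hsub fun p _ _ =>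
    zeroUnitPair_nonneg x _ _)
  have : ∀ p ∈ unitCoords x ×ˢ zeroCoords x, zeroUnitPair x p.1 p.2 = 1 := by
    intro p hp
    simp only [unitCoords, zeroCoords, Finset.mem_product, Finset.mem_filter, Finset.mem_univ,
      true_and] at hp
    unfold zeroUnitPair
    rw [if_pos (Or.inl hp)]
  rw [Finset.sum_congr rfl this]
  simp

theorem sum_perm_exp_zeroUnitPair_le {d R M m : ℕ} (hR : 4 ≤ R) (hd : 2 * R ≤ d) (hm0 : 0 < m)
    (a b : Fin M → Fin d) (hab : Function.Injective (Sum.elim a b)) (w : Fin M → ℝ)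
    (hw0 : ∀ t, 0 ≤ w t) (hw1 : ∀ t, w t ≤ 1) {v : ℝ} (hv : 0 < v)
    (hΩ : d * v / 12 ≤ ∑ t, w t) {x : Fin d → ℤ} (hx : x ∈ latticeBall d R)
    (hK : m ≤ (unitCoords x).card) :
    ∑ τ : Equiv.Perm (Fin d), Real.exp (-∑ t, w t * zeroUnitPair x (τ (a t)) (τ (b t))) ≤
      (d.factorial : ℝ) * (144 / (m * v) + 28 / d) := by
  have hd8 : 8 ≤ d := by omega
  have hd' : (8:ℝ) ≤ d := by exact_mod_cast hd8
  have hdR : 2 * (R:ℝ) ≤ d := by exact_mod_cast hd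
  have hm' : (0:ℝ) < m := by exact_mod_cast hm0
  have hdd : 0 < (d:ℝ) * (d - 1) := mul_pos (by linarith) (by linarith)
  have hΩ0 : 0 < ∑ t, w t := lt_of_lt_of_le (by positivity) hΩ
  set D := ∑ p ∈ (Finset.univ : Finset (Fin d)).offDiag, zeroUnitPair x p.1 p.2 with hD
  have hK' : (m:ℝ) ≤ (unitCoords x).card := by exact_mod_cast hK
  have hDm : m * (d / 2) ≤ D := by
    refine le_trans ?_ (card_mul_card_le_sum_zeroUnitPair x)
    have := sub_le_card_zeroCoords hx
    exact mul_le_mul hK' (by linarith) (by positivity) (by positivity)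
  have hμ : (m:ℝ) / (2 * d) ≤ D / (d * (d - 1)) := by
    rw [div_le_div_iff₀ (by positivity) hdd]
    nlinarith [mul_le_mul_of_nonneg_right hDm (by linarith : (0:ℝ) ≤ 2 * d),
      mul_pos hm' (by linarith : (0:ℝ) < d)]
  have hμ0 : 0 < D / (d * (d - 1)) := lt_of_lt_of_le (by positivity) hμ
  refine (sum_perm_exp_le hd8 a b hab w hw0 hw1 hΩ0 (zeroUnitPair x) (zeroUnitPair_nonneg x)
    (zeroUnitPair_mul_self x) hμ0 (div_mul_cancel₀ _ hdd.ne')).trans ?_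
  refine mul_le_mul_of_nonneg_left (add_le_add ?_ le_rfl) (Nat.cast_nonneg _)
  have : m * v / 24 ≤ D / (d * (d - 1)) * ∑ t, w t := by
    refine le_trans (le_of_eq ?_) (mul_le_mul hμ hΩ (by positivity) hμ0.le)
    field_simp; norm_num
  calc _ ≤ 6 / (m * v / 24) := div_le_div_of_nonneg_left (by norm_num) (by positivity) this
    _ = _ := by field_simp; norm_num

theorem abs_cosSum_le_of_few_units {d R m : ℕ} (hR : 4 ≤ R) (hd : 2 * R ≤ d) (hm0 : 0 < m)
    (hm : 2 * m ≤ R) (ξ : Fin d → ℝ) {v : ℝ} (hv : 0 < v) (hv1 : v ≤ sinMean d ξ)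
    (hv2 : v ≤ 1 - sinMean d ξ) :
    |cosSum d R ξ| ≤ (20 * (m + 2) / d + 144 / (m * v) + 28 / d) * (latticeBall d R).card := by
  have hd8 : 8 ≤ d := by omega
  have hd' : (8:ℝ) ≤ d := by exact_mod_cast hd8
  have hm' : (0:ℝ) < m := by exact_mod_cast hm0
  let a : Fin (d / 2) → Fin d := fun t => ⟨2 * t, by omega⟩
  let b : Fin (d / 2) → Fin d := fun t => ⟨2 * t + 1, by omega⟩
  have hab : Function.Injective (Sum.elim a b) := by
    rintro (i | i) (j | j) hij
    · simp only [Sum.elim_inl, a, Fin.mk.injEq] at hij; congr 1; ext; omega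
    · simp only [Sum.elim_inl, Sum.elim_inr, a, b, Fin.mk.injEq] at hij; omega
    · simp only [Sum.elim_inl, Sum.elim_inr, a, b, Fin.mk.injEq] at hij; omega
    · simp only [Sum.elim_inr, b, Fin.mk.injEq] at hij; congr 1; ext; omega
  set s : Fin d → ℝ := fun j => Real.sin (Real.pi * ξ j) ^ 2 with hs
  have hs0 : ∀ j, 0 ≤ s j := fun j => sq_nonneg _
  have hs1 : ∀ j, s j ≤ 1 := fun j => Real.sin_sq_le_one _
  have hsum : ∑ j, s j = sinMean d ξ * d := by unfold sinMean; field_simp; rfl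
  obtain ⟨σ, hσ⟩ := exists_perm_le_sum_pairWeight hd8 a b
    (fun t h => by simp only [a, b, Fin.mk.injEq] at h; omega) s hs0 hs1 hv.le
    (by rw [hsum]; gcongr) (by rw [hsum]; nlinarith)
  set w : Fin (d / 2) → ℝ := fun t => pairWeight (s (σ (a t))) (s (σ (b t))) with hw
  have hΩ : d * v / 12 ≤ ∑ t, w t := by
    refine le_trans ?_ hσ
    have : (d:ℝ) ≤ 3 * (d / 2 : ℕ) := by
      have : d ≤ 3 * (d / 2) := by omega
      exact_mod_cast this
    nlinarith
  have hbound : ∀ x, Real.exp (-∑ t, w t * zeroUnitPair x (a t) (b t)) ≤ 1 := fun x =>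
    Real.exp_le_one_iff.2 (neg_nonpos.2 (Finset.sum_nonneg fun t _ =>
      mul_nonneg (pairWeight_nonneg (hs0 _) (hs1 _) (hs0 _) (hs1 _)) (zeroUnitPair_nonneg _ _ _)))
  have h1 : |cosSum d R ξ| ≤ ∑ x ∈ latticeBall d R,
      Real.exp (-∑ t, w t * zeroUnitPair x (a t) (b t)) := by
    rw [← cosSum_comp_perm σ]
    exact abs_cosSum_le_sum_exp a b hab (ξ ∘ σ)
  have hfac : (0:ℝ) < d.factorial := by exact_mod_cast d.factorial_pos
  have h2 : (d.factorial : ℝ) * |cosSum d R ξ| ≤ ∑ x ∈ latticeBall d R,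
      ∑ τ : Equiv.Perm (Fin d),
        Real.exp (-∑ t, w t * zeroUnitPair x (τ (a t)) (τ (b t))) := by
    rw [Finset.sum_comm]
    have : ∀ τ : Equiv.Perm (Fin d), |cosSum d R ξ| ≤ ∑ x ∈ latticeBall d R,
        Real.exp (-∑ t, w t * zeroUnitPair x (τ (a t)) (τ (b t))) := by
      intro τ
      refine h1.trans (le_of_eq ?_)
      exact (sum_latticeBall_comp_perm τ fun x =>
        Real.exp (-∑ t, w t * zeroUnitPair x (a t) (b t))).symm
    have := Finset.sum_le_sum fun τ (_ : τ ∈ (Finset.univ : Finset (Equiv.Perm (Fin d)))) => this τ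
    rwa [Finset.sum_const, Finset.card_univ, Fintype.card_perm, Fintype.card_fin,
      nsmul_eq_mul] at this
  have h3 : ∀ x ∈ latticeBall d R, ∑ τ : Equiv.Perm (Fin d),
        Real.exp (-∑ t, w t * zeroUnitPair x (τ (a t)) (τ (b t))) ≤
      (d.factorial : ℝ) * (144 / (m * v) + 28 / d) +
        (if (unitCoords x).card < m then (d.factorial : ℝ) else 0) := by
    intro x hx
    split_ifs with h
    · have : ∑ τ : Equiv.Perm (Fin d),
        Real.exp (-∑ t, w t * zeroUnitPair x (τ (a t)) (τ (b t))) ≤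
          ∑ τ : Equiv.Perm (Fin d), 1 := Finset.sum_le_sum fun τ _ => hbound (x ∘ τ)
      simp only [Finset.sum_const, Finset.card_univ, Fintype.card_perm, Fintype.card_fin,
        nsmul_eq_mul, mul_one] at this
      have h0 : 0 ≤ (d.factorial : ℝ) * (144 / (m * v) + 28 / d) := by positivity
      linarith
    · rw [add_zero]
      exact sum_perm_exp_zeroUnitPair_le hR hd hm0 a b hab w
        (fun t => pairWeight_nonneg (hs0 _) (hs1 _) (hs0 _) (hs1 _))
        (fun t => pairWeight_le_one _ _) hv hΩ hx (not_lt.1 h)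
  have h4 := h2.trans (Finset.sum_le_sum h3)
  rw [Finset.sum_add_distrib, Finset.sum_const, nsmul_eq_mul, ← Finset.sum_filter,
    Finset.sum_const, nsmul_eq_mul] at h4
  have h5 := card_few_units_le (by omega) hd hm
  have h6 : (((latticeBall d R).filter fun x => (unitCoords x).card < m).card : ℝ) ≤
      20 * (m + 2) / d * (latticeBall d R).card := by
    rw [div_mul_eq_mul_div, le_div_iff₀ (by linarith)]; linarith
  refine le_of_mul_le_mul_left ?_ hfac
  have h7 := mul_le_mul_of_nonneg_right h6 hfac.le
  linarith

theorem abs_cosSum_le_small {d R : ℕ} (hR : 4 ≤ R) (hd : 2 * R ≤ d) (ξ : Fin d → ℝ) {v t : ℝ}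
    (hv1 : v ≤ sinMean d ξ) (hv2 : v ≤ 1 - sinMean d ξ) (ht : 0 < t) (htv : t ^ 2 = R * v) :
    |cosSum d R ξ| ≤ 160 * (1 / t + 1 / R) * (latticeBall d R).card := by
  have hR' : (4:ℝ) ≤ R := by exact_mod_cast hR
  have hdR : 2 * (R:ℝ) ≤ d := by exact_mod_cast hd
  have hv : 0 < v := by
    by_contra h
    nlinarith [pow_pos ht 2]
  rcases lt_or_ge t 4 with h4 | h4
  · refine (abs_cosSum_le d R ξ).trans (le_mul_of_one_le_left (Nat.cast_nonneg _) ?_)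
    have : 1 / 4 ≤ 1 / t := by gcongr
    have : 0 ≤ 1 / (R:ℝ) := by positivity
    linarith
  · have hfl := Nat.floor_le (show 0 ≤ R / t by positivity)
    have hfl2 := Nat.lt_floor_add_one (R / t)
    have hRt : R / t ≤ R / 4 := by gcongr
    have h2m : 2 * (⌊R / t⌋₊ + 1) ≤ R := by
      have : 2 * ((⌊R / t⌋₊ : ℝ) + 1) ≤ R := by linarith
      exact_mod_cast this
    refine (abs_cosSum_le_of_few_units hR hd (Nat.succ_pos ⌊R / t⌋₊) h2m ξ hv hv1 hv2).trans ?_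
    gcongr
    push_cast
    have e1 : 144 / (((⌊R / t⌋₊ : ℝ) + 1) * v) ≤ 144 / t := by
      have : t ≤ ((⌊R / t⌋₊ : ℝ) + 1) * v := by
        have h : t = R / t * v := by field_simp; linarith
        calc t = R / t * v := h
          _ ≤ _ := by gcongr
      gcongr
    have e2 : 20 * ((⌊R / t⌋₊ : ℝ) + 1 + 2) / d ≤ 20 * (R / t + 3) / (2 * R) := by
      gcongr ?_ / ?_
      linarith
    have e3 : 20 * (R / t + 3) / (2 * R) = 10 / t + 30 / R := by field_simp; ring
    have e4 : 28 / (d:ℝ) ≤ 28 / (2 * R) := by gcongr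
    have e5 : 28 / (2 * (R:ℝ)) = 14 / R := by field_simp; norm_num
    have e6 : 0 ≤ 1 / t := by positivity
    have e7 : 0 ≤ 1 / (R:ℝ) := by positivity
    have e8 : 144 / t = 144 * (1 / t) := by ring
    have e9 : 10 / t = 10 * (1 / t) := by ring
    have e10 : 30 / (R:ℝ) = 30 * (1 / R) := by ring
    have e11 : 14 / (R:ℝ) = 14 * (1 / R) := by ring
    linarith

/-- The average of the powers `r ^ i` over `i < 4 ^ n`. -/
noncomputable def geomAvg (n : ℕ) (r : ℝ) : ℝ := (∑ i ∈ Finset.range (4 ^ n), r ^ i) / 4 ^ n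

theorem geomAvg_nonneg (n : ℕ) {r : ℝ} (hr : 0 ≤ r) : 0 ≤ geomAvg n r :=
  div_nonneg (Finset.sum_nonneg fun _ _ => pow_nonneg hr _) (by positivity)

theorem geomAvg_le_one (n : ℕ) {r : ℝ} (hr : 0 ≤ r) (hr1 : r ≤ 1) : geomAvg n r ≤ 1 := by
  unfold geomAvg
  rw [div_le_one (by positivity)]
  refine (Finset.sum_le_sum fun i _ => pow_le_one₀ hr hr1).trans ?_
  simp

theorem one_sub_geomAvg_le (n : ℕ) {r : ℝ} (hr : 0 ≤ r) (hr1 : r ≤ 1) :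
    1 - geomAvg n r ≤ 4 ^ n * (1 - r) := by
  unfold geomAvg
  have h : ∀ i ∈ Finset.range (4 ^ n), 1 - 4 ^ n * (1 - r) ≤ r ^ i := by
    intro i hi
    have h1 := one_add_mul_le_pow (show -2 ≤ r - 1 by linarith) i
    have h2 : (i:ℝ) ≤ 4 ^ n := by
      exact_mod_cast (Finset.mem_range.1 hi).le
    have h3 : (1 + (r - 1)) = r := by ring
    rw [h3] at h1
    nlinarith
  have h2 := Finset.sum_le_sum h
  rw [Finset.sum_const, Finset.card_range, nsmul_eq_mul] at h2
  push_cast at h2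
  rw [sub_le_comm, le_div_iff₀ (by positivity)]
  linarith

theorem geomAvg_mul_le_one (n : ℕ) {r : ℝ} (hr : 0 ≤ r) :
    geomAvg n r * (4 ^ n * (1 - r)) ≤ 1 := by
  unfold geomAvg
  have h := mul_neg_geom_sum r (4 ^ n)
  have : 0 ≤ r ^ 4 ^ n := by positivity
  calc _ = (1 - r) * ∑ i ∈ Finset.range (4 ^ n), r ^ i := by field_simp
    _ ≤ 1 := by rw [h]; linarith

theorem sum_min_geometric_le {ρ l : ℝ} (hρ : 1 < ρ) (hl : 0 ≤ l) (N : ℕ) :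
    ∑ n ∈ Finset.range N, min (ρ ^ n * l) (1 / (ρ ^ n * l)) ≤ 2 * (ρ + 1) / (ρ - 1) := by
  have hρ0 : 0 < ρ - 1 := by linarith
  let h : ℕ → ℝ := fun n => (ρ ^ n * l) / (1 + ρ ^ n * l)
  have key : ∀ n, min (ρ ^ n * l) (1 / (ρ ^ n * l)) ≤
      2 * (ρ + 1) / (ρ - 1) * (h (n + 1) - h n) := by
    intro n
    simp only [h]
    rcases hl.eq_or_lt with rfl | hl
    · simp
    have hy : 0 < ρ ^ n * l := by positivity
    rw [pow_succ, show ρ ^ n * ρ * l = ρ * (ρ ^ n * l) by ring]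
    set y := ρ ^ n * l
    have e : 2 * (ρ + 1) / (ρ - 1) * (ρ * y / (1 + ρ * y) - y / (1 + y)) =
        2 * (ρ + 1) * y / ((1 + ρ * y) * (1 + y)) := by
      have : 1 + ρ * y ≠ 0 := by positivity
      have : 1 + y ≠ 0 := by positivity
      field_simp
      ring
    rw [e]
    rcases le_total y 1 with h1 | h1
    · refine (min_le_left _ _).trans ?_
      rw [le_div_iff₀ (by positivity)]
      have : (1 + ρ * y) * (1 + y) ≤ (ρ + 1) * 2 := by
        apply mul_le_mul <;> nlinarith
      nlinarith
    · refine (min_le_right _ _).trans ?_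
      rw [div_le_div_iff₀ hy (by positivity)]
      have : (1 + ρ * y) * (1 + y) ≤ ((ρ + 1) * y) * (2 * y) := by
        apply mul_le_mul <;> nlinarith
      nlinarith
  refine (Finset.sum_le_sum fun n _ => key n).trans ?_
  rw [← Finset.mul_sum, Finset.sum_range_sub]
  refine mul_le_of_le_one_right (by positivity) ?_
  have h1 : h N ≤ 1 := by
    simp only [h]
    have : 0 ≤ ρ ^ N * l := by positivity
    rw [div_le_one (by positivity)]
    linarith
  have h2 : 0 ≤ h 0 := by simp only [h]; positivity
  linarith

theorem sum_min_sqrt_two_le {l : ℝ} (hl : 0 ≤ l) (N : ℕ) :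
    ∑ n ∈ Finset.range N, min (√2 ^ n * l) (1 / (√2 ^ n * l)) ≤ 12 := by
  have h2 : √2 ^ 2 = (2:ℝ) := Real.sq_sqrt (by norm_num)
  have h1 : (1.41 : ℝ) < √2 := Real.lt_sqrt_of_sq_lt (by norm_num)
  refine (sum_min_geometric_le (by linarith) hl N).trans ?_
  rw [div_le_iff₀ (by linarith)]
  linarith

theorem sum_min_two_le {l : ℝ} (hl : 0 ≤ l) (N : ℕ) :
    ∑ n ∈ Finset.range N, min ((2:ℝ) ^ n * l) (1 / (2 ^ n * l)) ≤ 6 := by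
  refine (sum_min_geometric_le (by norm_num) hl N).trans ?_
  norm_num

/-- The difference of the ball multiplier and its semigroup model. -/
noncomputable def multiplierError (d n : ℕ) (ξ : Fin d → ℝ) : ℝ :=
  cosSum d (4 ^ n) ξ / (latticeBall d (4 ^ n)).card - geomAvg n (1 - sinMean d ξ) -
    if 2 * 4 ^ n < d then
      (cosSum d (4 ^ n) fun _ => 1 / 2) / (latticeBall d (4 ^ n)).card * geomAvg n (sinMean d ξ)
    else 0

theorem sq_le_of_abs_le_add {e a b c : ℝ} (h : |e| ≤ c * (a + b)) :
    e ^ 2 ≤ 2 * c ^ 2 * (a ^ 2 + b ^ 2) := by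
  have h1 : e ^ 2 ≤ (c * (a + b)) ^ 2 := by
    rw [← sq_abs]; gcongr
  have h2 : (a + b) ^ 2 ≤ 2 * (a ^ 2 + b ^ 2) := add_sq_le
  nlinarith [mul_le_mul_of_nonneg_left h2 (sq_nonneg c)]

theorem sq_sq_div_le {y : ℝ} (hy : 1 ≤ y) : (1 / y ^ 2) ^ 2 ≤ 1 / y := by
  rw [one_div_pow, ← pow_mul]
  have : y ≤ y ^ (2 * 2) := le_self_pow₀ hy (by norm_num)
  gcongr

/-- A bound for a quantity decaying away from the scale `y = 1`. -/
theorem sq_le_of_two_sided {e y b : ℝ} (hy : 0 ≤ y) (hb0 : 0 ≤ b) (hb1 : b ≤ 1)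
    (h1 : |e| ≤ 3 * y ^ 4 + 2 * b)
    (h2 : 1 ≤ y → |e| ≤ 162 * (1 / y ^ 2 + b)) :
    e ^ 2 ≤ 130000 * (min y (1 / y) + b) := by
  have hbb : b ^ 2 ≤ b := by nlinarith
  rcases le_total y 1 with hy1 | hy1
  · have h : |e| ≤ 3 * (y ^ 4 + b) := by linarith
    have h3 := sq_le_of_abs_le_add h
    have h4 : (y ^ 4) ^ 2 ≤ y := by
      rw [← pow_mul]; exact pow_le_of_le_one hy hy1 (by norm_num)
    rcases hy.eq_or_lt with rfl | hy0
    · simp at h4 h3 ⊢; linarith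
    have h5 : y ≤ 1 / y := by rw [le_div_iff₀ hy0]; nlinarith
    rw [min_eq_left h5]; nlinarith
  · have h3 := sq_le_of_abs_le_add (h2 hy1)
    have h4 := sq_sq_div_le hy1
    have h5 : 1 / y ≤ y := by rw [div_le_iff₀ (by linarith)]; nlinarith
    rw [min_eq_right h5]
    nlinarith

theorem abs_div_card_le {d R : ℕ} {A c : ℝ} (h : |A| ≤ c * (latticeBall d R).card) :
    |A / (latticeBall d R).card| ≤ c := by
  rw [abs_div, abs_of_pos (latticeBall_card_pos d R)]
  exact (div_le_iff₀ (latticeBall_card_pos d R)).2 h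

theorem multiplierError_sq_le_large {d n : ℕ} (hd : 1 ≤ d) (hn : d ≤ 2 * 4 ^ n) (ξ : Fin d → ℝ)
    (hξ : ∀ j, |ξ j| ≤ 1 / 2) {l : ℝ} (hl : 0 ≤ l) (hlv : l ^ 4 = sinMean d ξ) :
    multiplierError d n ξ ^ 2 ≤ 130000 * (min (√2 ^ n * l) (1 / (√2 ^ n * l)) +
      2 * min (2 ^ n * (1 / √d)) (1 / (2 ^ n * (1 / √d)))) := by
  have hd0 : (0:ℝ) < d := by exact_mod_cast hd
  have hs0 := sinMean_nonneg d ξ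
  have hs1 := sinMean_le_one hd ξ
  have hV := latticeBall_card_pos d (4 ^ n)
  have h2 : (√2 ^ n) ^ 4 = (4:ℝ) ^ n := by
    rw [← pow_mul, mul_comm n 4, pow_mul]
    congr 1
    rw [show √2 ^ 4 = (√2 ^ 2) ^ 2 by ring, Real.sq_sqrt (by norm_num)]; norm_num
  have hu : (√2 ^ n * l) ^ 4 = 4 ^ n * sinMean d ξ := by rw [mul_pow, hlv, h2]
  set y := √2 ^ n * l with hy
  have hy0 : 0 ≤ y := by positivity
  have hz : 1 ≤ 2 * (2 ^ n * (1 / √d)) ^ 2 := by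
    have : (2 ^ n * (1 / √d)) ^ 2 = (4:ℝ) ^ n / d := by
      rw [mul_pow, one_div_pow, Real.sq_sqrt hd0.le, ← pow_mul, mul_comm n 2, pow_mul]
      norm_num [div_eq_mul_inv]
    rw [this, mul_div_assoc', le_div_iff₀ hd0, one_mul]
    exact_mod_cast hn
  have hz4 : (√(2 ^ n * (1 / √d))) ^ 4 * d = (4:ℝ) ^ n := by
    rw [show √(2 ^ n * (1 / √d)) ^ 4 = (√(2 ^ n * (1 / √d)) ^ 2) ^ 2 by ring,
      Real.sq_sqrt (by positivity), mul_pow, one_div_pow, Real.sq_sqrt hd0.le, ← pow_mul,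
      mul_comm n 2, pow_mul]
    field_simp; norm_num
  set z := 2 ^ n * (1 / √d) with hzdef
  have hz0 : 0 < z := by positivity
  have he : multiplierError d n ξ =
      cosSum d (4 ^ n) ξ / (latticeBall d (4 ^ n)).card - geomAvg n (1 - sinMean d ξ) := by
    unfold multiplierError
    rw [if_neg (by omega), sub_zero]
  have hmin : 1 / z ≤ 2 * min z (1 / z) := by
    rcases le_total z (1 / z) with h | h
    · rw [min_eq_left h, div_le_iff₀ hz0]; nlinarith
    · rw [min_eq_right h]; have : 0 < 1 / z := by positivity
      linarith
  have hzmin : 0 ≤ min z (1 / z) := le_min hz0.le (by positivity)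
  rw [he]
  rcases lt_or_ge y 1 with h1 | h1
  · have e1 : |cosSum d (4 ^ n) ξ / (latticeBall d (4 ^ n)).card -
        geomAvg n (1 - sinMean d ξ)| ≤ 3 * (y ^ 4 + 0) := by
      have a1 : |(cosSum d (4 ^ n) ξ - (latticeBall d (4 ^ n)).card) /
          (latticeBall d (4 ^ n)).card| ≤ 2 * y ^ 4 := by
        refine abs_div_card_le ?_
        have := abs_cosSum_sub_card_le (R := 4 ^ n) hd ξ
        rw [hu]; push_cast at this; linarith
      have a2 := one_sub_geomAvg_le n (sub_nonneg.2 hs1) (by linarith : 1 - sinMean d ξ ≤ 1)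
      have a3 := geomAvg_le_one n (sub_nonneg.2 hs1) (by linarith : 1 - sinMean d ξ ≤ 1)
      rw [_root_.sub_sub_cancel, ← hu] at a2
      rw [sub_div, div_self hV.ne'] at a1
      rw [abs_le] at a1 ⊢
      constructor <;> linarith
    have h3 := sq_le_of_abs_le_add e1
    have h4 : (y ^ 4) ^ 2 ≤ min y (1 / y) := by
      have h4 : (y ^ 4) ^ 2 ≤ y := by
        rw [← pow_mul]; exact pow_le_of_le_one hy0 h1.le (by norm_num)
      refine le_min h4 (h4.trans ?_)
      rcases hy0.eq_or_lt with h0 | h0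
      · rw [← h0]; simp
      · rw [le_div_iff₀ h0]; nlinarith
    nlinarith
  · have ht : √y ^ 8 = ((4 ^ n : ℕ):ℝ) * sinMean d ξ := by
      rw [show √y ^ 8 = (√y ^ 2) ^ 4 by ring, Real.sq_sqrt hy0, hu]; push_cast; rfl
    have hty : 0 < √y := Real.sqrt_pos.2 (by linarith)
    have a1 : |cosSum d (4 ^ n) ξ / (latticeBall d (4 ^ n)).card| ≤ 250 * (1 / √y + 1 / √z) := by
      refine abs_div_card_le ?_
      obtain ⟨k, rfl⟩ : ∃ k, d = k + 1 := ⟨d - 1, by omega⟩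
      exact abs_cosSum_le_large hn ξ hξ hty (Real.sqrt_pos.2 hz0) ht
        (by push_cast at hz4 ⊢; exact hz4)
    have a2 := geomAvg_mul_le_one n (sub_nonneg.2 hs1)
    rw [_root_.sub_sub_cancel, ← hu] at a2
    have a3 := geomAvg_nonneg n (sub_nonneg.2 hs1)
    have a4 : geomAvg n (1 - sinMean d ξ) ≤ 1 / √y := by
      rw [le_div_iff₀ hty]
      refine le_trans (mul_le_mul_of_nonneg_left ?_ a3) a2
      refine (Real.sqrt_le_left (by linarith)).2 ?_ |>.trans (le_self_pow₀ h1 (by norm_num))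
      nlinarith
    have e1 : |cosSum d (4 ^ n) ξ / (latticeBall d (4 ^ n)).card -
        geomAvg n (1 - sinMean d ξ)| ≤ 251 * (1 / √y + 1 / √z) := by
      have : 0 < 1 / √z := one_div_pos.2 (Real.sqrt_pos.2 hz0)
      refine (abs_sub _ _).trans ?_
      rw [abs_of_nonneg a3]
      linarith
    have h3 := sq_le_of_abs_le_add e1
    rw [one_div_pow, one_div_pow, Real.sq_sqrt hy0, Real.sq_sqrt hz0.le] at h3
    have h5 : 1 / y ≤ y := by rw [div_le_iff₀ (by linarith)]; nlinarith
    have h6 : 0 < 1 / y := by positivity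
    rw [min_eq_right h5]
    linarith

theorem multiplierError_sq_le_small {d n : ℕ} (hn : 2 * 4 ^ n < d) (ξ : Fin d → ℝ)
    {v l : ℝ} (hv : (v = sinMean d ξ ∨ v = 1 - sinMean d ξ) ∧ v ≤ 1 / 2) (hl : 0 ≤ l)
    (hlv : l ^ 4 = v) :
    multiplierError d n ξ ^ 2 ≤ 130000 * (min (√2 ^ n * l) (1 / (√2 ^ n * l)) + 1 / 4 ^ n) := by
  have hd : 1 ≤ d := by omega
  have hs0 := sinMean_nonneg d ξ
  have hs1 := sinMean_le_one hd ξ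
  have hV := latticeBall_card_pos d (4 ^ n)
  have hR : (0:ℝ) < 4 ^ n := by positivity
  have hR1 : (1:ℝ) ≤ 4 ^ n := one_le_pow₀ (by norm_num)
  have h2 : (√2 ^ n) ^ 4 = (4:ℝ) ^ n := by
    rw [← pow_mul, mul_comm n 4, pow_mul]
    congr 1
    rw [show √2 ^ 4 = (√2 ^ 2) ^ 2 by ring, Real.sq_sqrt (by norm_num)]; norm_num
  have hu : (√2 ^ n * l) ^ 4 = 4 ^ n * v := by rw [mul_pow, hlv, h2]
  set y := √2 ^ n * l with hy
  have hy0 : 0 ≤ y := by positivity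
  have hv0 : 0 ≤ v := by rw [← hlv]; positivity
  have he : multiplierError d n ξ =
      cosSum d (4 ^ n) ξ / (latticeBall d (4 ^ n)).card - geomAvg n (1 - sinMean d ξ) -
      (cosSum d (4 ^ n) fun _ => 1 / 2) / (latticeBall d (4 ^ n)).card *
        geomAvg n (sinMean d ξ) := by
    unfold multiplierError
    rw [if_pos hn]
  have hω : |(cosSum d (4 ^ n) fun _ => 1 / 2) / (latticeBall d (4 ^ n)).card| ≤ 1 :=
    abs_div_card_le (by rw [one_mul]; exact abs_cosSum_le _ _ _)
  have a1 : |cosSum d (4 ^ n) ξ / (latticeBall d (4 ^ n)).card - 1| ≤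
      2 * (4 ^ n * sinMean d ξ) := by
    have := abs_div_card_le (d := d) (R := 4 ^ n) (A := cosSum d (4 ^ n) ξ -
      (latticeBall d (4 ^ n)).card) (c := 2 * (4 ^ n * sinMean d ξ))
      (by have := abs_cosSum_sub_card_le (R := 4 ^ n) hd ξ
          push_cast at this; linarith)
    rwa [sub_div, div_self hV.ne'] at this
  have a1' : |cosSum d (4 ^ n) ξ / (latticeBall d (4 ^ n)).card -
      (cosSum d (4 ^ n) fun _ => 1 / 2) / (latticeBall d (4 ^ n)).card| ≤
      2 * (4 ^ n * (1 - sinMean d ξ)) := by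
    have := abs_div_card_le (d := d) (R := 4 ^ n) (A := cosSum d (4 ^ n) ξ -
      (cosSum d (4 ^ n) fun _ => 1 / 2)) (c := 2 * (4 ^ n * (1 - sinMean d ξ)))
      (by have := abs_cosSum_sub_half_le (R := 4 ^ n) hd ξ
          push_cast at this; linarith)
    rwa [sub_div] at this
  have b1 := one_sub_geomAvg_le n (sub_nonneg.2 hs1) (by linarith : 1 - sinMean d ξ ≤ 1)
  have b2 := geomAvg_le_one n (sub_nonneg.2 hs1) (by linarith : 1 - sinMean d ξ ≤ 1)
  have b3 := geomAvg_nonneg n (sub_nonneg.2 hs1)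
  have b4 := geomAvg_mul_le_one n (sub_nonneg.2 hs1)
  rw [_root_.sub_sub_cancel] at b1 b4
  have c1 := one_sub_geomAvg_le n hs0 hs1
  have c2 := geomAvg_le_one n hs0 hs1
  have c3 := geomAvg_nonneg n hs0
  have c4 := geomAvg_mul_le_one n hs0
  rw [he]
  set m := cosSum d (4 ^ n) ξ / (latticeBall d (4 ^ n)).card
  set ω := (cosSum d (4 ^ n) fun _ => 1 / 2) / (latticeBall d (4 ^ n)).card
  set A := geomAvg n (1 - sinMean d ξ)
  set A' := geomAvg n (sinMean d ξ)
  have hωA : |ω * A'| ≤ A' := by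
    rw [abs_mul, abs_of_nonneg c3]; exact mul_le_of_le_one_left c3 hω
  have hωA' : |ω * (1 - A')| ≤ 1 - A' := by
    rw [abs_mul, abs_of_nonneg (sub_nonneg.2 c2)]
    exact mul_le_of_le_one_left (sub_nonneg.2 c2) hω
  have hmul : ∀ {B w : ℝ}, 0 ≤ B → 1 / 2 ≤ w → B * (4 ^ n * w) ≤ 1 → B ≤ 2 * (1 / 4 ^ n) := by
    intro B w hB hw h
    rw [mul_one_div, le_div_iff₀ hR]
    nlinarith [mul_nonneg hB hR.le]
  refine sq_le_of_two_sided hy0 (by positivity) ?_ ?_ ?_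
  · rw [div_le_one hR]; exact hR1
  · rw [hu]
    obtain ⟨hv | hv, hv2⟩ := hv
    · have := hmul c3 (by linarith) c4
      rw [hv]
      rw [abs_le] at *
      constructor <;> linarith
    · have := hmul b3 (by linarith) b4
      rw [hv]
      have e : m - A - ω * A' = (m - ω) + ω * (1 - A') - A := by ring
      rw [e]
      rw [abs_le] at *
      constructor <;> linarith
  · intro hy1
    have hm : |m| ≤ 160 * (1 / y ^ 2 + 1 / 4 ^ n) := by
      rcases Nat.eq_zero_or_pos n with rfl | hn0
      · have : |m| ≤ 1 := abs_div_card_le (by rw [one_mul]; exact abs_cosSum_le _ _ _)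
        have h : 0 ≤ 1 / y ^ 2 := by positivity
        rw [pow_zero]
        linarith
      · have h4 : 4 ≤ 4 ^ n := le_self_pow₀ (by norm_num) hn0.ne'
        have := abs_cosSum_le_small h4 hn.le ξ (v := v) (t := y ^ 2)
          (by rcases hv.1 with h | h <;> linarith) (by rcases hv.1 with h | h <;> linarith)
          (by positivity) (by rw [← pow_mul, hu]; push_cast; rfl)
        push_cast at this
        exact abs_div_card_le this
    have hy2 : ∀ {B : ℝ}, 0 ≤ B → B * (4 ^ n * v) ≤ 1 → B ≤ 1 / y ^ 2 := by
      intro B hB h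
      rw [← hu] at h
      rw [le_div_iff₀ (by positivity)]
      refine le_trans (mul_le_mul_of_nonneg_left ?_ hB) h
      exact pow_le_pow_right₀ hy1 (by norm_num)
    have hAA : A + A' ≤ 1 / y ^ 2 + 2 * (1 / 4 ^ n) := by
      obtain ⟨hv | hv, hv2⟩ := hv
      · have := hmul c3 (by linarith) c4
        have := hy2 b3 (by rw [hv]; exact b4)
        linarith
      · have := hmul b3 (by linarith) b4
        have := hy2 c3 (by rw [hv]; exact c4)
        linarith
    have h0 : 0 ≤ 1 / y ^ 2 := by positivity
    rw [abs_le] at *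
    constructor <;> linarith

theorem sum_multiplierError_sq_le {d : ℕ} (hd : 1 ≤ d) (ξ : Fin d → ℝ)
    (hξ : ∀ j, |ξ j| ≤ 1 / 2) (N : ℕ) :
    ∑ n ∈ Finset.range N, multiplierError d n ξ ^ 2 ≤ 5000000 := by
  have hs0 := sinMean_nonneg d ξ
  have hs1 := sinMean_le_one hd ξ
  obtain ⟨v, hv⟩ : ∃ v, (v = sinMean d ξ ∨ v = 1 - sinMean d ξ) ∧ v ≤ 1 / 2 := by
    rcases le_total (sinMean d ξ) (1 / 2) with h | h
    · exact ⟨_, Or.inl rfl, h⟩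
    · exact ⟨_, Or.inr rfl, by linarith⟩
  have hv0 : 0 ≤ v := by rcases hv.1 with h | h <;> rw [h] <;> linarith
  have hroot : ∀ x : ℝ, 0 ≤ x → (√(√x)) ^ 4 = x := fun x hx => by
    rw [show √(√x) ^ 4 = (√(√x) ^ 2) ^ 2 by ring, Real.sq_sqrt (Real.sqrt_nonneg _),
      Real.sq_sqrt hx]
  set l := √(√(sinMean d ξ)) with hl
  set k := √(√v) with hk
  have hl0 : 0 ≤ l := Real.sqrt_nonneg _
  have hk0 : 0 ≤ k := Real.sqrt_nonneg _
  have hmin : ∀ y : ℝ, 0 ≤ y → 0 ≤ min y (1 / y) := fun y hy => le_min hy (by positivity)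
  have key : ∀ n, multiplierError d n ξ ^ 2 ≤ 130000 * (min (√2 ^ n * l) (1 / (√2 ^ n * l)) +
      min (√2 ^ n * k) (1 / (√2 ^ n * k)) + (1 / 4) ^ n +
      2 * min (2 ^ n * (1 / √d)) (1 / (2 ^ n * (1 / √d)))) := by
    intro n
    have h1 := hmin (√2 ^ n * l) (by positivity)
    have h2 := hmin (√2 ^ n * k) (by positivity)
    have h3 := hmin (2 ^ n * (1 / √d)) (by positivity)
    have h4 : (0:ℝ) ≤ (1 / 4) ^ n := by positivity
    rcases lt_or_ge (2 * 4 ^ n) d with h | h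
    · have := multiplierError_sq_le_small h ξ hv hk0 (hroot v hv0)
      rw [← one_div_pow] at this
      linarith
    · have := multiplierError_sq_le_large hd h ξ hξ hl0 (hroot _ hs0)
      linarith
  refine (Finset.sum_le_sum fun n _ => key n).trans ?_
  rw [← Finset.mul_sum, Finset.sum_add_distrib, Finset.sum_add_distrib, Finset.sum_add_distrib,
    ← Finset.mul_sum]
  have g1 := sum_min_sqrt_two_le hl0 N
  have g2 := sum_min_sqrt_two_le hk0 N
  have g3 := sum_min_two_le (show 0 ≤ 1 / √(d:ℝ) by positivity) N
  have g4 : ∑ n ∈ Finset.range N, (1 / 4 : ℝ) ^ n ≤ 2 := by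
    refine (Finset.sum_le_sum fun n _ => pow_le_pow_left₀ (by norm_num)
      (by norm_num : (1/4:ℝ) ≤ 1/2) n).trans (sum_geometric_two_le N)
  linarith

/-- The real group algebra of `ℤ^d`: finitely supported functions with convolution. -/
abbrev LatticeAlg (d : ℕ) := AddMonoidAlgebra ℝ (Fin d → ℤ)

namespace LatticeAlg

variable {d : ℕ}

/-- The reflection `x ↦ -x` on the group algebra. -/
noncomputable def reflect : LatticeAlg d →ₐ[ℝ] LatticeAlg d :=
  AddMonoidAlgebra.mapDomainAlgHom ℝ ℝ (negAddMonoidHom : (Fin d → ℤ) →+ (Fin d → ℤ))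

theorem reflect_single (x : Fin d → ℤ) (a : ℝ) :
    reflect (AddMonoidAlgebra.single x a) = AddMonoidAlgebra.single (-x) a := by
  simp [reflect, AddMonoidAlgebra.mapDomainAlgHom]

theorem reflect_reflect (f : LatticeAlg d) : reflect (reflect f) = f := by
  induction f using AddMonoidAlgebra.induction_linear with
  | zero => simp
  | add f g hf hg => rw [map_add, map_add, hf, hg]
  | single x a => rw [reflect_single, reflect_single, neg_neg]

theorem coeff_reflect_zero (f : LatticeAlg d) : (reflect f).coeff 0 = f.coeff 0 := by
  induction f using AddMonoidAlgebra.induction_linear with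
  | zero => simp
  | add f g hf hg => simp [hf, hg]
  | single x a => rw [reflect_single]; simp [Finsupp.single_apply]

/-- The `ℓ²` pairing. -/
noncomputable def pairing (f g : LatticeAlg d) : ℝ := (f * reflect g).coeff 0

theorem pairing_add_left (f g h : LatticeAlg d) : pairing (f + g) h = pairing f h + pairing g h := by
  simp [pairing, add_mul]

theorem pairing_sum_right {ι : Type*} (s : Finset ι) (f : LatticeAlg d) (g : ι → LatticeAlg d) :
    pairing f (∑ i ∈ s, g i) = ∑ i ∈ s, pairing f (g i) := by
  simp [pairing, Finset.mul_sum, Finsupp.finsetSum_apply]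

theorem pairing_sum_left {ι : Type*} (s : Finset ι) (f : ι → LatticeAlg d) (g : LatticeAlg d) :
    pairing (∑ i ∈ s, f i) g = ∑ i ∈ s, pairing (f i) g := by
  simp [pairing, Finset.sum_mul, Finsupp.finsetSum_apply]

theorem pairing_single_right (f : LatticeAlg d) (x : Fin d → ℤ) (a : ℝ) :
    pairing f (AddMonoidAlgebra.single x a) = f.coeff x * a := by
  rw [pairing, reflect_single]
  exact AddMonoidAlgebra.coeff_mul_single_eq_coeff_mul x fun m _ => by
    rw [add_neg_eq_zero]

theorem pairing_comm (f g : LatticeAlg d) : pairing f g = pairing g f := by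
  unfold pairing
  rw [← coeff_reflect_zero, map_mul, reflect_reflect, mul_comm]

theorem pairing_mul_left {A : LatticeAlg d} (hA : reflect A = A) (f g : LatticeAlg d) :
    pairing (A * f) g = pairing f (A * g) := by
  unfold pairing
  rw [map_mul, hA]; congr 2; ring

theorem pairing_eq_sum (f g : LatticeAlg d) {X : Finset (Fin d → ℤ)} (hX : g.coeff.support ⊆ X) :
    pairing f g = ∑ x ∈ X, f.coeff x * g.coeff x := by
  have h : g = ∑ x ∈ X, AddMonoidAlgebra.single x (g.coeff x) := by
    rw [← AddMonoidAlgebra.coeff_inj]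
    ext y
    simp only [AddMonoidAlgebra.coeff_sum, AddMonoidAlgebra.coeff_single, Finsupp.finsetSum_apply,
      Finsupp.single_apply, Finset.sum_ite_eq']
    split_ifs with hy
    · rfl
    · exact Finsupp.notMem_support_iff.1 fun h => hy (hX h)
  conv_lhs => rw [h]
  rw [pairing_sum_right]
  exact Finset.sum_congr rfl fun x _ => pairing_single_right _ _ _

theorem sum_sq_le_pairing_self (f : LatticeAlg d) (X : Finset (Fin d → ℤ)) :
    ∑ x ∈ X, f.coeff x ^ 2 ≤ pairing f f := by
  classical
  rw [pairing_eq_sum f f (X := X ∪ f.coeff.support) Finset.subset_union_right]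
  simp_rw [← sq]
  exact Finset.sum_le_sum_of_subset_of_nonneg Finset.subset_union_left fun _ _ _ => sq_nonneg _

theorem pairing_self_nonneg (f : LatticeAlg d) : 0 ≤ pairing f f := by
  simpa using sum_sq_le_pairing_self f ∅

theorem pairing_sq_le (f g : LatticeAlg d) : pairing f g ^ 2 ≤ pairing f f * pairing g g := by
  classical
  rw [pairing_eq_sum f g (X := f.coeff.support ∪ g.coeff.support) Finset.subset_union_right,
    pairing_eq_sum f f (X := f.coeff.support ∪ g.coeff.support) Finset.subset_union_left,
    pairing_eq_sum g g (X := f.coeff.support ∪ g.coeff.support) Finset.subset_union_right]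
  simp_rw [← sq]
  exact Finset.sum_mul_sq_le_sq_mul_sq _ _ _

/-- Elements with nonnegative coefficients. -/
def Nonneg (f : LatticeAlg d) : Prop := ∀ x, 0 ≤ f.coeff x

theorem Nonneg.add {f g : LatticeAlg d} (hf : Nonneg f) (hg : Nonneg g) : Nonneg (f + g) :=
  fun x => by simpa using add_nonneg (hf x) (hg x)

theorem Nonneg.smul {f : LatticeAlg d} (hf : Nonneg f) {c : ℝ} (hc : 0 ≤ c) : Nonneg (c • f) :=
  fun x => by simpa using mul_nonneg hc (hf x)

theorem Nonneg.sum {ι : Type*} {s : Finset ι} {f : ι → LatticeAlg d}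
    (hf : ∀ i ∈ s, Nonneg (f i)) : Nonneg (∑ i ∈ s, f i) := fun x => by
  simpa [Finsupp.finsetSum_apply] using Finset.sum_nonneg fun i hi => hf i hi x

theorem nonneg_single (x : Fin d → ℤ) {a : ℝ} (ha : 0 ≤ a) :
    Nonneg (AddMonoidAlgebra.single x a) := fun y => by
  rw [AddMonoidAlgebra.coeff_single, Finsupp.single_apply]; split_ifs <;> simp [ha]

theorem nonneg_zero : Nonneg (0 : LatticeAlg d) := fun x => by simp

theorem nonneg_one : Nonneg (1 : LatticeAlg d) := nonneg_single 0 zero_le_one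

theorem Nonneg.mul {f g : LatticeAlg d} (hf : Nonneg f) (hg : Nonneg g) : Nonneg (f * g) := by
  classical
  intro x
  rw [AddMonoidAlgebra.coeff_mul]
  refine Finset.sum_nonneg fun y _ => Finset.sum_nonneg fun z _ => ?_
  dsimp only
  split_ifs
  · exact mul_nonneg (hf y) (hg z)
  · exact le_rfl

theorem Nonneg.pow {f : LatticeAlg d} (hf : Nonneg f) (n : ℕ) : Nonneg (f ^ n) := by
  induction n with
  | zero => simpa using nonneg_one
  | succ n ih => rw [pow_succ]; exact ih.mul hf

theorem Nonneg.reflect {f : LatticeAlg d} (hf : Nonneg f) : Nonneg (reflect f) := by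
  have : f = ∑ x ∈ f.coeff.support, AddMonoidAlgebra.single x (f.coeff x) :=
    (AddMonoidAlgebra.sum_coeff_single f).symm
  rw [this, map_sum]
  refine Nonneg.sum fun x _ => ?_
  rw [reflect_single]
  exact nonneg_single _ (hf x)

theorem pairing_nonneg {f g : LatticeAlg d} (hf : Nonneg f) (hg : Nonneg g) : 0 ≤ pairing f g :=
  (hf.mul hg.reflect) 0

theorem pairing_mono_left {f f' g : LatticeAlg d} (hf : Nonneg (f' - f)) (hg : Nonneg g) :
    pairing f g ≤ pairing f' g := by
  have := pairing_nonneg hf hg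
  have h : pairing f' g = pairing f g + pairing (f' - f) g := by
    rw [← pairing_add_left]; congr 1; abel
  linarith

/-- `f` is bounded coefficientwise in absolute value by `F`. -/
def Dominated (f F : LatticeAlg d) : Prop := Nonneg (F - f) ∧ Nonneg (F + f)

theorem Dominated.abs_le {f F : LatticeAlg d} (h : Dominated f F) (x : Fin d → ℤ) :
    |f.coeff x| ≤ F.coeff x := by
  have h1 := h.1 x
  have h2 := h.2 x
  simp only [AddMonoidAlgebra.coeff_sub, AddMonoidAlgebra.coeff_add, Finsupp.sub_apply,
    Finsupp.add_apply] at h1 h2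
  exact _root_.abs_le.2 ⟨by linarith, by linarith⟩

theorem Nonneg.dominated {f : LatticeAlg d} (h : Nonneg f) : Dominated f f :=
  ⟨by simpa using nonneg_zero, h.add h⟩

theorem Dominated.mul {f F g G : LatticeAlg d} (hf : Dominated f F) (hg : Dominated g G) :
    Dominated (f * g) (F * G) := by
  constructor
  · have h : F * G - f * g = (1 / 2 : ℝ) • ((F - f) * (G + g) + (F + f) * (G - g)) := by
      have : (F - f) * (G + g) + (F + f) * (G - g) = (2:ℝ) • (F * G - f * g) := by
        rw [two_smul]; ring
      rw [this, smul_smul]; norm_num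
    rw [h]
    exact ((hf.1.mul hg.2).add (hf.2.mul hg.1)).smul (by norm_num)
  · have h : F * G + f * g = (1 / 2 : ℝ) • ((F - f) * (G - g) + (F + f) * (G + g)) := by
      have : (F - f) * (G - g) + (F + f) * (G + g) = (2:ℝ) • (F * G + f * g) := by
        rw [two_smul]; ring
      rw [this, smul_smul]; norm_num
    rw [h]
    exact ((hf.1.mul hg.1).add (hf.2.mul hg.2)).smul (by norm_num)

theorem Dominated.sum {ι : Type*} {s : Finset ι} {f F : ι → LatticeAlg d}
    (h : ∀ i ∈ s, Dominated (f i) (F i)) : Dominated (∑ i ∈ s, f i) (∑ i ∈ s, F i) :=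
  ⟨by rw [← Finset.sum_sub_distrib]; exact Nonneg.sum fun i hi => (h i hi).1,
    by rw [← Finset.sum_add_distrib]; exact Nonneg.sum fun i hi => (h i hi).2⟩

theorem Dominated.smul {f F : LatticeAlg d} (h : Dominated f F) {c : ℝ} (hc : 0 ≤ c) :
    Dominated (c • f) (c • F) :=
  ⟨by rw [← smul_sub]; exact h.1.smul hc, by rw [← smul_add]; exact h.2.smul hc⟩

theorem Dominated.pow {f F : LatticeAlg d} (h : Dominated f F) (n : ℕ) :
    Dominated (f ^ n) (F ^ n) := by
  induction n with
  | zero => simpa using nonneg_one.dominated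
  | succ n ih => rw [pow_succ, pow_succ]; exact ih.mul h

/-- The average of the powers `S ^ i` over `i < 4 ^ n`. -/
noncomputable def powAvg (n : ℕ) (S : LatticeAlg d) : LatticeAlg d :=
  (1 / 4 ^ n : ℝ) • ∑ i ∈ Finset.range (4 ^ n), S ^ i

theorem powAvg_nonneg {S : LatticeAlg d} (hS : Nonneg S) (n : ℕ) : Nonneg (powAvg n S) :=
  (Nonneg.sum fun i _ => hS.pow i).smul (by positivity)

theorem reflect_powAvg {S : LatticeAlg d} (hS : reflect S = S) (n : ℕ) :
    reflect (powAvg n S) = powAvg n S := by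
  simp [powAvg, hS]

theorem Dominated.powAvg {f F : LatticeAlg d} (h : Dominated f F) (n : ℕ) :
    Dominated (powAvg n f) (powAvg n F) :=
  (Dominated.sum fun i _ => h.pow i).smul (by positivity)

theorem nonneg_powAvg_succ_sub_mul {S : LatticeAlg d} (hS : Nonneg S) {m n : ℕ} (hmn : m ≤ n) :
    Nonneg ((4:ℝ) • powAvg (n + 1) S - powAvg m S * powAvg n S) := by
  have h4 : (4:ℝ) • powAvg (n + 1) S = (1 / 4 ^ n : ℝ) • ∑ k ∈ Finset.range (4 ^ (n + 1)), S ^ k := by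
    rw [powAvg, smul_smul]
    congr 1
    rw [pow_succ]; field_simp
  have h1 : ∀ i ∈ Finset.range (4 ^ m), Nonneg ((4:ℝ) • powAvg (n + 1) S - S ^ i * powAvg n S) := by
    intro i hi
    have hi' : i < 4 ^ n := (Finset.mem_range.1 hi).trans_le (Nat.pow_le_pow_right (by norm_num) hmn)
    rw [h4, powAvg, mul_smul_comm, ← smul_sub]
    refine Nonneg.smul ?_ (by positivity)
    have h2 : S ^ i * ∑ j ∈ Finset.range (4 ^ n), S ^ j = ∑ k ∈ Finset.Ico i (i + 4 ^ n), S ^ k := by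
      rw [Finset.sum_Ico_eq_sum_range, Finset.mul_sum]
      simp [pow_add]
    have hsub : Finset.Ico i (i + 4 ^ n) ⊆ Finset.range (4 ^ (n + 1)) := by
      intro k hk
      rw [Finset.mem_Ico] at hk
      rw [Finset.mem_range, pow_succ]
      omega
    rw [h2, ← Finset.sum_sdiff hsub, add_sub_cancel_right]
    exact Nonneg.sum fun k _ => hS.pow k
  have h3 : (4:ℝ) • powAvg (n + 1) S - powAvg m S * powAvg n S = (1 / 4 ^ m : ℝ) •
      ∑ i ∈ Finset.range (4 ^ m), ((4:ℝ) • powAvg (n + 1) S - S ^ i * powAvg n S) := by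
    rw [Finset.sum_sub_distrib, Finset.sum_const, Finset.card_range, smul_sub, ← Finset.sum_mul,
      ← smul_mul_assoc, ← powAvg, ← Nat.cast_smul_eq_nsmul ℝ, smul_smul]
    congr 1
    push_cast
    rw [one_div, inv_mul_cancel₀ (by positivity), one_smul]
  rw [h3]
  exact (Nonneg.sum h1).smul (by positivity)

/-- The character of `ℤ^d` with frequency `ξ`. -/
noncomputable def latticeChar (ξ : Fin d → ℝ) : Multiplicative (Fin d → ℤ) →* ℂ where
  toFun x := ∏ j, Complex.exp (2 * Real.pi * Complex.I * (x.toAdd j * ξ j))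
  map_one' := by simp
  map_mul' x y := by
    rw [← Finset.prod_mul_distrib]
    refine Finset.prod_congr rfl fun j _ => ?_
    rw [← Complex.exp_add]
    congr 1
    simp only [toAdd_mul, Pi.add_apply, Int.cast_add]
    ring

/-- The Fourier transform at frequency `ξ`. -/
noncomputable def fourier (ξ : Fin d → ℝ) : LatticeAlg d →ₐ[ℝ] ℂ :=
  AddMonoidAlgebra.lift ℝ ℂ (Fin d → ℤ) (latticeChar ξ)

theorem fourier_single (ξ : Fin d → ℝ) (x : Fin d → ℤ) (a : ℝ) :
    fourier ξ (AddMonoidAlgebra.single x a) =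
      a * ∏ j, Complex.exp (2 * Real.pi * Complex.I * (x j * ξ j)) := by
  rw [fourier, AddMonoidAlgebra.lift_single, Complex.real_smul]
  rfl

theorem fourier_reflect (ξ : Fin d → ℝ) (f : LatticeAlg d) :
    fourier ξ (reflect f) = starRingEnd ℂ (fourier ξ f) := by
  induction f using AddMonoidAlgebra.induction_linear with
  | zero => simp
  | add f g hf hg => simp only [map_add, hf, hg]
  | single x a =>
    rw [reflect_single, fourier_single, fourier_single, map_mul, map_prod, Complex.conj_ofReal]
    congr 1
    refine Finset.prod_congr rfl fun j _ => ?_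
    rw [← Complex.exp_conj]
    congr 1
    simp only [map_mul, Complex.conj_ofReal, Complex.conj_I, map_ofNat, map_intCast]
    simp only [Pi.neg_apply]
    push_cast
    ring

theorem continuous_fourier (f : LatticeAlg d) : Continuous fun ξ => fourier ξ f := by
  induction f using AddMonoidAlgebra.induction_linear with
  | zero => simpa using continuous_const
  | add f g hf hg => simp only [map_add]; exact hf.add hg
  | single x a => simp only [fourier_single]; fun_prop

/-- The unit cube of frequencies. -/
def freqCube (d : ℕ) : Set (Fin d → ℝ) := Set.Icc (fun _ => -(1 / 2)) (fun _ => 1 / 2)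

theorem integrableOn_freqCube {E : Type*} [NormedAddCommGroup E]
    {F : (Fin d → ℝ) → E} (hF : Continuous F) : IntegrableOn F (freqCube d) :=
  hF.continuousOn.integrableOn_compact isCompact_Icc

theorem integral_exp_int (n : ℤ) :
    ∫ t in Set.Icc (-(1 / 2) : ℝ) (1 / 2), Complex.exp (2 * Real.pi * Complex.I * (n * t)) =
      if n = 0 then 1 else 0 := by
  rw [integral_Icc_eq_integral_Ioc, ← intervalIntegral.integral_of_le (by norm_num)]
  split_ifs with h
  · subst h; norm_num
  · have hc : 2 * Real.pi * Complex.I * n ≠ 0 := by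
      simp [h, Real.pi_ne_zero]
    have := integral_exp_mul_complex (a := (-(1 / 2) : ℝ)) (b := (1 / 2 : ℝ)) hc
    simp_rw [mul_assoc (2 * (Real.pi:ℂ) * Complex.I)] at this
    rw [this]
    have e : Complex.exp (2 * Real.pi * Complex.I * (n * ((1 / 2 : ℝ) : ℂ))) =
        Complex.exp (2 * Real.pi * Complex.I * (n * ((-(1 / 2) : ℝ) : ℂ))) := by
      rw [Complex.exp_eq_exp_iff_exists_int]
      refine ⟨n, ?_⟩
      push_cast; ring
    rw [e, sub_self, zero_div]

theorem integral_fourier (f : LatticeAlg d) :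
    ∫ ξ in freqCube d, fourier ξ f = (f.coeff 0 : ℂ) := by
  induction f using AddMonoidAlgebra.induction_linear with
  | zero => simp
  | add f g hf hg =>
    simp only [map_add]
    rw [integral_add (integrableOn_freqCube (continuous_fourier f))
      (integrableOn_freqCube (continuous_fourier g)), hf, hg]
    simp
  | single x a =>
    simp only [fourier_single]
    rw [integral_const_mul, freqCube, ← Set.pi_univ_Icc, volume_pi, Measure.restrict_pi_pi,
      integral_fintype_prod_eq_prod (𝕜 := ℂ)
        (f := fun j (t : ℝ) => Complex.exp (2 * Real.pi * Complex.I * (x j * t)))]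
    simp_rw [integral_exp_int]
    by_cases h : x = 0
    · subst h; simp
    · obtain ⟨j, hj⟩ := Function.ne_iff.1 h
      rw [Finset.prod_eq_zero (Finset.mem_univ j) (by simpa using hj)]
      simp [h]

theorem integral_norm_fourier_sq (f : LatticeAlg d) :
    ∫ ξ in freqCube d, ‖fourier ξ f‖ ^ 2 = pairing f f := by
  have h := integral_fourier (f * reflect f)
  have h2 : ∀ ξ, fourier ξ (f * reflect f) = ((‖fourier ξ f‖ ^ 2 : ℝ) : ℂ) := by
    intro ξ
    rw [map_mul, fourier_reflect, Complex.mul_conj, Complex.normSq_eq_norm_sq]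
  simp_rw [h2] at h
  rw [integral_complex_ofReal] at h
  exact_mod_cast h

theorem sum_pairing_mul_le {ι : Type*} (s : Finset ι) (E : ι → LatticeAlg d) {C : ℝ}
    (hE : ∀ ξ ∈ freqCube d, ∑ i ∈ s, ‖fourier ξ (E i)‖ ^ 2 ≤ C) (f : LatticeAlg d) :
    ∑ i ∈ s, pairing (E i * f) (E i * f) ≤ C * pairing f f := by
  have hint : ∀ g : LatticeAlg d, IntegrableOn (fun ξ => ‖fourier ξ g‖ ^ 2) (freqCube d) :=
    fun g => integrableOn_freqCube ((continuous_fourier g).norm.pow 2)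
  simp_rw [← integral_norm_fourier_sq]
  rw [← integral_finsetSum _ fun i _ => hint _, ← integral_const_mul]
  refine setIntegral_mono_on (integrable_finsetSum _ fun i _ => hint _)
    ((hint f).const_mul C) measurableSet_Icc fun ξ hξ => ?_
  simp_rw [map_mul, norm_mul, mul_pow]
  rw [← Finset.sum_mul]
  exact mul_le_mul_of_nonneg_right (hE ξ hξ) (by positivity)

/-- The lazy nearest-neighbour step, with multiplier `1 - sinMean`. -/
noncomputable def lazyStep (d : ℕ) : LatticeAlg d :=
  (1 / 2 : ℝ) • 1 + ∑ j, (AddMonoidAlgebra.single (Pi.single j 1) (1 / (4 * d) : ℝ) +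
    AddMonoidAlgebra.single (-Pi.single j 1) (1 / (4 * d) : ℝ))

theorem fourier_lazyStep (hd : 1 ≤ d) (ξ : Fin d → ℝ) :
    fourier ξ (lazyStep d) = ((1 - sinMean d ξ : ℝ) : ℂ) := by
  have hd0 : (d:ℝ) ≠ 0 := by exact_mod_cast (by omega : d ≠ 0)
  have h1 : ∀ (j : Fin d) (k : ℤ),
      ∏ i, Complex.exp (2 * Real.pi * Complex.I * ((Pi.single j k : Fin d → ℤ) i * ξ i)) =
      Complex.exp (2 * Real.pi * Complex.I * (k * ξ j)) := by
    intro j k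
    rw [Finset.prod_eq_single j]
    · simp
    · intro i _ hi; simp [hi]
    · simp
  have h2 : ∀ j : Fin d, fourier ξ (AddMonoidAlgebra.single (Pi.single j 1) (1 / (4 * d) : ℝ) +
      AddMonoidAlgebra.single (-Pi.single j 1) (1 / (4 * d) : ℝ)) =
      ((1 / (2 * d) * (1 - 2 * Real.sin (Real.pi * ξ j) ^ 2) : ℝ) : ℂ) := by
    intro j
    rw [map_add, fourier_single, fourier_single, ← Pi.single_neg, h1, h1]
    have : Real.cos (2 * (Real.pi * ξ j)) = 1 - 2 * Real.sin (Real.pi * ξ j) ^ 2 := by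
      rw [Real.cos_two_mul, Real.sin_sq]; ring
    rw [← this]
    push_cast
    rw [Complex.cos]
    have hdc : (d:ℂ) ≠ 0 := by exact_mod_cast hd0
    have e1 : 2 * (Real.pi:ℂ) * Complex.I * (1 * ξ j) = 2 * (Real.pi * ξ j) * Complex.I := by ring
    have e2 : 2 * (Real.pi:ℂ) * Complex.I * (-1 * ξ j) = -(2 * (Real.pi * ξ j)) * Complex.I := by
      ring
    rw [e1, e2]
    field_simp
    ring
  rw [lazyStep, map_add, map_smul, map_one, map_sum]
  simp_rw [h2]
  rw [← Complex.ofReal_sum, ← Finset.mul_sum, Finset.sum_sub_distrib, ← Finset.mul_sum, sinMean]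
  simp only [Complex.real_smul, mul_one]
  rw [← Complex.ofReal_add]
  congr 1
  simp
  field_simp
  ring

theorem reflect_lazyStep : reflect (lazyStep d) = lazyStep d := by
  simp [lazyStep, reflect_single, add_comm]

theorem nonneg_lazyStep : Nonneg (lazyStep d) :=
  (nonneg_one.smul (by norm_num)).add (Nonneg.sum fun j _ =>
    (nonneg_single _ (by positivity)).add (nonneg_single _ (by positivity)))

theorem dominated_one_sub_lazyStep : Dominated (1 - lazyStep d) (lazyStep d) := by
  constructor
  · have : lazyStep d - (1 - lazyStep d) =
        (2:ℝ) • ∑ j : Fin d, (AddMonoidAlgebra.single (Pi.single j 1) (1 / (4 * d) : ℝ) +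
        AddMonoidAlgebra.single (-Pi.single j 1) (1 / (4 * d) : ℝ)) := by
      have h : (1 : LatticeAlg d) = (2:ℝ) • ((1 / 2 : ℝ) • (1 : LatticeAlg d)) := by
        rw [smul_smul]; norm_num
      have h2 : lazyStep d - (1 - lazyStep d) = (2:ℝ) • lazyStep d - 1 := by
        rw [two_smul]; abel
      rw [h2]
      calc (2:ℝ) • lazyStep d - 1 = (2:ℝ) • lazyStep d - (2:ℝ) • ((1 / 2 : ℝ) • 1) := by rw [← h]
        _ = _ := by rw [← smul_sub, lazyStep, add_sub_cancel_left]
    rw [this]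
    exact (Nonneg.sum fun j _ =>
      (nonneg_single _ (by positivity)).add (nonneg_single _ (by positivity))).smul (by norm_num)
  · rw [add_sub_cancel]; exact nonneg_one

theorem fourier_powAvg (ξ : Fin d → ℝ) (n : ℕ) {S : LatticeAlg d} {r : ℝ}
    (h : fourier ξ S = (r : ℂ)) : fourier ξ (powAvg n S) = ((geomAvg n r : ℝ) : ℂ) := by
  rw [powAvg, map_smul, map_sum, geomAvg, Complex.real_smul]
  simp_rw [map_pow, h]
  push_cast
  ring

/-- The ball average as an element of the group algebra. -/
noncomputable def ballElt (d R : ℕ) : LatticeAlg d :=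
  ∑ y ∈ latticeBall d R, AddMonoidAlgebra.single y (1 / (latticeBall d R).card : ℝ)

theorem fourier_ballElt (ξ : Fin d → ℝ) (R : ℕ) :
    fourier ξ (ballElt d R) = ((cosSum d R ξ / (latticeBall d R).card : ℝ) : ℂ) := by
  rw [ballElt, map_sum]
  simp_rw [fourier_single]
  rw [← Finset.mul_sum, sum_prod_exp_eq_cosSum]
  push_cast; ring

/-- The difference of the ball average and its semigroup model. -/
noncomputable def errorElt (d n : ℕ) : LatticeAlg d :=
  ballElt d (4 ^ n) - powAvg n (lazyStep d) -
    (if 2 * 4 ^ n < d then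
      (cosSum d (4 ^ n) fun _ => 1 / 2) / (latticeBall d (4 ^ n)).card else (0:ℝ)) •
      powAvg n (1 - lazyStep d)

theorem fourier_errorElt (hd : 1 ≤ d) (ξ : Fin d → ℝ) (n : ℕ) :
    fourier ξ (errorElt d n) = (multiplierError d n ξ : ℂ) := by
  have h1 := fourier_lazyStep hd ξ
  have h2 : fourier ξ (1 - lazyStep d) = ((sinMean d ξ : ℝ) : ℂ) := by
    rw [map_sub, map_one, h1]; push_cast; ring
  rw [errorElt, map_sub, map_sub, map_smul, fourier_ballElt, fourier_powAvg ξ n h1,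
    fourier_powAvg ξ n h2, multiplierError, Complex.real_smul]
  split_ifs <;> push_cast <;> ring

theorem sum_pairing_errorElt_le (hd : 1 ≤ d) (f : LatticeAlg d) (N : ℕ) :
    ∑ n ∈ Finset.range N, pairing (errorElt d n * f) (errorElt d n * f) ≤
      5000000 * pairing f f := by
  refine sum_pairing_mul_le _ _ (fun ξ hξ => ?_) f
  simp_rw [fourier_errorElt hd, Complex.norm_real, Real.norm_eq_abs, sq_abs]
  exact sum_multiplierError_sq_le hd ξ (fun j => abs_le.2 ⟨hξ.1 j, hξ.2 j⟩) N

theorem pairing_powAvg_lazyStep_le (hd : 1 ≤ d) (f : LatticeAlg d) (n : ℕ) :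
    pairing (powAvg n (lazyStep d) * f) (powAvg n (lazyStep d) * f) ≤ pairing f f := by
  have := sum_pairing_mul_le (Finset.range 1) (fun _ => powAvg n (lazyStep d)) (C := 1)
    (fun ξ _ => by
      have h1 := sinMean_le_one hd ξ
      have h0 := sinMean_nonneg d ξ
      rw [Finset.sum_range_one, fourier_powAvg ξ n (fourier_lazyStep hd ξ), Complex.norm_real,
        Real.norm_eq_abs, sq_abs]
      exact pow_le_one₀ (geomAvg_nonneg n (by linarith)) (geomAvg_le_one n (by linarith)
        (by linarith))) f
  simpa using this

/-- The `ℓ²` bound with constant `K` for the maximal function of `A n`, `n < n₀`, stated through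
linearizations and for nonnegative elements. -/
def MaximalBound (A : ℕ → LatticeAlg d) (n₀ : ℕ) (K : ℝ) : Prop :=
  ∀ (X : Finset (Fin d → ℤ)) (n : (Fin d → ℤ) → ℕ), (∀ x ∈ X, n x < n₀) →
    ∀ f : LatticeAlg d, Nonneg f → ∑ x ∈ X, (A (n x) * f).coeff x ^ 2 ≤ K * pairing f f

theorem sum_sq_coeff_le_sum_pairing (A : ℕ → LatticeAlg d) {n₀ : ℕ} {X : Finset (Fin d → ℤ)}
    {n : (Fin d → ℤ) → ℕ} (hn : ∀ x ∈ X, n x < n₀) (f : LatticeAlg d) :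
    ∑ x ∈ X, (A (n x) * f).coeff x ^ 2 ≤
      ∑ i ∈ Finset.range n₀, pairing (A i * f) (A i * f) := by
  calc ∑ x ∈ X, (A (n x) * f).coeff x ^ 2
      ≤ ∑ x ∈ X, ∑ i ∈ Finset.range n₀, (A i * f).coeff x ^ 2 :=
        Finset.sum_le_sum fun x hx => Finset.single_le_sum
          (f := fun i => (A i * f).coeff x ^ 2) (fun i _ => sq_nonneg _)
          (Finset.mem_range.2 (hn x hx))
    _ ≤ _ := by
        rw [Finset.sum_comm]
        exact Finset.sum_le_sum fun i _ => sum_sq_le_pairing_self _ _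

theorem coeff_sum_single {X : Finset (Fin d → ℤ)} (w : (Fin d → ℤ) → ℝ) {y : Fin d → ℤ}
    (hy : y ∈ X) : (∑ x ∈ X, (AddMonoidAlgebra.single x (w x) : LatticeAlg d)).coeff y = w y := by
  simp only [AddMonoidAlgebra.coeff_sum, AddMonoidAlgebra.coeff_single, Finsupp.finsetSum_apply,
    Finsupp.single_apply, Finset.sum_ite_eq', hy, if_true]

theorem MaximalBound.of_contraction {A : ℕ → LatticeAlg d}
    (hA : ∀ n f, pairing (A n * f) (A n * f) ≤ pairing f f) (n₀ : ℕ) :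
    MaximalBound A n₀ n₀ := fun X n hn f _ => by
  refine (sum_sq_coeff_le_sum_pairing A hn f).trans ?_
  refine (Finset.sum_le_sum fun i _ => hA i f).trans ?_
  simp

theorem MaximalBound.improve {A : ℕ → LatticeAlg d} (hA0 : ∀ n, Nonneg (A n))
    (hAr : ∀ n, reflect (A n) = A n)
    (hAc : ∀ n f, pairing (A n * f) (A n * f) ≤ pairing f f)
    (hAm : ∀ m n, m ≤ n → Nonneg ((4:ℝ) • A (n + 1) - A m * A n))
    {n₀ : ℕ} {K K' : ℝ} (hK : MaximalBound A n₀ K) (hK' : 0 ≤ K')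
    (hKK' : 64 * (K + 1) ≤ K' ^ 2) : MaximalBound A n₀ K' := by
  intro X n hn f hf
  set w : (Fin d → ℤ) → ℝ := fun x => (A (n x) * f).coeff x with hw
  set s : (Fin d → ℤ) → LatticeAlg d := fun x => AddMonoidAlgebra.single x (w x) with hs
  have hw0 : ∀ x, 0 ≤ w x := fun x => ((hA0 _).mul hf) x
  have hs0 : ∀ x, Nonneg (s x) := fun x => nonneg_single x (hw0 x)
  set g := ∑ x ∈ X, s x with hg
  have hg0 : Nonneg g := Nonneg.sum fun x _ => hs0 x
  set Q := ∑ x ∈ X, w x ^ 2 with hQ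
  have hQ0 : 0 ≤ Q := Finset.sum_nonneg fun x _ => sq_nonneg _
  have hgg : pairing g g = Q := by
    conv_lhs => rw [hg, pairing_sum_right]
    refine Finset.sum_congr rfl fun x hx => ?_
    rw [pairing_single_right, coeff_sum_single w hx, sq]
  set H := ∑ x ∈ X, A (n x) * s x with hH
  have hQH : Q = pairing f H := by
    rw [hH, pairing_sum_right]
    refine Finset.sum_congr rfl fun x hx => ?_
    rw [← pairing_mul_left (hAr _), pairing_single_right, sq]
  set R := ∑ y ∈ X, (A (n y + 1) * g).coeff y * w y with hR
  have hR' : R = ∑ y ∈ X, ∑ x ∈ X, pairing (A (n y + 1) * s x) (s y) := by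
    refine Finset.sum_congr rfl fun y _ => ?_
    rw [← pairing_single_right, hg, Finset.mul_sum, pairing_sum_left]
  have hAs : ∀ i x, Nonneg (A i * s x) := fun i x => (hA0 i).mul (hs0 x)
  have hterm : ∀ x y, pairing (A (n x) * s x) (A (n y) * s y) ≤
      4 * (pairing (A (n y + 1) * s x) (s y) + pairing (A (n x + 1) * s y) (s x)) := by
    have key : ∀ x y, n x ≤ n y → pairing (A (n x) * s x) (A (n y) * s y) ≤
        4 * pairing (A (n y + 1) * s x) (s y) := by
      intro x y hxy
      have h1 : pairing (A (n x) * s x) (A (n y) * s y) =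
          pairing (A (n x) * A (n y) * s x) (s y) := by
        rw [← pairing_mul_left (hAr (n y))]; congr 1; ring
      have h2 : 4 * pairing (A (n y + 1) * s x) (s y) =
          pairing ((4:ℝ) • A (n y + 1) * s x) (s y) := by
        simp [pairing]
      rw [h1, h2]
      refine pairing_mono_left ?_ (hs0 y)
      rw [← sub_mul]
      exact (hAm _ _ hxy).mul (hs0 x)
    intro x y
    have p1 := pairing_nonneg (hAs (n y + 1) x) (hs0 y)
    have p2 := pairing_nonneg (hAs (n x + 1) y) (hs0 x)
    rcases le_total (n x) (n y) with h | h
    · linarith [key x y h]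
    · rw [pairing_comm]; linarith [key y x h]
  have hHH : pairing H H ≤ 8 * R := by
    have h1 : pairing H H = ∑ x ∈ X, ∑ y ∈ X, pairing (A (n x) * s x) (A (n y) * s y) := by
      rw [hH, pairing_sum_left]
      exact Finset.sum_congr rfl fun x _ => pairing_sum_right _ _ _
    have h2 : ∑ x ∈ X, ∑ y ∈ X, pairing (A (n y + 1) * s x) (s y) = R := by
      rw [hR', Finset.sum_comm]
    calc pairing H H ≤ ∑ x ∈ X, ∑ y ∈ X,
          4 * (pairing (A (n y + 1) * s x) (s y) + pairing (A (n x + 1) * s y) (s x)) := by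
          rw [h1]
          exact Finset.sum_le_sum fun x _ => Finset.sum_le_sum fun y _ => hterm x y
      _ = 4 * (R + R) := by
          simp_rw [← Finset.mul_sum, Finset.sum_add_distrib]
          rw [h2, ← hR']
      _ = 8 * R := by ring
  have hsq : ∑ y ∈ X, (A (n y + 1) * g).coeff y ^ 2 ≤ (K + 1) * Q := by
    have e1 : ∑ y ∈ X with n y + 1 < n₀, (A (n y + 1) * g).coeff y ^ 2 ≤ K * pairing g g :=
      hK {y ∈ X | n y + 1 < n₀} (fun y => n y + 1) (fun y hy => (Finset.mem_filter.1 hy).2) g hg0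
    have e2 : ∑ y ∈ X with ¬ n y + 1 < n₀, (A (n y + 1) * g).coeff y ^ 2 ≤ pairing g g := by
      have : ∀ y ∈ X.filter (fun y => ¬ n y + 1 < n₀),
          (A (n y + 1) * g).coeff y ^ 2 = (A n₀ * g).coeff y ^ 2 := by
        intro y hy
        rw [Finset.mem_filter] at hy
        have := hn y hy.1
        rw [show n y + 1 = n₀ by omega]
      rw [Finset.sum_congr rfl this]
      exact (sum_sq_le_pairing_self _ _).trans (hAc _ _)
    rw [hgg] at e1 e2
    rw [← Finset.sum_filter_add_sum_filter_not X (fun y => n y + 1 < n₀), add_mul, one_mul]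
    exact add_le_add e1 e2
  have hR2 : R ^ 2 ≤ (K + 1) * Q * Q :=
    (Finset.sum_mul_sq_le_sq_mul_sq X (fun y => (A (n y + 1) * g).coeff y) w).trans
      (mul_le_mul_of_nonneg_right hsq hQ0)
  clear_value Q R
  have hRK : 8 * R ≤ K' * Q := by
    refine (abs_le_of_sq_le_sq' ?_ (mul_nonneg hK' hQ0)).2
    have : 64 * (K + 1) * Q ^ 2 ≤ K' ^ 2 * Q ^ 2 :=
      mul_le_mul_of_nonneg_right hKK' (sq_nonneg Q)
    nlinarith
  have hf0 := pairing_self_nonneg f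
  have hfin : Q * Q ≤ K' * pairing f f * Q := by
    have := pairing_sq_le f H
    rw [← hQH] at this
    nlinarith [mul_le_mul_of_nonneg_left (hHH.trans hRK) hf0]
  rcases hQ0.eq_or_lt with h | h
  · rw [← h]; exact mul_nonneg hK' hf0
  · exact le_of_mul_le_mul_right hfin h

theorem MaximalBound.of_semigroup {A : ℕ → LatticeAlg d} (hA0 : ∀ n, Nonneg (A n))
    (hAr : ∀ n, reflect (A n) = A n)
    (hAc : ∀ n f, pairing (A n * f) (A n * f) ≤ pairing f f)
    (hAm : ∀ m n, m ≤ n → Nonneg ((4:ℝ) • A (n + 1) - A m * A n)) (n₀ : ℕ) :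
    MaximalBound A n₀ 66 := by
  have mono : ∀ K K' : ℝ, K ≤ K' → MaximalBound A n₀ K → MaximalBound A n₀ K' :=
    fun K K' h hK X n hn f hf =>
      (hK X n hn f hf).trans (mul_le_mul_of_nonneg_right h (pairing_self_nonneg f))
  have iter : ∀ k : ℕ, MaximalBound A n₀ (65 + n₀ / 2 ^ k) := by
    intro k
    induction k with
    | zero => exact mono _ _ (by simp) (MaximalBound.of_contraction hAc n₀)
    | succ k ih =>
      refine ih.improve hA0 hAr hAc hAm (by positivity) ?_
      rw [pow_succ (2:ℝ) k, ← div_div]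
      have : (0:ℝ) ≤ n₀ / 2 ^ k := by positivity
      nlinarith
  refine mono _ _ ?_ (iter n₀)
  have : (n₀:ℝ) / 2 ^ n₀ ≤ 1 := by
    rw [div_le_one (by positivity)]
    exact_mod_cast Nat.lt_two_pow_self.le
  linarith

theorem maximalBound_powAvg_lazyStep (hd : 1 ≤ d) (n₀ : ℕ) :
    MaximalBound (fun n => powAvg n (lazyStep d)) n₀ 66 :=
  MaximalBound.of_semigroup (fun n => powAvg_nonneg nonneg_lazyStep n)
    (fun n => reflect_powAvg reflect_lazyStep n) (fun n f => pairing_powAvg_lazyStep_le hd f n)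
    (fun _ _ h => nonneg_powAvg_succ_sub_mul nonneg_lazyStep h) n₀

theorem abs_cosSum_div_card_le_one (R : ℕ) (ξ : Fin d → ℝ) :
    |cosSum d R ξ / (latticeBall d R).card| ≤ 1 :=
  abs_div_card_le (by rw [one_mul]; exact abs_cosSum_le _ _ _)

theorem maximalBound_ballElt (hd : 1 ≤ d) (n₀ : ℕ) :
    MaximalBound (fun n => ballElt d (4 ^ n)) n₀ 10000528 := by
  intro X n hn f hf
  have hpt : ∀ (m : ℕ) (x : Fin d → ℤ), (ballElt d (4 ^ m) * f).coeff x ^ 2 ≤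
      2 * (errorElt d m * f).coeff x ^ 2 + 8 * (powAvg m (lazyStep d) * f).coeff x ^ 2 := by
    intro m x
    set c := (if 2 * 4 ^ m < d then
      (cosSum d (4 ^ m) fun _ => 1 / 2) / (latticeBall d (4 ^ m)).card else (0:ℝ)) with hc
    have hc1 : |c| ≤ 1 := by
      rw [hc]; split_ifs
      · exact abs_cosSum_div_card_le_one _ _
      · simp
    have hB : (ballElt d (4 ^ m) * f).coeff x = (errorElt d m * f).coeff x +
        (powAvg m (lazyStep d) * f).coeff x + c * (powAvg m (1 - lazyStep d) * f).coeff x := by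
      have : ballElt d (4 ^ m) * f = errorElt d m * f + powAvg m (lazyStep d) * f +
          c • (powAvg m (1 - lazyStep d) * f) := by
        rw [errorElt, ← hc, sub_mul, sub_mul, smul_mul_assoc]; abel
      rw [this]; simp
    have hdom := ((dominated_one_sub_lazyStep (d := d)).powAvg m |>.mul hf.dominated).abs_le x
    rw [hB]
    set a := (powAvg m (lazyStep d) * f).coeff x
    set b := (powAvg m (1 - lazyStep d) * f).coeff x
    set e := (errorElt d m * f).coeff x
    have hcb : |c * b| ≤ a := by
      rw [abs_mul]
      exact (mul_le_of_le_one_left (abs_nonneg _) hc1).trans hdom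
    have := abs_le.1 hcb
    nlinarith [sq_nonneg (e - (a + c * b)), mul_nonneg (sub_nonneg.2 this.1) (sub_nonneg.2 this.2)]
  have h1 := (sum_sq_coeff_le_sum_pairing (errorElt d) hn f).trans (sum_pairing_errorElt_le hd f n₀)
  have h2 := maximalBound_powAvg_lazyStep hd n₀ X n hn f hf
  calc ∑ x ∈ X, (ballElt d (4 ^ n x) * f).coeff x ^ 2
      ≤ 2 * ∑ x ∈ X, (errorElt d (n x) * f).coeff x ^ 2 +
        8 * ∑ x ∈ X, (powAvg (n x) (lazyStep d) * f).coeff x ^ 2 := by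
        rw [Finset.mul_sum, Finset.mul_sum, ← Finset.sum_add_distrib]
        exact Finset.sum_le_sum fun x _ => hpt _ x
    _ ≤ 10000528 * pairing f f := by linarith

theorem coeff_ballElt_mul (R : ℕ) (f : LatticeAlg d) (x : Fin d → ℤ) :
    (ballElt d R * f).coeff x =
      (∑ y ∈ latticeBall d R, f.coeff (x - y)) / (latticeBall d R).card := by
  rw [ballElt, Finset.sum_mul, AddMonoidAlgebra.coeff_sum, Finsupp.finsetSum_apply, Finset.sum_div]
  refine Finset.sum_congr rfl fun y _ => ?_
  rw [AddMonoidAlgebra.coeff_single_mul_apply, neg_add_eq_sub]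
  ring

end LatticeAlg

/-- The average of a real function over the lattice points in the ball of squared radius `R`. -/
noncomputable def latticeBallAvg (d R : ℕ) (F : (Fin d → ℤ) → ℝ) (x : Fin d → ℤ) : ℝ :=
  (∑ y ∈ latticeBall d R, F (x - y)) / (latticeBall d R).card

theorem exists_sum_latticeBallAvg_sq_le {d : ℕ} (hd : 1 ≤ d) {F : (Fin d → ℤ) → ℝ}
    (hF : ∀ x, 0 ≤ F x) (X : Finset (Fin d → ℤ)) (n : (Fin d → ℤ) → ℕ) :
    ∃ Y : Finset (Fin d → ℤ), ∑ x ∈ X, latticeBallAvg d (4 ^ n x) F x ^ 2 ≤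
      10000528 * ∑ y ∈ Y, F y ^ 2 := by
  classical
  set Y := X.biUnion fun x => (latticeBall d (4 ^ n x)).image fun y => x - y with hY
  set f : LatticeAlg d := ∑ y ∈ Y, AddMonoidAlgebra.single y (F y) with hf
  have hf0 : LatticeAlg.Nonneg f :=
    LatticeAlg.Nonneg.sum fun y _ => LatticeAlg.nonneg_single y (hF y)
  refine ⟨Y, ?_⟩
  have hff : LatticeAlg.pairing f f = ∑ y ∈ Y, F y ^ 2 := by
    conv_lhs => rw [hf, LatticeAlg.pairing_sum_right]
    refine Finset.sum_congr rfl fun x hx => ?_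
    rw [LatticeAlg.pairing_single_right, LatticeAlg.coeff_sum_single F hx, sq]
  rw [← hff]
  have hn : ∀ x ∈ X, n x < X.sup n + 1 := fun x hx => Nat.lt_succ_of_le (Finset.le_sup hx)
  refine le_trans (le_of_eq ?_) (LatticeAlg.maximalBound_ballElt hd (X.sup n + 1) X n hn f hf0)
  refine Finset.sum_congr rfl fun x hx => ?_
  rw [LatticeAlg.coeff_ballElt_mul, latticeBallAvg]
  congr 2
  refine Finset.sum_congr rfl fun y hy => ?_
  rw [hf, LatticeAlg.coeff_sum_single F]
  exact Finset.mem_biUnion.2 ⟨x, hx, Finset.mem_image_of_mem _ hy⟩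

theorem latticeBallAvg_nonneg {d R : ℕ} {F : (Fin d → ℤ) → ℝ} (hF : ∀ x, 0 ≤ F x)
    (x : Fin d → ℤ) : 0 ≤ latticeBallAvg d R F x :=
  div_nonneg (Finset.sum_nonneg fun _ _ => hF _) (Nat.cast_nonneg _)

theorem latticeBallAvg_rpow_le {d R : ℕ} {F : (Fin d → ℤ) → ℝ} (hF : ∀ x, 0 ≤ F x)
    (x : Fin d → ℤ) {q : ℝ} (hq : 1 ≤ q) :
    latticeBallAvg d R F x ^ q ≤ latticeBallAvg d R (fun y => F y ^ q) x := by
  have hV := latticeBall_card_pos d R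
  have := Real.rpow_arith_mean_le_arith_mean_rpow (latticeBall d R)
    (fun _ => 1 / (latticeBall d R).card) (fun y => F (x - y)) (fun _ _ => by positivity)
    (by rw [Finset.sum_const, nsmul_eq_mul]; field_simp) (fun _ _ => hF _) hq
  simp_rw [← Finset.mul_sum] at this
  rw [latticeBallAvg, latticeBallAvg, div_eq_inv_mul, div_eq_inv_mul]
  simpa only [one_div] using this

theorem exists_sum_latticeBallAvg_rpow_le {d : ℕ} (hd : 1 ≤ d) {F : (Fin d → ℤ) → ℝ}
    (hF : ∀ x, 0 ≤ F x) {p : ℝ} (hp : 2 ≤ p) (X : Finset (Fin d → ℤ)) (n : (Fin d → ℤ) → ℕ) :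
    ∃ Y : Finset (Fin d → ℤ), ∑ x ∈ X, latticeBallAvg d (4 ^ n x) F x ^ p ≤
      10000528 * ∑ y ∈ Y, F y ^ p := by
  have hsq : ∀ a : ℝ, 0 ≤ a → (a ^ (p / 2)) ^ 2 = a ^ p := by
    intro a ha
    rw [← Real.rpow_mul_natCast ha]
    congr 1
    push_cast; ring
  obtain ⟨Y, hY⟩ := exists_sum_latticeBallAvg_sq_le hd (F := fun y => F y ^ (p / 2))
    (fun y => Real.rpow_nonneg (hF y) _) X n
  refine ⟨Y, ?_⟩
  simp_rw [fun y => hsq (F y) (hF y)] at hY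
  refine le_trans (Finset.sum_le_sum fun x _ => ?_) hY
  rw [← hsq _ (latticeBallAvg_nonneg hF x)]
  exact pow_le_pow_left₀ (Real.rpow_nonneg (latticeBallAvg_nonneg hF x) _)
    (latticeBallAvg_rpow_le hF x (by linarith)) 2

theorem latticeBallSet_two_pow (d n : ℕ) :
    latticeBallSet d ((2 : ℝ) ^ n) = (latticeBall d (4 ^ n) : Set (Fin d → ℤ)) := by
  ext y
  rw [Finset.mem_coe, mem_latticeBall, latticeBallSet, Set.mem_ofPred_eq, ← pow_mul, mul_comm n,
    pow_mul]
  norm_num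
  exact_mod_cast Iff.rfl

theorem norm_ballAvg_le (d n : ℕ) (f : (Fin d → ℤ) → ℂ) (x : Fin d → ℤ) :
    ‖ballAvg d ((2 : ℝ) ^ n) f x‖ ≤ latticeBallAvg d (4 ^ n) (fun y => ‖f y‖) x := by
  rw [ballAvg, latticeBallSet_two_pow, Set.ncard_coe_finset, finsum_mem_coe_finset, norm_div,
    Complex.norm_natCast, latticeBallAvg]
  exact div_le_div_of_nonneg_right (norm_sum_le _ _) (Nat.cast_nonneg _)

theorem sum_ballAvg_rpow_le {d : ℕ} (hd : 1 ≤ d) {p : ℝ} (hp : 2 ≤ p) (f : (Fin d → ℤ) → ℂ)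
    (X : Finset (Fin d → ℤ)) (n : (Fin d → ℤ) → ℕ) :
    ∑ x ∈ X, (‖ballAvg d ((2 : ℝ) ^ n x) f x‖₊ : ℝ≥0∞) ^ p ≤
      ENNReal.ofReal 10000528 * ∑' x, (‖f x‖₊ : ℝ≥0∞) ^ p := by
  have hp0 : 0 ≤ p := by linarith
  have hnn : ∀ z : ℂ, (‖z‖₊ : ℝ≥0∞) ^ p = ENNReal.ofReal (‖z‖ ^ p) := fun z => by
    rw [← ENNReal.ofReal_rpow_of_nonneg (norm_nonneg z) hp0, ofReal_norm]; rfl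
  obtain ⟨Y, hY⟩ := exists_sum_latticeBallAvg_rpow_le hd (F := fun y => ‖f y‖)
    (fun y => norm_nonneg _) hp X n
  refine le_trans ?_ (mul_le_mul_right (ENNReal.sum_le_tsum Y) _)
  simp_rw [hnn]
  rw [← ENNReal.ofReal_sum_of_nonneg fun _ _ => by positivity,
    ← ENNReal.ofReal_sum_of_nonneg fun _ _ => by positivity,
    ← ENNReal.ofReal_mul (by norm_num)]
  refine ENNReal.ofReal_le_ofReal (le_trans (Finset.sum_le_sum fun x _ => ?_) hY)
  exact Real.rpow_le_rpow (norm_nonneg _) (norm_ballAvg_le _ _ _ _) hp0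

theorem tsum_iSup_ballAvg_rpow_le {d : ℕ} (hd : 1 ≤ d) {p : ℝ} (hp : 2 ≤ p)
    (f : (Fin d → ℤ) → ℂ) :
    ∑' x, (⨆ n : ℕ, (‖ballAvg d ((2 : ℝ) ^ n) f x‖₊ : ℝ≥0∞)) ^ p ≤
      ENNReal.ofReal 10000528 * ∑' x, (‖f x‖₊ : ℝ≥0∞) ^ p := by
  set u : (Fin d → ℤ) → ℕ → ℝ≥0∞ :=
    fun x n => (‖ballAvg d ((2 : ℝ) ^ n) f x‖₊ : ℝ≥0∞) ^ p with hu
  have hsup : ∀ x, (⨆ n : ℕ, (‖ballAvg d ((2 : ℝ) ^ n) f x‖₊ : ℝ≥0∞)) ^ p =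
      ⨆ N, partialSups (u x) N := by
    intro x
    rw [iSup_partialSups_eq]
    exact (ENNReal.orderIsoRpow p (by linarith)).map_iSup _
  simp_rw [hsup]
  rw [ENNReal.tsum_eq_iSup_sum]
  refine iSup_le fun X => ?_
  rw [ENNReal.finsetSum_iSup_of_monotone fun x => partialSups_monotone (u x)]
  refine iSup_le fun N => ?_
  choose n _ hn using fun x => exists_partialSups_eq (u x) N
  simp_rw [hn]
  exact sum_ballAvg_rpow_le hd hp f X n

/-- Dimension-free `ℓ_p` bound, `2 ≤ p < ∞`, for the discrete dyadic
Hardy–Littlewood maximal operator over Euclidean balls. -/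
theorem dimension_free_discrete_dyadic_maximal (p : ℝ) (hp : 2 ≤ p) :
    ∃ C : ℝ, 0 < C ∧
      ∀ d : ℕ, 1 ≤ d → ∀ f : (Fin d → ℤ) → ℂ,
        lpNorm d p (fun x => ⨆ n : ℕ, (‖ballAvg d ((2 : ℝ) ^ n) f x‖₊ : ℝ≥0∞)) ≤
          ENNReal.ofReal C * lpNorm d p (fun x => (‖f x‖₊ : ℝ≥0∞)) := by
  refine ⟨10000528, by norm_num, fun d hd f => ?_⟩
  have hp1 : 0 ≤ 1 / p := by positivity
  refine (ENNReal.rpow_le_rpow (tsum_iSup_ballAvg_rpow_le hd hp f) hp1).trans ?_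
  rw [ENNReal.mul_rpow_of_nonneg _ _ hp1]
  refine mul_le_mul_left ?_ _
  refine (ENNReal.rpow_le_rpow_of_exponent_le (y := 1 / p) (z := 1) ?_ ?_).trans
    (ENNReal.rpow_one _).le
  · rw [← ENNReal.ofReal_one]; exact ENNReal.ofReal_le_ofReal (by norm_num)
  · rw [div_le_one (by linarith)]; linarith
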